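/- Knutson–Tao completeness via networks (consequence): every tableau (t_i^k), 0 ≤ i ≤ k ≤ n, in the hive cone C_3 with t_0^0 = 0 arises as (m_i^k(ε)) for some weighting ε of the concatenation Γ_0 ∘ Δ_0, where Γ_0 is the triangular network and Δ_0 the trivial network of n parallel horizontal edges; consequently the image of the boundary map ∂ ∘ M_{Γ_0Δ_0} equals the closure of the Horn cone of eigenvalue triples (λ, μ, ν) of Hermitian matrices A + B = C. -/

import Mathlib

open scoped BigOperators

/-- A planar network: a finite graph embedded in the vertical strip
`{a ≤ x ≤ b}` with straight-line, non-vertical edges, oriented from left to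
right; edge segments meet only at common endpoints, and no vertex lies in the
interior of an edge. -/
structure PlanarNetwork where
  a : ℝ
  b : ℝ
  hab : a < b
  V : Finset (ℝ × ℝ)
  E : Finset ((ℝ × ℝ) × (ℝ × ℝ))
  strip : ∀ p ∈ V, a ≤ p.1 ∧ p.1 ≤ b
  ends : ∀ e ∈ E, e.1 ∈ V ∧ e.2 ∈ V ∧ e.1.1 < e.2.1
  embed : ∀ e ∈ E, ∀ f ∈ E, e ≠ f →
    ∀ x ∈ openSegment ℝ e.1 e.2, x ∉ segment ℝ f.1 f.2
  embedV : ∀ e ∈ E, ∀ p ∈ V, p ∉ openSegment ℝ e.1 e.2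

/-- The network has `n` sources on the left boundary and `n` sinks on the
right boundary, at heights `1, …, n`. -/
def PlanarNetwork.HasRank (Γ : PlanarNetwork) (n : ℕ) : Prop :=
  (∀ p ∈ Γ.V, p.1 = Γ.a → ∃ j : ℕ, 1 ≤ j ∧ j ≤ n ∧ p.2 = (j : ℝ)) ∧
  (∀ p ∈ Γ.V, p.1 = Γ.b → ∃ j : ℕ, 1 ≤ j ∧ j ≤ n ∧ p.2 = (j : ℝ)) ∧
  (∀ j : ℕ, 1 ≤ j → j ≤ n →
    (Γ.a, (j : ℝ)) ∈ Γ.V ∧ (Γ.b, (j : ℝ)) ∈ Γ.V)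

/-- The weight of a path (recorded as the list of its vertices): the sum of
the weights of its edges. -/
def pathWeight {α : Type*} [AddCommMonoid α]
    (ε : (ℝ × ℝ) × (ℝ × ℝ) → α) (L : List (ℝ × ℝ)) : α :=
  ((L.zip L.tail).map ε).sum

/-- `L` is a directed path in `Γ` from `p` to `q`. -/
def IsPathBetween (Γ : PlanarNetwork) (p q : ℝ × ℝ) (L : List (ℝ × ℝ)) : Prop :=
  L ≠ [] ∧ List.Chain' (fun u v => (u, v) ∈ Γ.E) L ∧
    L.head? = some p ∧ L.getLast? = some q

/-- `L` is a directed path in `Γ` from a source to a sink. -/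
def IsThroughPath (Γ : PlanarNetwork) (L : List (ℝ × ℝ)) : Prop :=
  ∃ p q, IsPathBetween Γ p q L ∧ p.1 = Γ.a ∧ q.1 = Γ.b

/-- `L` is a source-to-sink path of the subnetwork `Γ^{(k)}` (both endpoints
at height at most `k`). -/
def IsBoundedPath (Γ : PlanarNetwork) (k : ℕ) (L : List (ℝ × ℝ)) : Prop :=
  ∃ p q, IsPathBetween Γ p q L ∧ p.1 = Γ.a ∧ q.1 = Γ.b ∧
    p.2 ≤ (k : ℝ) ∧ q.2 ≤ (k : ℝ)

/-- Pairwise vertex-disjointness of a family of paths. -/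
def PairwiseVertexDisjoint {m : ℕ} (F : Fin m → List (ℝ × ℝ)) : Prop :=
  ∀ j j', j ≠ j' → ∀ v ∈ F j, v ∉ F j'

/-- The set of total weights of `ΓΔ`-paths in `P_i^k`. -/
def gdWeights (Γ Δ : PlanarNetwork) (ε : (ℝ × ℝ) × (ℝ × ℝ) → ℝ)
    (i k : ℕ) : Set ℝ :=
  { x | ∃ (G : Fin k → List (ℝ × ℝ)) (D : Fin i → List (ℝ × ℝ)),
      (∀ j, IsThroughPath Γ (G j)) ∧ (∀ j, IsThroughPath Δ (D j)) ∧
      PairwiseVertexDisjoint G ∧ PairwiseVertexDisjoint D ∧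
      (∀ j, ∃ m, (D j).head? = (G m).getLast?) ∧
      x = (∑ j, pathWeight ε (G j)) + (∑ j, pathWeight ε (D j)) }

/-- Membership in the Knutson–Tao hive cone `C₃`. -/
def MemC3 (n : ℕ) (t : ℕ → ℕ → ℝ) : Prop :=
  ∀ i k, 0 < i → i ≤ k → k < n →
    t i (k + 1) + t (i - 1) k ≥ t (i - 1) (k + 1) + t i k ∧
    t i (k + 1) + t i k ≥ t (i + 1) (k + 1) + t (i - 1) k ∧
    t i k + t (i - 1) k ≥ t i (k + 1) + t (i - 1) (k - 1)

/-- The Horn cone: triples of decreasingly ordered spectra of Hermitian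
matrices `A`, `B`, `C = A + B`. -/
def HornCone (n : ℕ) : Set ((Fin n → ℝ) × (Fin n → ℝ) × (Fin n → ℝ)) :=
  { p | ∃ (A B : Matrix (Fin n) (Fin n) ℂ) (hA : A.IsHermitian)
      (hB : B.IsHermitian) (hC : (A + B).IsHermitian),
      Antitone p.1 ∧ Antitone p.2.1 ∧ Antitone p.2.2 ∧
      (∃ σ : Equiv.Perm (Fin n), p.1 = hA.eigenvalues ∘ σ) ∧
      (∃ σ : Equiv.Perm (Fin n), p.2.1 = hB.eigenvalues ∘ σ) ∧
      (∃ σ : Equiv.Perm (Fin n), p.2.2 = hC.eigenvalues ∘ σ) }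

set_option linter.unusedSectionVars false

open Matrix Polynomial in
/-- `A` is Hermitian and its spectrum, counted with multiplicity, is `s`. -/
def SpecIs {ι : Type*} [Fintype ι] [DecidableEq ι] (A : Matrix ι ι ℂ) (s : Multiset ℝ) : Prop :=
  A.IsHermitian ∧ A.charpoly = (s.map fun x : ℝ => X - C (x : ℂ)).prod

/-- The real diagonal matrix with diagonal `d`, viewed as a complex matrix. -/
noncomputable def rdiag {ι : Type*} [DecidableEq ι] (d : ι → ℝ) : Matrix ι ι ℂ :=
  Matrix.diagonal fun i => (d i : ℂ)

/-- The multiset of values of a function on a finite type. -/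
def valuesOf {ι : Type*} [Fintype ι] (a : ι → ℝ) : Multiset ℝ := Finset.univ.val.map a

section SpecBasics

open Matrix Polynomial

variable {ι κ : Type*} [Fintype ι] [DecidableEq ι] [Fintype κ] [DecidableEq κ]

theorem rdiag_isHermitian (d : ι → ℝ) : (rdiag d).IsHermitian := by
  rw [rdiag, Matrix.IsHermitian, Matrix.diagonal_conjTranspose]
  congr 1; ext i; simp

theorem prod_X_sub_injective {s t : Multiset ℝ}
    (h : (s.map fun x : ℝ => X - C (x : ℂ)).prod = (t.map fun x : ℝ => X - C (x : ℂ)).prod) : s = t := by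
  have h1 : ∀ s : Multiset ℝ, ((s.map fun x : ℝ => X - C (x : ℂ)).prod).roots = s.map (fun x : ℝ => (x:ℂ)) := by
    intro s
    have := Polynomial.roots_multiset_prod_X_sub_C (s.map (fun x : ℝ => (x:ℂ)))
    rwa [Multiset.map_map] at this
  have h2 := congrArg Polynomial.roots h
  rw [h1, h1] at h2
  exact Multiset.map_injective Complex.ofReal_injective h2

theorem SpecIs.unique {A : Matrix ι ι ℂ} {s t : Multiset ℝ} (h : SpecIs A s) (h' : SpecIs A t) :
    s = t := prod_X_sub_injective (h.2.symm.trans h'.2)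

theorem Matrix.IsHermitian.specIs {A : Matrix ι ι ℂ} (hA : A.IsHermitian) :
    SpecIs A (valuesOf hA.eigenvalues) := by
  refine ⟨hA, ?_⟩
  rw [hA.charpoly_eq, valuesOf, Multiset.map_map]; rfl

theorem exists_perm_of_valuesOf_eq {a b : ι → ℝ} (h : valuesOf a = valuesOf b) :
    ∃ σ : Equiv.Perm ι, a = b ∘ σ := by
  classical
  have : ∀ x, Fintype.card {i // a i = x} = Fintype.card {i // b i = x} := by
    intro x
    have h2 := congrArg (Multiset.count x) h
    simp only [valuesOf, Multiset.count_map] at h2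
    rw [Fintype.card_subtype, Fintype.card_subtype]
    simpa [Finset.card, eq_comm] using h2
  have e : ∀ x, {i // a i = x} ≃ {i // b i = x} := fun x => Fintype.equivOfCardEq (this x)
  refine ⟨((Equiv.sigmaFiberEquiv a).symm.trans (Equiv.sigmaCongrRight e)).trans
    (Equiv.sigmaFiberEquiv b), ?_⟩
  ext i
  simp only [Function.comp, Equiv.trans_apply, Equiv.sigmaFiberEquiv, Equiv.coe_fn_mk,
    Equiv.coe_fn_symm_mk, Equiv.sigmaCongrRight_apply]
  exact ((e (a i)) ⟨i, rfl⟩).2.symm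

theorem valuesOf_comp_perm (a : ι → ℝ) (σ : Equiv.Perm ι) : valuesOf (a ∘ σ) = valuesOf a := by
  simp only [valuesOf]
  rw [← Multiset.map_map, Multiset.map_univ_val_equiv]

theorem valuesOf_comp_equiv (a : ι → ℝ) (σ : κ ≃ ι) : valuesOf (a ∘ σ) = valuesOf a := by
  simp only [valuesOf]
  rw [← Multiset.map_map, Multiset.map_univ_val_equiv]

@[simp] theorem card_valuesOf (a : ι → ℝ) : (valuesOf a).card = Fintype.card ι := by
  simp [valuesOf]

theorem SpecIs.card {A : Matrix ι ι ℂ} {s : Multiset ℝ} (h : SpecIs A s) :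
    s.card = Fintype.card ι := by
  rw [h.unique h.1.specIs]; simp

theorem SpecIs.reindex {A : Matrix ι ι ℂ} {s : Multiset ℝ} (h : SpecIs A s) (e : ι ≃ κ) :
    SpecIs (Matrix.reindex e e A) s :=
  ⟨h.1.submatrix _, by rw [Matrix.charpoly_reindex]; exact h.2⟩

theorem SpecIs.fromBlocks {A : Matrix ι ι ℂ} {B : Matrix κ κ ℂ} {s t : Multiset ℝ}
    (h : SpecIs A s) (h' : SpecIs B t) : SpecIs (Matrix.fromBlocks A 0 0 B) (s + t) := by
  refine ⟨Matrix.IsHermitian.fromBlocks h.1 (by simp) h'.1, ?_⟩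
  rw [Matrix.charpoly_fromBlocks_zero₁₂, h.2, h'.2, Multiset.map_add, Multiset.prod_add]

theorem charpoly_conj {U A : Matrix ι ι ℂ} (hU : U ∈ Matrix.unitaryGroup ι ℂ) :
    (U * A * star U).charpoly = A.charpoly := by
  rw [Matrix.charpoly_mul_comm, ← mul_assoc, Unitary.star_mul_self_of_mem hU, one_mul]

theorem SpecIs.conj {U A : Matrix ι ι ℂ} {s : Multiset ℝ} (h : SpecIs A s)
    (hU : U ∈ Matrix.unitaryGroup ι ℂ) : SpecIs (U * A * star U) s :=
  ⟨Matrix.isHermitian_mul_mul_conjTranspose U h.1, by rw [charpoly_conj hU, h.2]⟩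

theorem SpecIs.conj' {U A : Matrix ι ι ℂ} {s : Multiset ℝ} (h : SpecIs A s)
    (hU : U ∈ Matrix.unitaryGroup ι ℂ) : SpecIs (star U * A * U) s := by
  have := h.conj (Unitary.star_mem hU)
  rwa [star_star] at this

theorem specIs_rdiag (d : ι → ℝ) : SpecIs (rdiag d) (valuesOf d) := by
  refine ⟨rdiag_isHermitian d, ?_⟩
  rw [rdiag, Matrix.charpoly_diagonal, valuesOf, Multiset.map_map]; rfl

theorem Matrix.IsHermitian.exists_unitary {A : Matrix ι ι ℂ} (hA : A.IsHermitian) :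
    ∃ U ∈ Matrix.unitaryGroup ι ℂ, A = U * rdiag hA.eigenvalues * star U := by
  refine ⟨hA.eigenvectorUnitary, hA.eigenvectorUnitary.2, ?_⟩
  conv_lhs => rw [hA.spectral_theorem, Unitary.conjStarAlgAut_apply]
  rfl

theorem rdiag_comp_perm (d : ι → ℝ) (σ : Equiv.Perm ι) :
    ∃ W ∈ Matrix.unitaryGroup ι ℂ, rdiag (d ∘ σ) = W * rdiag d * star W := by
  refine ⟨σ.permMatrix ℂ, ?_, ?_⟩
  · rw [Matrix.mem_unitaryGroup_iff, Matrix.star_eq_conjTranspose, Matrix.conjTranspose_permMatrix,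
      ← Matrix.permMatrix_mul]
    simp
  · rw [Matrix.star_eq_conjTranspose, Matrix.conjTranspose_permMatrix]
    ext i j
    rw [Equiv.Perm.permMatrix, Equiv.Perm.permMatrix, Matrix.mul_assoc,
      PEquiv.toMatrix_toPEquiv_mul, PEquiv.mul_toMatrix_toPEquiv]
    simp only [rdiag, Matrix.diagonal_apply, Matrix.submatrix_apply, Function.comp, id]
    have : (Equiv.symm σ⁻¹) j = σ j := by rw [Equiv.symm_apply_eq]; simp
    rw [this]
    simp

theorem SpecIs.exists_unitary {A : Matrix ι ι ℂ} {a : ι → ℝ} (h : SpecIs A (valuesOf a)) :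
    ∃ U ∈ Matrix.unitaryGroup ι ℂ, A = U * rdiag a * star U := by
  obtain ⟨σ, hσ⟩ := exists_perm_of_valuesOf_eq (h.1.specIs.unique h)
  obtain ⟨U, hU, hA⟩ := h.1.exists_unitary
  obtain ⟨W, hW, hd⟩ := rdiag_comp_perm a σ
  refine ⟨U * W, mul_mem hU hW, ?_⟩
  conv_lhs => rw [hA]
  rw [hσ, hd, star_mul]; simp only [mul_assoc]

theorem specIs_unitary_conj {U : Matrix ι ι ℂ} (hU : U ∈ Matrix.unitaryGroup ι ℂ) (a : ι → ℝ) :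
    SpecIs (U * rdiag a * star U) (valuesOf a) := (specIs_rdiag a).conj hU

theorem SpecIs.trace {A : Matrix ι ι ℂ} {a : ι → ℝ} (h : SpecIs A (valuesOf a)) :
    A.trace = ((∑ i, a i : ℝ) : ℂ) := by
  obtain ⟨U, hU, rfl⟩ := h.exists_unitary
  rw [Matrix.trace_mul_comm, ← mul_assoc, Unitary.star_mul_self_of_mem hU, one_mul, rdiag,
    Matrix.trace_diagonal]
  push_cast; rfl

theorem exists_valuesOf_eq {n : ℕ} {s : Multiset ℝ} (h : s.card = n) :
    ∃ a : Fin n → ℝ, Antitone a ∧ valuesOf a = s := by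
  subst h
  have hl : (s.sort (· ≥ ·)).length = s.card := Multiset.length_sort _
  refine ⟨fun i => (s.sort (· ≥ ·)).get (i.cast hl.symm), ?_, ?_⟩
  · intro i j hij
    have := (Multiset.pairwise_sort s (· ≥ ·)).rel_get_of_le (a := i.cast hl.symm) (b := j.cast hl.symm) hij
    simpa using this
  · have h1 : valuesOf (fun i : Fin s.card => (s.sort (· ≥ ·)).get (i.cast hl.symm))
      = valuesOf (s.sort (· ≥ ·)).get :=
      valuesOf_comp_equiv (s.sort (· ≥ ·)).get (finCongr hl.symm)
    rw [h1, valuesOf]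
    conv_rhs => rw [← Multiset.sort_eq s (· ≥ ·)]
    rw [Fin.univ_val_map, List.ofFn_get]

end SpecBasics

section AbstractPerturbation

open NormedSpace Filter Topology

variable {R P : Type*} [NormedRing R] [NormedAlgebra ℝ R] [CompleteSpace R]
  [NormedAddCommGroup P] [NormedSpace ℝ P] [CompleteSpace P]

/-- The defect of the equation `D₁ A D₁ + D₃ = C + θ`, with `A` and `C` moved by conjugation with
exponentials of elements `S Z`. -/
noncomputable def defect (D A T C : P → R) (S : R →L[ℝ] R)
    (x : P × (R × R × ℝ × R)) : R :=
  D x.1 * (exp (S x.2.1) * A x.1 * exp (-S x.2.1)) * D x.1 + T x.1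
    - exp (S x.2.2.1) * C x.1 * exp (-S x.2.2.1) - x.2.2.2.1 • (1 : R) + S x.2.2.2.2

theorem contDiff_defect {D A T C : P → R} (hD : ContDiff ℝ 1 D) (hA : ContDiff ℝ 1 A)
    (hT : ContDiff ℝ 1 T) (hC : ContDiff ℝ 1 C) (S : R →L[ℝ] R) :
    ContDiff ℝ 1 (defect D A T C S) := by
  have hexp : ContDiff ℝ 1 (NormedSpace.exp : R → R) :=
    contDiff_iff_contDiffAt.mpr fun x => (NormedSpace.exp_analytic (𝕂 := ℝ) x).contDiffAt
  unfold defect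
  fun_prop

theorem hasDerivAt_defect (D A T C : P → R) (S : R →L[ℝ] R) (p : P) (z : R × R × ℝ × R) :
    HasDerivAt (fun t : ℝ => defect D A T C S (p, t • z))
      (D p * (S z.1 * A p - A p * S z.1) * D p - (S z.2.1 * C p - C p * S z.2.1)
        - z.2.2.1 • (1 : R) + S z.2.2.2) 0 := by
  have he : ∀ X : R, HasDerivAt (fun t : ℝ => exp (t • X)) X 0 := by
    intro X
    have := hasDerivAt_exp_smul_const (𝕂 := ℝ) X 0
    simpa using this
  have hconj : ∀ X A : R,
      HasDerivAt (fun t : ℝ => exp (t • X) * A * exp (t • (-X))) (X * A - A * X) 0 := by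
    intro X A
    have := ((he X).mul_const A).mul (he (-X))
    simpa [sub_eq_add_neg, Pi.mul_def] using this
  have h1 := ((((hconj (S z.1) (A p)).const_mul (D p)).mul_const
    (D p)).add_const (T p)).sub (hconj (S z.2.1) (C p))
  have h2 : HasDerivAt (fun t : ℝ => (t * z.2.2.1) • (1 : R)) (z.2.2.1 • 1) 0 := by
    have := ((hasDerivAt_id (0:ℝ)).mul_const z.2.2.1).smul_const (1 : R)
    simpa using this
  have h3 : HasDerivAt (fun t : ℝ => t • S z.2.2.2) (S z.2.2.2) 0 := by
    have := (hasDerivAt_id (0:ℝ)).smul_const (S z.2.2.2)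
    simpa using this
  refine ((h1.sub h2).add h3).congr_of_eventuallyEq (Filter.Eventually.of_forall fun t => ?_)
  simp only [defect, Prod.smul_fst, Prod.smul_snd, map_smul, smul_neg, smul_eq_mul,
    Pi.add_apply, Pi.sub_apply]

theorem eventually_defect_eq_zero {D A T C : P → R} {S : R →L[ℝ] R} {p : P}
    (hD : ContDiff ℝ 1 D) (hA : ContDiff ℝ 1 A) (hT : ContDiff ℝ 1 T) (hC : ContDiff ℝ 1 C)
    (heq : D p * A p * D p + T p = C p)
    (hsurj : Function.Surjective fun z : R × R × ℝ × R =>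
      D p * (S z.1 * A p - A p * S z.1) * D p - (S z.2.1 * C p - C p * S z.2.1)
        - z.2.2.1 • (1 : R) + S z.2.2.2) :
    ∀ᶠ q in 𝓝 p, ∃ z, defect D A T C S (q, z) = 0 := by
  set x0 : P × (R × R × ℝ × R) := (p, 0) with hx0
  have hd : HasStrictFDerivAt (defect D A T C S) (fderiv ℝ (defect D A T C S) x0) x0 :=
    (contDiff_defect hD hA hT hC S).contDiffAt.hasStrictFDerivAt one_ne_zero
  have hΦ : HasStrictFDerivAt (fun x : P × (R × R × ℝ × R) => (x.1, defect D A T C S x))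
    ((ContinuousLinearMap.fst ℝ _ _).prod (fderiv ℝ (defect D A T C S) x0)) x0 :=
    hasStrictFDerivAt_fst.prodMk hd
  have hdir : ∀ z, fderiv ℝ (defect D A T C S) x0 (0, z) = D p * (S z.1 * A p - A p * S z.1) * D p
      - (S z.2.1 * C p - C p * S z.2.1) - z.2.2.1 • (1 : R) + S z.2.2.2 := by
    intro z
    have hl : HasDerivAt (fun t : ℝ => (p, t • z)) ((0 : P), z) 0 := by
      have h1 := (hasDerivAt_id (0:ℝ)).smul_const z
      simp only [id, one_smul] at h1
      exact (hasDerivAt_const (0:ℝ) p).prodMk h1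
    have hd' : HasFDerivAt (defect D A T C S) (fderiv ℝ (defect D A T C S) x0)
        ((fun t : ℝ => (p, t • z)) 0) := by
      simpa [hx0] using hd.hasFDerivAt
    have h2 := HasFDerivAt.comp_hasDerivAt (l := defect D A T C S) (0:ℝ) hd' hl
    exact HasDerivAt.unique (f := fun t : ℝ => defect D A T C S (p, t • z)) h2
      (hasDerivAt_defect D A T C S p z)
  have hrange : ((ContinuousLinearMap.fst ℝ _ _).prod
      (fderiv ℝ (defect D A T C S) x0)).range = ⊤ := by
    rw [LinearMap.range_eq_top]
    rintro ⟨q, W⟩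
    obtain ⟨z, hz⟩ := hsurj (W - fderiv ℝ (defect D A T C S) x0 (q, 0))
    refine ⟨(q, z), ?_⟩
    beta_reduce at hz
    have : (q, z) = (q, 0) + (0, z) := by simp
    refine Prod.ext rfl ?_
    change fderiv ℝ (defect D A T C S) x0 (q, z) = W
    rw [this, map_add, hdir, hz]; abel
  have hmap := hΦ.map_nhds_eq_of_surj hrange
  have hzero : defect D A T C S x0 = 0 := by
    simp [defect, hx0, heq]
  have hmem : Set.range (fun x : P × (R × R × ℝ × R) => (x.1, defect D A T C S x)) ∈
      𝓝 (p, (0 : R)) := by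
    have h1 : (x0.1, defect D A T C S x0) = (p, 0) := by rw [hzero]
    rw [← h1, ← hmap]
    exact Filter.mem_map.mpr (Filter.mem_of_superset Filter.univ_mem fun x _ => ⟨x, rfl⟩)
  have hc : Tendsto (fun q : P => (q, (0 : R))) (𝓝 p) (𝓝 (p, 0)) :=
    (Continuous.prodMk continuous_id continuous_const).tendsto p
  filter_upwards [hc hmem] with q hq
  obtain ⟨⟨q', z⟩, hx⟩ := hq
  simp only [Prod.mk.injEq] at hx
  obtain ⟨rfl, hx⟩ := hx
  exact ⟨z, hx⟩

end AbstractPerturbation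

section Perturbation

open Matrix
open scoped Matrix.Norms.Operator ComplexOrder

variable {ι : Type*} [Fintype ι] [DecidableEq ι]

theorem exists_trace_repr (f : Matrix ι ι ℂ →ₗ[ℝ] ℝ) :
    ∃ M : Matrix ι ι ℂ, ∀ Z, f Z = (M * Z).trace.re := by
  refine ⟨Matrix.of fun j i => (f (Matrix.single i j 1) : ℂ) -
    Complex.I * f (Matrix.single i j Complex.I), fun Z => ?_⟩
  have hZ : Z = ∑ i, ∑ j, ((Z i j).re • Matrix.single i j (1 : ℂ) +
      (Z i j).im • Matrix.single i j Complex.I) := by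
    conv_lhs => rw [Matrix.matrix_eq_sum_single Z]
    refine Finset.sum_congr rfl fun i _ => Finset.sum_congr rfl fun j _ => ?_
    rw [Matrix.smul_single, Matrix.smul_single, ← Matrix.single_add]
    congr 1
    simp [Complex.re_add_im]
  conv_lhs => rw [hZ]
  simp only [map_sum, map_add, map_smul, smul_eq_mul, Matrix.trace, Matrix.diag, Matrix.mul_apply,
    Matrix.of_apply, Complex.re_sum]
  rw [Finset.sum_comm]
  refine Finset.sum_congr rfl fun i _ => Finset.sum_congr rfl fun j _ => ?_
  simp
  ring

theorem eq_zero_of_re_trace_mul {N : Matrix ι ι ℂ} (h : (N * Nᴴ).trace.re = 0) : N = 0 := by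
  rw [← Matrix.trace_mul_conjTranspose_self_eq_zero_iff]
  apply Complex.ext
  · simpa using h
  · have h1 : (N * Nᴴ).IsHermitian := Matrix.isHermitian_mul_conjTranspose_self N
    have h2 : star (N * Nᴴ).trace = (N * Nᴴ).trace := by
      rw [← Matrix.trace_conjTranspose, h1]
    simpa using Complex.conj_eq_iff_im.mp h2

/-- The real-linear map of first-order variations of `D A D - C - θ`, with `A` and `C` moved
along their unitary orbits and skew-Hermitian matrices added freely. -/
noncomputable def variationMap (D A C : Matrix ι ι ℂ) :
    (Matrix ι ι ℂ × Matrix ι ι ℂ × ℝ × Matrix ι ι ℂ) → Matrix ι ι ℂ := fun z =>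
  D * ((z.1 - z.1ᴴ) * A - A * (z.1 - z.1ᴴ)) * D - ((z.2.1 - z.2.1ᴴ) * C - C * (z.2.1 - z.2.1ᴴ))
    - z.2.2.1 • (1 : Matrix ι ι ℂ) + (z.2.2.2 - z.2.2.2ᴴ)

theorem variationMap_surjective {D A C : Matrix ι ι ℂ} (hD : D.IsHermitian) (hA : A.IsHermitian)
    (hC : C.IsHermitian)
    (h : ∀ M : Matrix ι ι ℂ, M.IsHermitian → M.trace = 0 → Commute A (D * M * D) →
      Commute C M → M = 0) : Function.Surjective (variationMap D A C) := by
  let L : (Matrix ι ι ℂ × Matrix ι ι ℂ × ℝ × Matrix ι ι ℂ) →ₗ[ℝ] Matrix ι ι ℂ :=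
    { toFun := variationMap D A C
      map_add' := by
        intro x y
        simp only [variationMap, Prod.fst_add, Prod.snd_add, Matrix.conjTranspose_add, add_smul]
        noncomm_ring
      map_smul' := by
        intro c x
        simp only [variationMap, Prod.smul_fst, Prod.smul_snd, Matrix.conjTranspose_smul,
          star_trivial, RingHom.id_apply, smul_add, smul_sub, mul_assoc, smul_assoc, mul_sub, sub_mul,
          Matrix.smul_mul, Matrix.mul_smul] }
  change Function.Surjective L
  rw [← LinearMap.range_eq_top]
  by_contra hne
  obtain ⟨f, hf0, hf⟩ := Submodule.exists_le_ker_of_lt_top _ (lt_top_iff_ne_top.mpr hne)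
  obtain ⟨M, hM⟩ := exists_trace_repr f
  have hz : ∀ z, (M * variationMap D A C z).trace.re = 0 := by
    intro z
    rw [← hM]
    exact hf ⟨z, rfl⟩
  apply hf0
  have key : ∀ N : Matrix ι ι ℂ, (N * (Nᴴ - N)).trace.re = 0 → Nᴴ = -N → N = 0 := by
    intro N h1 h2
    apply eq_zero_of_re_trace_mul
    have : Nᴴ - N = Nᴴ + Nᴴ := by rw [h2]; abel
    rw [this, mul_add, Matrix.trace_add, Complex.add_re] at h1
    linarith
  have hMh : M.IsHermitian := by
    have h1 := hz (0, 0, 0, (M - Mᴴ)ᴴ)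
    simp only [variationMap, Matrix.conjTranspose_zero, sub_zero, mul_zero, zero_mul, zero_smul,
      zero_add, Matrix.conjTranspose_conjTranspose] at h1
    have h2 : M - Mᴴ = 0 := by
      apply eq_zero_of_re_trace_mul
      have e1 : ((M - Mᴴ) * (M - Mᴴ)ᴴ).trace =
        (M * (M - Mᴴ)ᴴ).trace - (Mᴴ * (M - Mᴴ)ᴴ).trace := by rw [sub_mul, Matrix.trace_sub]
      have e2 : (Mᴴ * (M - Mᴴ)ᴴ).trace.re = (M * (M - Mᴴ)).trace.re := by
        rw [← Matrix.conjTranspose_mul, Matrix.trace_conjTranspose, Matrix.trace_mul_comm]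
        simp
      rw [e1, Complex.sub_re, e2]
      rw [mul_sub, Matrix.trace_sub, Complex.sub_re] at h1
      exact h1
    exact (sub_eq_zero.mp h2).symm
  have hMt : M.trace = 0 := by
    apply Complex.ext
    · have := hz (0, 0, 1, 0)
      simpa [variationMap] using this
    · have h2 : star M.trace = M.trace := by
        rw [← Matrix.trace_conjTranspose, hMh]
      simpa using Complex.conj_eq_iff_im.mp h2
  have hMA : Commute A (D * M * D) := by
    set N := A * (D * M * D) - (D * M * D) * A with hN
    have h1 := hz (Nᴴ, 0, 0, 0)
    simp only [variationMap, Matrix.conjTranspose_zero, sub_zero, mul_zero, zero_mul, zero_smul,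
      add_zero, Matrix.conjTranspose_conjTranspose] at h1
    have h2 : N = 0 := by
      apply key
      · rw [← h1]; congr 1
        rw [hN]
        generalize (A * (D * M * D) - (D * M * D) * A)ᴴ - (A * (D * M * D) - (D * M * D) * A) = X
        simp only [mul_sub, sub_mul, Matrix.trace_sub, mul_assoc]
        congr 1
        · rw [Matrix.trace_mul_comm]; simp only [mul_assoc]
          rw [Matrix.trace_mul_comm D]; simp only [mul_assoc]
        · rw [Matrix.trace_mul_comm D]; simp only [mul_assoc]
      · simp only [hN, Matrix.conjTranspose_sub, Matrix.conjTranspose_mul, hA.eq, hD.eq, hMh.eq]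
        noncomm_ring
    exact sub_eq_zero.mp h2
  have hMC : Commute C M := by
    set N := C * M - M * C with hN
    have h1 := hz (0, Nᴴ, 0, 0)
    simp only [variationMap, Matrix.conjTranspose_zero, sub_zero, mul_zero, zero_mul, zero_smul,
      add_zero, Matrix.conjTranspose_conjTranspose, zero_sub] at h1
    have h2 : N = 0 := by
      apply key
      · rw [mul_neg, Matrix.trace_neg, Complex.neg_re, neg_eq_zero] at h1
        rw [← h1]; congr 1
        rw [hN]
        generalize (C * M - M * C)ᴴ - (C * M - M * C) = X
        simp only [mul_sub, sub_mul, Matrix.trace_sub, mul_assoc]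
        congr 1
        · rw [Matrix.trace_mul_comm]; simp only [mul_assoc]
      · rw [hN, Matrix.conjTranspose_sub, Matrix.conjTranspose_mul, Matrix.conjTranspose_mul,
          hC, hMh]
        noncomm_ring
    exact sub_eq_zero.mp h2
  have hM0 := h M hMh hMt hMA hMC
  ext Z
  rw [hM, hM0]; simp

/-- Quadruples of real diagonals. -/
abbrev DiagQuad (ι : Type*) := (ι → ℝ) × (ι → ℝ) × (ι → ℝ) × (ι → ℝ)

/-- The skew-Hermitian matrix `Z - Zᴴ`, as a real-linear function of `Z`. -/
noncomputable def skewMap : Matrix ι ι ℂ →L[ℝ] Matrix ι ι ℂ :=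
  LinearMap.toContinuousLinearMap
    { toFun := fun Z => Z - Zᴴ
      map_add' := by intro x y; simp only [Matrix.conjTranspose_add]; abel
      map_smul' := by
        intro c x
        simp only [Matrix.conjTranspose_smul, star_trivial, RingHom.id_apply, smul_sub] }

theorem skewMap_apply (Z : Matrix ι ι ℂ) : skewMap Z = Z - Zᴴ := rfl

/-- `rdiag` as a continuous real-linear map. -/
noncomputable def rdiagMap : (ι → ℝ) →L[ℝ] Matrix ι ι ℂ :=
  LinearMap.toContinuousLinearMap
    { toFun := rdiag
      map_add' := by intro x y; ext i j; by_cases h : i = j <;> simp [rdiag, h]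
      map_smul' := by
        intro c x; ext i j; by_cases h : i = j <;> simp [rdiag, h] }

theorem continuous_rdiag : Continuous (rdiag : (ι → ℝ) → Matrix ι ι ℂ) :=
  (rdiagMap (ι := ι)).continuous

theorem skewMap_conjTranspose (Z : Matrix ι ι ℂ) : (skewMap Z)ᴴ = -skewMap Z := by
  rw [skewMap_apply, Matrix.conjTranspose_sub, Matrix.conjTranspose_conjTranspose]; abel

open NormedSpace in
theorem exp_skewMap_mem (Z : Matrix ι ι ℂ) :
    exp (skewMap Z) ∈ Matrix.unitaryGroup ι ℂ ∧ star (exp (skewMap Z)) = exp (-skewMap Z) := by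
  have h : star (exp (skewMap Z)) = exp (-skewMap Z) := by
    rw [Matrix.star_eq_conjTranspose, ← Matrix.exp_conjTranspose, skewMap_conjTranspose]
  refine ⟨?_, h⟩
  rw [Matrix.mem_unitaryGroup_iff, h,
    ← Matrix.exp_add_of_commute _ _ (Commute.neg_right (Commute.refl (skewMap Z)))]
  simp

open Filter Topology in
/-- At a solution where the first-order variations are surjective, the equation
`D₁ A D₁ + D₃ = C + θ` remains solvable for all nearby spectra. -/
theorem eventually_solvable {p : DiagQuad ι} {U V : Matrix ι ι ℂ}
    (hU : U ∈ Matrix.unitaryGroup ι ℂ) (hV : V ∈ Matrix.unitaryGroup ι ℂ)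
    (heq : rdiag p.1 * (U * rdiag p.2.1 * star U) * rdiag p.1 + rdiag p.2.2.1 =
      V * rdiag p.2.2.2 * star V)
    (h : ∀ M : Matrix ι ι ℂ, M.IsHermitian → M.trace = 0 →
      Commute (U * rdiag p.2.1 * star U) (rdiag p.1 * M * rdiag p.1) →
      Commute (V * rdiag p.2.2.2 * star V) M → M = 0) :
    ∀ᶠ q : DiagQuad ι in 𝓝 p, ∃ U ∈ Matrix.unitaryGroup ι ℂ, ∃ V ∈ Matrix.unitaryGroup ι ℂ,
      ∃ θ : ℝ, rdiag q.1 * (U * rdiag q.2.1 * star U) * rdiag q.1 + rdiag q.2.2.1 =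
        V * rdiag q.2.2.2 * star V + θ • (1 : Matrix ι ι ℂ) := by
  have hsurj := variationMap_surjective (rdiag_isHermitian p.1)
    (specIs_unitary_conj hU p.2.1).1 (specIs_unitary_conj hV p.2.2.2).1 h
  have hr : ContDiff ℝ 1 (rdiag : (ι → ℝ) → Matrix ι ι ℂ) := (rdiagMap (ι := ι)).contDiff
  have hev := eventually_defect_eq_zero (R := Matrix ι ι ℂ) (P := DiagQuad ι) (p := p)
    (D := fun q => rdiag q.1) (A := fun q => U * rdiag q.2.1 * star U)
    (T := fun q => rdiag q.2.2.1) (C := fun q => V * rdiag q.2.2.2 * star V) (S := skewMap)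
    (hr.comp contDiff_fst)
    ((contDiff_const.mul (hr.comp (contDiff_fst.comp contDiff_snd))).mul contDiff_const)
    (hr.comp (contDiff_fst.comp (contDiff_snd.comp contDiff_snd)))
    ((contDiff_const.mul (hr.comp (contDiff_snd.comp (contDiff_snd.comp contDiff_snd)))).mul
      contDiff_const) heq hsurj
  filter_upwards [hev] with q hq
  obtain ⟨⟨Z1, Z2, θ, K⟩, hx⟩ := hq
  obtain ⟨m1, s1⟩ := exp_skewMap_mem Z1
  obtain ⟨m2, s2⟩ := exp_skewMap_mem Z2
  refine ⟨_, mul_mem m1 hU, _, mul_mem m2 hV, θ, ?_⟩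
  set E1 := NormedSpace.exp (skewMap Z1)
  set E2 := NormedSpace.exp (skewMap Z2)
  have e1 : ∀ E W D : Matrix ι ι ℂ, E * (W * D * star W) * star E = (E * W) * D * star (E * W) := by
    intro E W D; rw [star_mul]; simp only [mul_assoc]
  set X := rdiag q.1 * (E1 * U * rdiag q.2.1 * star (E1 * U)) * rdiag q.1 + rdiag q.2.2.1 with hX
  set Y := E2 * V * rdiag q.2.2.2 * star (E2 * V) with hY
  replace hx : X - Y - θ • (1 : Matrix ι ι ℂ) + skewMap K = 0 := by
    rw [hX, hY, ← e1, ← e1, s1, s2]; exact hx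
  have hXh : X.IsHermitian := by
    refine Matrix.IsHermitian.add ?_ (rdiag_isHermitian _)
    have h1 := Matrix.isHermitian_mul_mul_conjTranspose (rdiag q.1)
      (specIs_unitary_conj (mul_mem m1 hU) q.2.1).1
    rwa [(rdiag_isHermitian q.1).eq] at h1
  have hYh : Y.IsHermitian := (specIs_unitary_conj (mul_mem m2 hV) q.2.2.2).1
  have hk := congrArg Matrix.conjTranspose hx
  rw [Matrix.conjTranspose_add, skewMap_conjTranspose, Matrix.conjTranspose_sub,
    Matrix.conjTranspose_sub, hXh, hYh, Matrix.conjTranspose_smul, Matrix.conjTranspose_one,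
    star_trivial, Matrix.conjTranspose_zero] at hk
  have h2 : (2:ℝ) • (X - Y - θ • (1 : Matrix ι ι ℂ)) = 0 := by
    rw [two_smul]
    calc _ = (X - Y - θ • 1 + skewMap K) + (X - Y - θ • 1 + -skewMap K) := by abel
      _ = 0 := by rw [hx, hk, add_zero]
  have h3 := (smul_eq_zero.mp h2).resolve_left two_ne_zero
  rw [sub_sub, sub_eq_zero] at h3
  exact h3

end Perturbation

section SpectralRelations

open Matrix

variable {ι : Type*} [Fintype ι] [DecidableEq ι]

/-- There are Hermitian `n × n` matrices with `S A S + T = C` and the given spectra. -/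
def SpecRel (n : ℕ) (s a t c : Multiset ℝ) : Prop :=
  ∃ S A T C : Matrix (Fin n) (Fin n) ℂ, SpecIs S s ∧ SpecIs A a ∧ SpecIs T t ∧ SpecIs C c ∧
    S * A * S + T = C

theorem specRel_of_matrix {S A T C : Matrix ι ι ℂ} {s a t c : Multiset ℝ} (hS : SpecIs S s)
    (hA : SpecIs A a) (hT : SpecIs T t) (hC : SpecIs C c) (h : S * A * S + T = C) :
    SpecRel (Fintype.card ι) s a t c := by
  let e := Fintype.equivFin ι
  refine ⟨_, _, _, _, hS.reindex e, hA.reindex e, hT.reindex e, hC.reindex e, ?_⟩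
  rw [← h]
  simp only [Matrix.reindex_apply, Matrix.submatrix_mul_equiv]
  rfl

theorem SpecRel.add {m n : ℕ} {s a t c s' a' t' c' : Multiset ℝ} (h : SpecRel m s a t c)
    (h' : SpecRel n s' a' t' c') : SpecRel (m + n) (s + s') (a + a') (t + t') (c + c') := by
  obtain ⟨S, A, T, C, hS, hA, hT, hC, e⟩ := h
  obtain ⟨S', A', T', C', hS', hA', hT', hC', e'⟩ := h'
  have := specRel_of_matrix (hS.fromBlocks hS') (hA.fromBlocks hA') (hT.fromBlocks hT')
    (hC.fromBlocks hC') (by simp [Matrix.fromBlocks_multiply, Matrix.fromBlocks_add, e, e'])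
  simpa using this

theorem SpecRel.conj_eq {S A T C R : Matrix ι ι ℂ} (h : S * A * S + T = C) (hS : Commute R S)
    (hA : Commute R A) (hT : Commute R T) : Commute R C := by
  rw [← h]
  exact ((hS.mul_right hA).mul_right hS).add_right hT

theorem fromBlocks_of_commute_rdiag {r : ι → ℝ} {A : Matrix ι ι ℂ} (h : Commute (rdiag r) A) (x : ℝ) :
    A.submatrix (Equiv.sumCompl fun i => r i = x) (Equiv.sumCompl fun i => r i = x) =
      Matrix.fromBlocks (A.submatrix Subtype.val Subtype.val) 0 0
        (A.submatrix Subtype.val Subtype.val) := by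
  have key : ∀ i j, r i ≠ r j → A i j = 0 := by
    intro i j hij
    have h1 := congrFun (congrFun h i) j
    rw [rdiag, Matrix.diagonal_mul, Matrix.mul_diagonal, mul_comm, ← sub_eq_zero, ← mul_sub] at h1
    refine (mul_eq_zero.mp h1).resolve_right ?_
    intro h0
    exact hij (by exact_mod_cast sub_eq_zero.mp h0)
  ext i j
  rcases i with ⟨i, hi⟩ | ⟨i, hi⟩ <;> rcases j with ⟨j, hj⟩ | ⟨j, hj⟩ <;> simp
  · exact key i j (by rw [hi]; exact fun h => hj h.symm)
  · exact key i j (by rw [hj]; exact hi)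

theorem SpecIs.submatrix_val {A : Matrix ι ι ℂ} {a : Multiset ℝ} (h : SpecIs A a) (p : ι → Prop)
    [DecidablePred p] : ∃ b, SpecIs (A.submatrix (Subtype.val : {i // p i} → ι) Subtype.val) b :=
  ⟨_, (h.1.submatrix _).specIs⟩

theorem SpecIs.eq_add_of_fromBlocks {κ κ' : Type*} [Fintype κ] [DecidableEq κ] [Fintype κ']
    [DecidableEq κ'] {A : Matrix ι ι ℂ} {e : κ ⊕ κ' ≃ ι} {B : Matrix κ κ ℂ} {B' : Matrix κ' κ' ℂ}
    {a b b' : Multiset ℝ}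
    (h : SpecIs A a) (hb : SpecIs B b) (hb' : SpecIs B' b')
    (he : A.submatrix e e = Matrix.fromBlocks B 0 0 B') : a = b + b' := by
  have h1 := h.reindex e.symm
  rw [Matrix.reindex_apply, Equiv.symm_symm, he] at h1
  exact h1.unique (hb.fromBlocks hb')

theorem exists_split {S A T C R : Matrix ι ι ℂ} {s a t c : Multiset ℝ} (hS : SpecIs S s)
    (hA : SpecIs A a) (hT : SpecIs T t) (hC : SpecIs C c) (h : S * A * S + T = C)
    (hR : R.IsHermitian) (hRs : ∀ x : ℝ, R ≠ x • (1 : Matrix ι ι ℂ)) (cS : Commute R S)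
    (cA : Commute R A) (cT : Commute R T) :
    ∃ m m' : ℕ, m < Fintype.card ι ∧ m' < Fintype.card ι ∧ m + m' = Fintype.card ι ∧
      ∃ s1 a1 t1 c1 s2 a2 t2 c2 : Multiset ℝ, s = s1 + s2 ∧ a = a1 + a2 ∧ t = t1 + t2 ∧
        c = c1 + c2 ∧ SpecRel m s1 a1 t1 c1 ∧ SpecRel m' s2 a2 t2 c2 := by
  obtain ⟨O, hO, hRO⟩ := hR.exists_unitary
  set r := hR.eigenvalues
  have hOO : O * star O = 1 := Unitary.mul_star_self_of_mem hO
  have hOO' : star O * O = 1 := Unitary.star_mul_self_of_mem hO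
  have conj_mul : ∀ X Y : Matrix ι ι ℂ,
      (star O * X * O) * (star O * Y * O) = star O * (X * Y) * O := by
    intro X Y
    calc _ = star O * X * (O * star O) * Y * O := by simp only [mul_assoc]
      _ = _ := by rw [hOO, mul_one]; simp only [mul_assoc]
  have hRd : star O * R * O = rdiag r := by
    rw [hRO]
    calc _ = (star O * O) * rdiag r * (star O * O) := by simp only [mul_assoc]
      _ = _ := by rw [hOO', one_mul, mul_one]
  have conj_comm : ∀ {X : Matrix ι ι ℂ}, Commute R X → Commute (rdiag r) (star O * X * O) := by
    intro X hX
    rw [← hRd]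
    show _ * _ = _ * _
    rw [conj_mul, conj_mul, hX.eq]
  have hne : ∃ i j, r i ≠ r j := by
    by_contra hcon
    push Not at hcon
    rcases isEmpty_or_nonempty ι with he | ⟨⟨i0⟩⟩
    · exact hRs 0 (by ext i; exact he.elim i)
    · apply hRs (r i0)
      have : rdiag r = r i0 • (1 : Matrix ι ι ℂ) := by
        ext i j
        by_cases hij : i = j
        · subst hij; simp [rdiag, hcon i i0]
        · simp [rdiag, hij]
      rw [hRO, this, mul_smul_comm, smul_mul_assoc, mul_one, hOO]
  obtain ⟨i1, i2, hi⟩ := hne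
  set p : ι → Prop := fun i => r i = r i1 with hp
  have bS := fromBlocks_of_commute_rdiag (conj_comm cS) (r i1)
  have bA := fromBlocks_of_commute_rdiag (conj_comm cA) (r i1)
  have bT := fromBlocks_of_commute_rdiag (conj_comm cT) (r i1)
  have bC := fromBlocks_of_commute_rdiag (conj_comm (SpecRel.conj_eq h cS cA cT)) (r i1)
  have h' : (star O * S * O) * (star O * A * O) * (star O * S * O) + star O * T * O =
      star O * C * O := by
    rw [conj_mul, conj_mul, ← h, mul_add, add_mul]
  have hb := congrArg (fun X => X.submatrix (Equiv.sumCompl p) (Equiv.sumCompl p)) h'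
  rw [Matrix.submatrix_add, Pi.add_apply, Pi.add_apply, ← Matrix.submatrix_mul_equiv _ _ _ (Equiv.sumCompl p),
    ← Matrix.submatrix_mul_equiv _ _ _ (Equiv.sumCompl p), bS, bA, bT, bC, Matrix.fromBlocks_multiply,
    Matrix.fromBlocks_multiply, Matrix.fromBlocks_add, Matrix.fromBlocks_inj] at hb
  simp only [Matrix.mul_zero, Matrix.zero_mul, add_zero, zero_add] at hb
  obtain ⟨hb1, -, -, hb2⟩ := hb
  obtain ⟨s1, hs1⟩ := (hS.conj' hO).submatrix_val p
  obtain ⟨s2, hs2⟩ := (hS.conj' hO).submatrix_val (fun i => ¬ p i)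
  obtain ⟨a1, ha1⟩ := (hA.conj' hO).submatrix_val p
  obtain ⟨a2, ha2⟩ := (hA.conj' hO).submatrix_val (fun i => ¬ p i)
  obtain ⟨t1, ht1⟩ := (hT.conj' hO).submatrix_val p
  obtain ⟨t2, ht2⟩ := (hT.conj' hO).submatrix_val (fun i => ¬ p i)
  obtain ⟨c1, hc1⟩ := (hC.conj' hO).submatrix_val p
  obtain ⟨c2, hc2⟩ := (hC.conj' hO).submatrix_val (fun i => ¬ p i)
  refine ⟨Fintype.card {i // p i}, Fintype.card {i // ¬ p i}, ?_, ?_, ?_, s1, a1, t1, c1, s2, a2, t2, c2,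
    (hS.conj' hO).eq_add_of_fromBlocks hs1 hs2 bS, (hA.conj' hO).eq_add_of_fromBlocks ha1 ha2 bA,
    (hT.conj' hO).eq_add_of_fromBlocks ht1 ht2 bT, (hC.conj' hO).eq_add_of_fromBlocks hc1 hc2 bC,
    specRel_of_matrix hs1 ha1 ht1 hc1 hb1, specRel_of_matrix hs2 ha2 ht2 hc2 hb2⟩
  · exact Fintype.card_subtype_lt (x := i2) (fun h => hi h.symm)
  · exact Fintype.card_subtype_lt (x := i1) (fun h => h rfl)
  · exact (Fintype.card_sum).symm.trans (Fintype.card_congr (Equiv.sumCompl p))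

/-- The equation `D₁ A D₁ + D₃ = C` is solvable with `A` and `C` in the given unitary orbits. -/
def DiagSolvable (q : DiagQuad ι) : Prop :=
  ∃ U ∈ Matrix.unitaryGroup ι ℂ, ∃ V ∈ Matrix.unitaryGroup ι ℂ,
    rdiag q.1 * (U * rdiag q.2.1 * star U) * rdiag q.1 + rdiag q.2.2.1 = V * rdiag q.2.2.2 * star V

theorem isCompact_unitaryGroup : IsCompact (Matrix.unitaryGroup ι ℂ : Set (Matrix ι ι ℂ)) := by
  have h1 : IsCompact (Set.pi Set.univ fun _ : ι => Set.pi Set.univ fun _ : ι =>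
      Metric.closedBall (0 : ℂ) 1) :=
    isCompact_univ_pi fun _ => isCompact_univ_pi fun _ => isCompact_closedBall _ _
  have h2 : IsClosed (Matrix.unitaryGroup ι ℂ : Set (Matrix ι ι ℂ)) := by
    have : (Matrix.unitaryGroup ι ℂ : Set (Matrix ι ι ℂ)) = {U | U * star U = 1} := by
      ext U; exact Matrix.mem_unitaryGroup_iff
    rw [this]
    exact isClosed_eq (by fun_prop) continuous_const
  refine IsCompact.of_isClosed_subset h1 h2 fun U hU => ?_
  intro i _ j _
  simpa using entry_norm_bound_of_unitary hU i j

theorem isClosed_exists_mem_of_isCompact {X Y : Type*} [TopologicalSpace X] [TopologicalSpace Y]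
    {K : Set X} (hK : IsCompact K) {F : Set (X × Y)} (hF : IsClosed F) :
    IsClosed {y | ∃ x ∈ K, (x, y) ∈ F} := by
  have := isCompact_iff_compactSpace.mp hK
  have h1 : IsClosed {z : K × Y | (z.1.1, z.2) ∈ F} := hF.preimage (by fun_prop)
  convert! isClosedMap_snd_of_compactSpace _ h1 using 1
  ext y; simp

theorem isClosed_diagSolvable : IsClosed {q : DiagQuad ι | DiagSolvable q} := by
  have hr := continuous_rdiag (ι := ι)
  have h := isClosed_exists_mem_of_isCompact (Y := DiagQuad ι)
    ((isCompact_unitaryGroup (ι := ι)).prod (isCompact_unitaryGroup (ι := ι)))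
    (F := {x | rdiag x.2.1 * (x.1.1 * rdiag x.2.2.1 * star x.1.1) * rdiag x.2.1 + rdiag x.2.2.2.1 =
      x.1.2 * rdiag x.2.2.2.2 * star x.1.2}) (isClosed_eq (by fun_prop) (by fun_prop))
  convert! h using 1
  ext q
  constructor
  · rintro ⟨U, hU, V, hV, h⟩
    exact ⟨(U, V), ⟨hU, hV⟩, h⟩
  · rintro ⟨⟨U, V⟩, ⟨hU, hV⟩, h⟩
    exact ⟨U, hU, V, hV, h⟩

end SpectralRelations

section Dichotomy

open Matrix Filter Topology
open scoped ComplexOrder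

variable {ι : Type*} [Fintype ι] [DecidableEq ι]

/-- `SpecRel` with the given spectra decomposes into two smaller relations. -/
def SpecSplits (n : ℕ) (s a t c : Multiset ℝ) : Prop :=
  ∃ m m' : ℕ, m < n ∧ m' < n ∧ m + m' = n ∧
      ∃ s1 a1 t1 c1 s2 a2 t2 c2 : Multiset ℝ, s = s1 + s2 ∧ a = a1 + a2 ∧ t = t1 + t2 ∧
        c = c1 + c2 ∧ SpecRel m s1 a1 t1 c1 ∧ SpecRel m' s2 a2 t2 c2

theorem SpecRel.card {n : ℕ} {s a t c : Multiset ℝ} (h : SpecRel n s a t c) :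
    s.card = n ∧ a.card = n ∧ t.card = n ∧ c.card = n := by
  obtain ⟨S, A, T, C, hS, hA, hT, hC, -⟩ := h
  exact ⟨by simpa using hS.card, by simpa using hA.card, by simpa using hT.card,
    by simpa using hC.card⟩

theorem DiagSolvable.specRel {q : DiagQuad ι} (h : DiagSolvable q) :
    SpecRel (Fintype.card ι) (valuesOf q.1) (valuesOf q.2.1) (valuesOf q.2.2.1)
      (valuesOf q.2.2.2) := by
  obtain ⟨U, hU, V, hV, h⟩ := h
  exact specRel_of_matrix (specIs_rdiag _) (specIs_unitary_conj hU _) (specIs_rdiag _)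
    (specIs_unitary_conj hV _) h

theorem valuesOf_const (x : ℝ) : valuesOf (fun _ : ι => x) = Multiset.replicate (Fintype.card ι) x := by
  simp [valuesOf]

theorem rdiag_const (x : ℝ) : rdiag (fun _ : ι => x) = x • (1 : Matrix ι ι ℂ) := by
  ext i j
  by_cases hij : i = j
  · subst hij; simp [rdiag]
  · simp [rdiag, hij]

theorem SpecIs.eq_smul_one {A : Matrix ι ι ℂ} {x : ℝ}
    (h : SpecIs A (Multiset.replicate (Fintype.card ι) x)) : A = x • (1 : Matrix ι ι ℂ) := by
  rw [← valuesOf_const] at h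
  obtain ⟨U, hU, rfl⟩ := h.exists_unitary
  rw [rdiag_const, mul_smul_comm, smul_mul_assoc, mul_one, Unitary.mul_star_self_of_mem hU]

theorem unitary_conj_conj {W : Matrix ι ι ℂ} (hW : W ∈ Matrix.unitaryGroup ι ℂ) (A : Matrix ι ι ℂ) :
    star W * (W * A * star W) * W = A := by
  have h := Unitary.star_mul_self_of_mem hW
  calc _ = (star W * W) * A * (star W * W) := by simp only [mul_assoc]
    _ = A := by rw [h, one_mul, mul_one]

theorem conj_star_mul (W U A : Matrix ι ι ℂ) :
    star W * (U * A * star U) * W = (star W * U) * A * star (star W * U) := by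
  rw [star_mul, star_star]; simp only [mul_assoc]

theorem SpecRel.diagSolvable_one {n : ℕ} {a b c : Fin n → ℝ}
    (h : SpecRel n (Multiset.replicate n 1) (valuesOf a) (valuesOf b) (valuesOf c)) :
    DiagSolvable ((fun _ => 1), a, b, c) := by
  obtain ⟨S, A, T, C, hS, hA, hT, hC, e⟩ := h
  have hS1 : S = 1 := by
    have hS' : SpecIs S (Multiset.replicate (Fintype.card (Fin n)) 1) := by simpa using hS
    rw [hS'.eq_smul_one, one_smul]
  obtain ⟨U, hU, rfl⟩ := hA.exists_unitary
  obtain ⟨W, hW, rfl⟩ := hT.exists_unitary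
  obtain ⟨V, hV, rfl⟩ := hC.exists_unitary
  refine ⟨star W * U, mul_mem (Unitary.star_mem hW) hU, star W * V,
    mul_mem (Unitary.star_mem hW) hV, ?_⟩
  rw [rdiag_const, one_smul, one_mul, mul_one, ← conj_star_mul, ← conj_star_mul, ← e, hS1, one_mul,
    mul_one, mul_add, add_mul, unitary_conj_conj hW]

theorem SpecRel.diagSolvable_zero {n : ℕ} {d a c : Fin n → ℝ}
    (h : SpecRel n (valuesOf d) (valuesOf a) (Multiset.replicate n 0) (valuesOf c)) :
    DiagSolvable (d, a, (fun _ => 0), c) := by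
  obtain ⟨S, A, T, C, hS, hA, hT, hC, e⟩ := h
  have hT0 : T = 0 := by
    have hT' : SpecIs T (Multiset.replicate (Fintype.card (Fin n)) 0) := by simpa using hT
    rw [hT'.eq_smul_one, zero_smul]
  obtain ⟨U, hU, rfl⟩ := hA.exists_unitary
  obtain ⟨W, hW, rfl⟩ := hS.exists_unitary
  obtain ⟨V, hV, rfl⟩ := hC.exists_unitary
  refine ⟨star W * U, mul_mem (Unitary.star_mem hW) hU, star W * V,
    mul_mem (Unitary.star_mem hW) hV, ?_⟩
  rw [rdiag_const, zero_smul, ← conj_star_mul, ← conj_star_mul, ← e, hT0]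
  have h := Unitary.star_mul_self_of_mem hW
  simp only [add_zero]
  calc rdiag d * (star W * (U * rdiag a * star U) * W) * rdiag d
      = (star W * W) * (rdiag d * (star W * (U * rdiag a * star U) * W) * rdiag d) * (star W * W) := by
        rw [h, one_mul, mul_one]
    _ = _ := by simp only [mul_assoc]

theorem DiagSolvable.sum_eq {a b c : ι → ℝ} (h : DiagSolvable ((fun _ => 1), a, b, c)) :
    ∑ i, a i + ∑ i, b i = ∑ i, c i := by
  obtain ⟨U, hU, V, hV, h⟩ := h
  dsimp only at h
  rw [rdiag_const, one_smul, one_mul, mul_one] at h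
  have := congrArg Matrix.trace h
  rw [Matrix.trace_add, (specIs_unitary_conj hU a).trace, (specIs_rdiag b).trace,
    (specIs_unitary_conj hV c).trace] at this
  exact_mod_cast this

theorem sum_dichotomy [Nonempty ι] {a b c : ι → ℝ} (h : DiagSolvable ((fun _ => 1), a, b, c)) :
    SpecSplits (Fintype.card ι) (Multiset.replicate (Fintype.card ι) 1) (valuesOf a) (valuesOf b)
      (valuesOf c) ∨
    ∀ᶠ q : DiagQuad ι in 𝓝 ((fun _ => 1), a, b, c), q.1 = (fun _ => 1) →
      ∑ i, q.2.1 i + ∑ i, q.2.2.1 i = ∑ i, q.2.2.2 i → DiagSolvable q := by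
  obtain ⟨U, hU, V, hV, h⟩ := h
  have h' := h
  dsimp only at h'
  rw [rdiag_const, one_smul] at h'
  by_cases hR : ∃ R : Matrix ι ι ℂ, R.IsHermitian ∧ (∀ x : ℝ, R ≠ x • (1 : Matrix ι ι ℂ)) ∧
      Commute R (U * rdiag a * star U) ∧ Commute R (rdiag b)
  · left
    obtain ⟨R, hRh, hRs, cA, cB⟩ := hR
    rw [← valuesOf_const]
    refine exists_split (S := 1) ?_ (specIs_unitary_conj hU a) (specIs_rdiag b)
      (specIs_unitary_conj hV c) h' hRh hRs (Commute.one_right R) cA cB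
    have := specIs_rdiag (fun _ : ι => (1:ℝ))
    rwa [rdiag_const, one_smul] at this
  · right
    push Not at hR
    have hcard : (Fintype.card ι : ℝ) ≠ 0 := by exact_mod_cast Fintype.card_ne_zero
    have hev := eventually_solvable hU hV h (by
      intro M hM hMt hMA hMC
      dsimp only at hMA hMC
      rw [rdiag_const, one_smul, one_mul, mul_one] at hMA
      rw [← h', one_mul, mul_one] at hMC
      by_contra hM0
      have cB : Commute M (rdiag b) := by
        have := hMC.symm.sub_right hMA.symm
        simpa using this
      refine hR M hM (fun x hx => hM0 ?_) hMA.symm cB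
      rw [hx, Matrix.trace_smul, Matrix.trace_one, Complex.real_smul] at hMt
      have : x * Fintype.card ι = 0 := by exact_mod_cast hMt
      rw [hx, (mul_eq_zero.mp this).resolve_right hcard, zero_smul])
    filter_upwards [hev] with q hq h1 hs
    obtain ⟨U', hU', V', hV', θ, he⟩ := hq
    have ht := congrArg Matrix.trace he
    rw [h1, rdiag_const, one_smul, one_mul, mul_one, Matrix.trace_add, Matrix.trace_add,
      (specIs_unitary_conj hU' _).trace, (specIs_rdiag _).trace, (specIs_unitary_conj hV' _).trace,
      Matrix.trace_smul, Matrix.trace_one, Complex.real_smul] at ht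
    have ht' : ∑ i, q.2.1 i + ∑ i, q.2.2.1 i = ∑ i, q.2.2.2 i + θ * Fintype.card ι := by
      exact_mod_cast ht
    have hθ : θ * Fintype.card ι = 0 := by linarith
    rw [(mul_eq_zero.mp hθ).resolve_right hcard, zero_smul, add_zero] at he
    exact ⟨U', hU', V', hV', he⟩

theorem rdiag_mul (d e : ι → ℝ) : rdiag d * rdiag e = rdiag (fun i => d i * e i) := by
  simp [rdiag, Matrix.diagonal_mul_diagonal]

theorem commute_rdiag_of_sq {d : ι → ℝ} (hd : ∀ i, 0 < d i) {R : Matrix ι ι ℂ}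
    (h : Commute R (rdiag d * rdiag d)) : Commute R (rdiag d) := by
  ext i j
  rw [rdiag_mul] at h
  have h1 := congrFun (congrFun h i) j
  simp only [rdiag, Matrix.diagonal_mul, Matrix.mul_diagonal, Complex.ofReal_mul] at h1 ⊢
  have h2 : R i j * ((d j : ℂ) - d i) * (d j + d i) = 0 := by linear_combination h1
  have h3 : ((d j : ℂ) + d i) ≠ 0 := by
    have : d j + d i ≠ 0 := by linarith [hd i, hd j] |> fun h : 0 < d j + d i => h.ne'
    exact_mod_cast this
  have h4 := (mul_eq_zero.mp h2).resolve_right h3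
  linear_combination h4

theorem det_unitary_conj {U A : Matrix ι ι ℂ} (hU : U ∈ Matrix.unitaryGroup ι ℂ) :
    (U * A * star U).det = A.det := by
  rw [Matrix.det_mul_comm, ← mul_assoc, Unitary.star_mul_self_of_mem hU, one_mul]

theorem det_rdiag (d : ι → ℝ) : (rdiag d).det = ((∏ i, d i : ℝ) : ℂ) := by
  simp [rdiag]

theorem prod_dichotomy [Nonempty ι] {d a c : ι → ℝ} (hd : ∀ i, 0 < d i)
    (hc : ∀ i, 0 < c i) (h : DiagSolvable (d, a, (fun _ => 0), c)) :
    SpecSplits (Fintype.card ι) (valuesOf d) (valuesOf a) (Multiset.replicate (Fintype.card ι) 0)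
      (valuesOf c) ∨
    ∀ᶠ q : DiagQuad ι in 𝓝 (d, a, (fun _ => 0), c), q.2.2.1 = (fun _ => 0) →
      (∀ i, 0 < q.1 i) → (∀ i, 0 < q.2.1 i) → (∀ i, 0 < q.2.2.2 i) →
      (∏ i, q.1 i) * (∏ i, q.2.1 i) * (∏ i, q.1 i) = ∏ i, q.2.2.2 i → DiagSolvable q := by
  obtain ⟨U, hU, V, hV, h⟩ := h
  have h' := h
  dsimp only at h'
  rw [rdiag_const, zero_smul, add_zero] at h'
  set A := U * rdiag a * star U with hA
  set C := V * rdiag c * star V with hC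
  have hAh : A.IsHermitian := (specIs_unitary_conj hU a).1
  by_cases hR : ∃ R : Matrix ι ι ℂ, R.IsHermitian ∧ (∀ x : ℝ, R ≠ x • (1 : Matrix ι ι ℂ)) ∧
      Commute R A ∧ Commute R (rdiag d)
  · left
    obtain ⟨R, hRh, hRs, cA, cD⟩ := hR
    rw [← valuesOf_const]
    refine exists_split (T := 0) (specIs_rdiag d) (specIs_unitary_conj hU a) ?_
      (specIs_unitary_conj hV c) (by rw [add_zero]; exact h') hRh hRs cD cA (Commute.zero_right R)
    have := specIs_rdiag (fun _ : ι => (0:ℝ))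
    rwa [rdiag_const, zero_smul] at this
  · right
    push Not at hR
    have hev := eventually_solvable hU hV h (by
      intro M hM hMt hMA hMC
      dsimp only at hMA hMC
      change Commute A _ at hMA
      change Commute C M at hMC
      set D := rdiag d with hD
      have hDh : D.IsHermitian := rdiag_isHermitian d
      set R := A * (D * M * D) with hRdef
      have hRh : R.IsHermitian := by
        rw [Matrix.IsHermitian, hRdef, Matrix.conjTranspose_mul, Matrix.conjTranspose_mul,
          Matrix.conjTranspose_mul, hAh, hDh, hM]
        rw [hMA.eq]; simp only [mul_assoc]
      have cA : Commute R A := (Commute.refl A).mul_left hMA.symm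
      have cD : Commute R D := by
        apply commute_rdiag_of_sq hd
        show R * (D * D) = (D * D) * R
        have e2 : D * A * D * M = M * (D * A * D) := by rw [h']; exact hMC
        calc R * (D * D) = (D * M * D * A) * (D * D) := by rw [hRdef, hMA.eq]
          _ = D * (M * (D * A * D)) * D := by simp only [mul_assoc]
          _ = D * (D * A * D * M) * D := by rw [e2]
          _ = (D * D) * R := by rw [hRdef]; simp only [mul_assoc]
      have : ∃ x : ℝ, R = x • (1 : Matrix ι ι ℂ) := by
        by_contra hcon
        push Not at hcon
        exact hR R hRh hcon cA cD
      obtain ⟨x, hx⟩ := this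
      have hDi : D * rdiag (fun i => (d i)⁻¹) = 1 := by
        rw [hD, rdiag_mul]
        simp only [mul_inv_cancel₀ (hd _).ne']
        rw [rdiag_const, one_smul]
      have hCM : C * M = x • (1 : Matrix ι ι ℂ) := by
        calc C * M = D * A * D * M := by rw [h']
          _ = D * A * D * M * (D * rdiag (fun i => (d i)⁻¹)) := by rw [hDi, mul_one]
          _ = D * R * rdiag (fun i => (d i)⁻¹) := by rw [hRdef]; simp only [mul_assoc]
          _ = x • (1 : Matrix ι ι ℂ) := by
            rw [hx, mul_smul_comm, mul_one, smul_mul_assoc, hDi]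
      set Ci := V * rdiag (fun i => (c i)⁻¹) * star V with hCi
      have hCC : Ci * C = 1 := by
        have hV' := Unitary.star_mul_self_of_mem hV
        calc Ci * C = V * rdiag (fun i => (c i)⁻¹) * (star V * V) * rdiag c * star V := by
              rw [hCi, hC]; simp only [mul_assoc]
          _ = V * (rdiag (fun i => (c i)⁻¹) * rdiag c) * star V := by
              rw [hV', mul_one]; simp only [mul_assoc]
          _ = 1 := by
            rw [rdiag_mul]
            simp only [inv_mul_cancel₀ (hc _).ne']
            rw [rdiag_const, one_smul, mul_one, Unitary.mul_star_self_of_mem hV]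
      have hMx : M = x • Ci := by
        calc M = Ci * C * M := by rw [hCC, one_mul]
          _ = x • Ci := by rw [mul_assoc, hCM, mul_smul_comm, mul_one]
      rw [hMx, Matrix.trace_smul, (specIs_unitary_conj hV _).trace, Complex.real_smul] at hMt
      have h0 : x * ∑ i, (c i)⁻¹ = 0 := by exact_mod_cast hMt
      have hpos : 0 < ∑ i, (c i)⁻¹ :=
        Finset.sum_pos (fun i _ => inv_pos.mpr (hc i)) Finset.univ_nonempty
      rw [hMx, (mul_eq_zero.mp h0).resolve_right hpos.ne', zero_smul])
    filter_upwards [hev] with q hq hq0 hq1 hq2 hq4 hprod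
    obtain ⟨U', hU', V', hV', θ, he⟩ := hq
    rw [hq0, rdiag_const, zero_smul, add_zero] at he
    have hCθ : V' * rdiag q.2.2.2 * star V' + θ • (1 : Matrix ι ι ℂ) =
        V' * rdiag (fun i => q.2.2.2 i + θ) * star V' := by
      have : rdiag (fun i => q.2.2.2 i + θ) = rdiag q.2.2.2 + θ • (1 : Matrix ι ι ℂ) := by
        rw [← rdiag_const]; simp [rdiag, Matrix.diagonal_add]
      rw [this, mul_add, add_mul, mul_smul_comm, smul_mul_assoc, mul_one,
        Unitary.mul_star_self_of_mem hV']
    have hpd : ∀ (e : ι → ℝ), (rdiag e).PosDef ↔ ∀ i, 0 < e i := by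
      intro e
      rw [rdiag, Matrix.posDef_diagonal_iff]
      simp
    have hcp : ∀ (B W : Matrix ι ι ℂ), IsUnit W →
        ((W * B * star W).PosDef ↔ B.PosDef) :=
      fun B W hW => Matrix.IsUnit.posDef_star_right_conjugate_iff hW
    have hunit : ∀ {W : Matrix ι ι ℂ}, W ∈ Matrix.unitaryGroup ι ℂ → IsUnit W := fun hW =>
      IsUnit.of_mul_eq_one _ (Unitary.mul_star_self_of_mem hW)
    have hpos : ∀ i, 0 < q.2.2.2 i + θ := by
      rw [← hpd, ← hcp _ V' (hunit hV'), ← hCθ, ← he]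
      have hs : star (rdiag q.1) = rdiag q.1 := rdiag_isHermitian q.1
      have hDu : IsUnit (rdiag q.1) := by
        refine IsUnit.of_mul_eq_one (rdiag fun i => (q.1 i)⁻¹) ?_
        rw [rdiag_mul]
        simp only [mul_inv_cancel₀ (hq1 _).ne']
        rw [rdiag_const, one_smul]
      have := (hcp (U' * rdiag q.2.1 * star U') _ hDu).2 ((hcp _ U' (hunit hU')).2 ((hpd _).2 hq2))
      rwa [hs] at this
    have hdet : (∏ i, q.1 i) * (∏ i, q.2.1 i) * (∏ i, q.1 i) = ∏ i, (q.2.2.2 i + θ) := by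
      have := congrArg Matrix.det he
      rw [hCθ, det_unitary_conj hV', Matrix.det_mul, Matrix.det_mul, det_unitary_conj hU',
        det_rdiag, det_rdiag, det_rdiag] at this
      exact_mod_cast this
    have hθ : θ = 0 := by
      rw [hprod] at hdet
      rcases lt_trichotomy θ 0 with h1 | h1 | h1
      · exact absurd hdet (Finset.prod_lt_prod_of_nonempty (fun i _ => hpos i)
          (fun i _ => by linarith) Finset.univ_nonempty).ne'
      · exact h1
      · exact absurd hdet (Finset.prod_lt_prod_of_nonempty (fun i _ => hq4 i)
          (fun i _ => by linarith) Finset.univ_nonempty).ne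
    refine ⟨U', hU', V', hV', ?_⟩
    rw [hq0, rdiag_const, zero_smul, add_zero, he, hθ, zero_smul, add_zero]

end Dichotomy

section MultiplicativeHorn

open Matrix Filter Topology

/-- `(a, b, c)` is a triple of spectra of Hermitian matrices `A`, `B`, `A + B`. -/
def HRel (n : ℕ) (a b c : Multiset ℝ) : Prop := SpecRel n (Multiset.replicate n 1) a b c

/-- The exponentials of `s` times `a`, `b`, `c` are the spectra of positive matrices `A`, `S ^ 2`
and `S * A * S`. -/
def MRel (n : ℕ) (s : ℝ) (a b c : Multiset ℝ) : Prop :=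
  SpecRel n (b.map fun x => Real.exp (s * x / 2)) (a.map fun x => Real.exp (s * x))
    (Multiset.replicate n 0) (c.map fun x => Real.exp (s * x))

theorem Multiset.exists_add_of_map_eq_add {α β : Type*} (f : α → β) (t1 : Multiset β) :
    ∀ (s : Multiset α) (t2 : Multiset β), s.map f = t1 + t2 →
      ∃ s1 s2, s = s1 + s2 ∧ s1.map f = t1 ∧ s2.map f = t2 := by
  classical
  induction t1 using Multiset.induction_on with
  | empty => intro s t2 h; exact ⟨0, s, by simp, by simp, by simpa using h⟩
  | cons x t1 ih =>
    intro s t2 h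
    have hx : x ∈ s.map f := by rw [h]; simp
    obtain ⟨y, hy, rfl⟩ := Multiset.mem_map.mp hx
    obtain ⟨s', rfl⟩ := Multiset.exists_cons_of_mem hy
    rw [Multiset.map_cons, Multiset.cons_add, Multiset.cons_inj_right] at h
    obtain ⟨s1, s2, rfl, h1, h2⟩ := ih s' t2 h
    exact ⟨y ::ₘ s1, s2, by simp, by simp [h1], h2⟩

theorem Multiset.eq_replicate_of_add {α : Type*} {n m m' : ℕ} {x : α} {t1 t2 : Multiset α}
    (h : Multiset.replicate n x = t1 + t2) (h1 : t1.card = m) (h2 : t2.card = m') :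
    t1 = Multiset.replicate m x ∧ t2 = Multiset.replicate m' x := by
  refine ⟨Multiset.eq_replicate.2 ⟨h1, fun b hb => ?_⟩, Multiset.eq_replicate.2 ⟨h2, fun b hb => ?_⟩⟩
  all_goals
    refine Multiset.eq_of_mem_replicate (n := n) ?_
    rw [h]; simp [hb]

theorem map_valuesOf {ι : Type*} [Fintype ι] (a : ι → ℝ) (f : ℝ → ℝ) :
    (valuesOf a).map f = valuesOf fun i => f (a i) := by
  simp [valuesOf]

theorem HRel.add {m n : ℕ} {a b c a' b' c' : Multiset ℝ} (h : HRel m a b c) (h' : HRel n a' b' c') :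
    HRel (m + n) (a + a') (b + b') (c + c') := by
  have := SpecRel.add h h'
  rwa [← Multiset.replicate_add] at this

/-- The diagonal data attached to `MRel`. -/
noncomputable def expQuad {n : ℕ} (a b c : Fin n → ℝ) (s : ℝ) : DiagQuad (Fin n) :=
  (fun i => Real.exp (s * b i / 2), fun i => Real.exp (s * a i), fun _ => 0,
    fun i => Real.exp (s * c i))

theorem continuous_expQuad {n : ℕ} (a b c : Fin n → ℝ) : Continuous (expQuad a b c) := by
  unfold expQuad
  fun_prop

theorem tendsto_exp_sub_one_div (x : ℝ) :
    Tendsto (fun s : ℝ => s⁻¹ * (Real.exp (s * x) - 1)) (𝓝[>] 0) (𝓝 x) := by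
  have h : HasDerivAt (fun s : ℝ => Real.exp (s * x)) x 0 := by
    have := ((hasDerivAt_id (0 : ℝ)).mul_const x).exp
    simpa using this
  have h1 := hasDerivAt_iff_tendsto_slope_zero.mp h
  simp only [zero_add, zero_mul, Real.exp_zero, smul_eq_mul] at h1
  exact h1.mono_left (nhdsWithin_mono _ fun y hy => ne_of_gt hy)

theorem diagSolvable_one_of_expQuad {n : ℕ} {a b c : Fin n → ℝ}
    (h : ∀ s : ℝ, 0 < s → DiagSolvable (expQuad a b c s)) : DiagSolvable ((fun _ => 1), a, b, c) := by
  have hlim : Tendsto (fun s : ℝ => ((fun i => Real.exp (s * b i / 2),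
      fun i => s⁻¹ * (Real.exp (s * a i) - 1), fun i => s⁻¹ * (Real.exp (s * b i) - 1),
      fun i => s⁻¹ * (Real.exp (s * c i) - 1)) : DiagQuad (Fin n))) (𝓝[>] 0)
      (𝓝 ((fun _ => 1), a, b, c)) := by
    refine Tendsto.prodMk_nhds (tendsto_pi_nhds.2 fun i => ?_) (Tendsto.prodMk_nhds
      (tendsto_pi_nhds.2 fun i => tendsto_exp_sub_one_div _) (Tendsto.prodMk_nhds
      (tendsto_pi_nhds.2 fun i => tendsto_exp_sub_one_div _)
      (tendsto_pi_nhds.2 fun i => tendsto_exp_sub_one_div _)))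
    have : Continuous fun s : ℝ => Real.exp (s * b i / 2) := by fun_prop
    have h2 := this.tendsto 0
    simp only [zero_mul, zero_div, Real.exp_zero] at h2
    exact h2.mono_left nhdsWithin_le_nhds
  refine isClosed_diagSolvable.mem_of_tendsto hlim ?_
  filter_upwards [self_mem_nhdsWithin] with s hs
  obtain ⟨U, hU, V, hV, e⟩ := h s hs
  refine ⟨U, hU, V, hV, ?_⟩
  simp only [expQuad] at e ⊢
  rw [rdiag_const, zero_smul, add_zero] at e
  have key : ∀ x : Fin n → ℝ, rdiag (fun i => s⁻¹ * (x i - 1)) =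
      s⁻¹ • (rdiag x - (1 : Matrix (Fin n) (Fin n) ℂ)) := by
    intro x
    ext i j
    by_cases hij : i = j
    · subst hij; simp [rdiag]
    · simp [rdiag, hij]
  have hD : rdiag (fun i => Real.exp (s * b i)) =
      rdiag (fun i => Real.exp (s * b i / 2)) * rdiag (fun i => Real.exp (s * b i / 2)) := by
    rw [rdiag_mul]
    congr 1; ext i; rw [← Real.exp_add]; congr 1; ring
  rw [key, key, key, hD]
  simp only [mul_smul_comm, smul_mul_assoc, mul_sub, sub_mul, mul_one]
  rw [Unitary.mul_star_self_of_mem hU, Unitary.mul_star_self_of_mem hV, ← e, mul_one, ← smul_add]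
  congr 1
  abel

theorem expQuad_prod_eq {n : ℕ} {a b c : Fin n → ℝ} (s : ℝ) :
    ((∏ i, Real.exp (s * b i / 2)) * (∏ i, Real.exp (s * a i)) * (∏ i, Real.exp (s * b i / 2)) =
      ∏ i, Real.exp (s * c i)) ↔ s * (∑ i, a i + ∑ i, b i) = s * ∑ i, c i := by
  rw [← Real.exp_sum, ← Real.exp_sum, ← Real.exp_sum, ← Real.exp_add, ← Real.exp_add,
    Real.exp_eq_exp]
  simp only [mul_div_assoc]
  rw [← Finset.mul_sum, ← Finset.mul_sum, ← Finset.mul_sum, ← Finset.sum_div]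
  constructor <;> intro h <;> linarith

theorem MRel.hRel : ∀ (n : ℕ) {s : ℝ} {a b c : Multiset ℝ}, 0 < s → MRel n s a b c →
    HRel n a b c := by
  intro n
  induction n using Nat.strong_induction_on with
  | _ n ih =>
  intro s a b c hs h
  rcases Nat.eq_zero_or_pos n with rfl | hn
  · obtain ⟨h1, h2, -, h4⟩ := SpecRel.card h
    simp only [Multiset.card_map, Multiset.card_eq_zero] at h1 h2 h4
    subst h1 h2 h4
    simpa [MRel, HRel] using h
  have : Nonempty (Fin n) := ⟨⟨0, hn⟩⟩
  obtain ⟨h1, h2, -, h4⟩ := SpecRel.card h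
  rw [Multiset.card_map] at h1 h2 h4
  obtain ⟨b, -, rfl⟩ := exists_valuesOf_eq h1
  obtain ⟨a, -, rfl⟩ := exists_valuesOf_eq h2
  obtain ⟨c, -, rfl⟩ := exists_valuesOf_eq h4
  by_contra hH
  have hsolv : DiagSolvable (expQuad a b c s) := by
    unfold MRel at h
    rw [map_valuesOf, map_valuesOf, map_valuesOf] at h
    exact h.diagSolvable_zero
  have hsum : ∑ i, a i + ∑ i, b i = ∑ i, c i := by
    have := hsolv
    obtain ⟨U, hU, V, hV, e⟩ := this
    simp only [expQuad] at e
    rw [rdiag_const, zero_smul, add_zero] at e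
    have hdet := congrArg Matrix.det e
    rw [Matrix.det_mul, Matrix.det_mul, det_unitary_conj hU, det_unitary_conj hV,
      det_rdiag, det_rdiag, det_rdiag] at hdet
    have hdet' := (expQuad_prod_eq (a := a) (b := b) (c := c) s).1 (by exact_mod_cast hdet)
    exact mul_left_cancel₀ hs.ne' hdet'
  have hclopen : IsClopen {x : Set.Ioi (0 : ℝ) | DiagSolvable (expQuad a b c x)} := by
    have hc : Continuous fun x : Set.Ioi (0 : ℝ) => expQuad a b c x :=
      (continuous_expQuad a b c).comp continuous_subtype_val
    refine ⟨isClosed_diagSolvable.preimage hc, isOpen_iff_mem_nhds.2 ?_⟩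
    rintro ⟨x, hx⟩ hxs
    rcases prod_dichotomy (fun i => Real.exp_pos _) (fun i => Real.exp_pos _) hxs with hsp | hev
    · exfalso
      apply hH
      rw [← map_valuesOf b fun y => Real.exp (x * y / 2), ← map_valuesOf a fun y => Real.exp (x * y),
        ← map_valuesOf c fun y => Real.exp (x * y)] at hsp
      obtain ⟨m, m', hm, hm', hmm, s1, a1, t1, c1, s2, a2, t2, c2, es, ea, et, ec, r1, r2⟩ := hsp
      rw [Fintype.card_fin] at hm hm' hmm et
      obtain ⟨b1, b2, eb, rfl, rfl⟩ := Multiset.exists_add_of_map_eq_add _ _ _ _ es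
      obtain ⟨a1', a2', ea', rfl, rfl⟩ := Multiset.exists_add_of_map_eq_add _ _ _ _ ea
      obtain ⟨c1', c2', ec', rfl, rfl⟩ := Multiset.exists_add_of_map_eq_add _ _ _ _ ec
      obtain ⟨rfl, rfl⟩ := Multiset.eq_replicate_of_add et r1.card.2.2.1 r2.card.2.2.1
      have := (ih m hm hx r1).add (ih m' hm' hx r2)
      rwa [← ea', ← eb, ← ec', hmm] at this
    · refine (hc.tendsto ⟨x, hx⟩).eventually hev |>.mono fun y hy => ?_
      exact hy rfl (fun i => Real.exp_pos _) (fun i => Real.exp_pos _) (fun i => Real.exp_pos _)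
        ((expQuad_prod_eq _).2 (by rw [hsum]))
  have : PreconnectedSpace (Set.Ioi (0 : ℝ)) :=
    isPreconnected_iff_preconnectedSpace.mp isPreconnected_Ioi
  have huniv := hclopen.eq_univ ⟨⟨s, hs⟩, hsolv⟩
  apply hH
  have := (diagSolvable_one_of_expQuad (a := a) (b := b) (c := c) fun x hx => by
    have : (⟨x, hx⟩ : Set.Ioi (0 : ℝ)) ∈ (Set.univ : Set (Set.Ioi (0 : ℝ))) := trivial
    rwa [← huniv] at this).specRel
  simpa [HRel, valuesOf_const] using this

end MultiplicativeHorn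

section Hives

/-- The rhombus inequalities in one of the three directions, for a function of the barycentric
coordinates of the lattice points of a triangle of size `n`. -/
def Rhombus (n : ℕ) (f : ℕ → ℕ → ℕ → ℝ) : Prop :=
  ∀ a b c, a + b + c + 2 = n →
    f a b (c + 2) + f (a + 1) (b + 1) c ≤ f (a + 1) b (c + 1) + f a (b + 1) (c + 1)

/-- A hive, as a function of barycentric coordinates. -/
def IsHive (n : ℕ) (f : ℕ → ℕ → ℕ → ℝ) : Prop :=
  Rhombus n f ∧ Rhombus n (fun a b c => f c a b) ∧ Rhombus n (fun a b c => f b c a)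

theorem IsHive.memC3 {n : ℕ} {f : ℕ → ℕ → ℕ → ℝ} (h : IsHive n f) :
    MemC3 n fun i k => f i (k - i) (n - k) := by
  intro i k hi hk hn
  obtain ⟨i, rfl⟩ : ∃ j, i = j + 1 := ⟨i - 1, by omega⟩
  obtain ⟨b, rfl⟩ : ∃ b, k = i + 1 + b := ⟨k - (i + 1), by omega⟩
  obtain ⟨c, rfl⟩ : ∃ c, n = i + 1 + b + 1 + c := ⟨n - (i + 1 + b + 1), by omega⟩
  have e1 := h.1 i b c (by omega)
  have e2 := h.2.1 b c i (by omega)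
  have e3 := h.2.2 c i b (by omega)
  have s1 : i + 1 + b + 1 - (i + 1) = b + 1 := by omega
  have s2 : i + 1 + b + 1 + c - (i + 1 + b + 1) = c := by omega
  have s3 : i + 1 + b - i = b + 1 := by omega
  have s4 : i + 1 + b + 1 + c - (i + 1 + b) = c + 1 := by omega
  have s5 : i + 1 + b + 1 - i = b + 2 := by omega
  have s6 : i + 1 + b - (i + 1) = b := by omega
  have s7 : i + 1 + b + 1 - (i + 1 + 1) = b := by omega
  have s8 : i + 1 + b - 1 - i = b := by omega
  have s9 : i + 1 + b + 1 + c - (i + 1 + b - 1) = c + 2 := by omega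
  simp only [Nat.add_sub_cancel, s1, s2, s3, s4, s5, s6, s7, s8, s9]
  refine ⟨?_, ?_, ?_⟩ <;> linarith

/-- The functional giving the differences of `f` along the three sides of the triangle. -/
def sideDiff (n : ℕ) (f : ℕ → ℕ → ℕ → ℝ) : (Fin n → ℝ) × (Fin n → ℝ) × (Fin n → ℝ) :=
  (fun j => f 0 (j + 1) (n - (j + 1)) - f 0 j (n - j),
    fun j => f (j + 1) (n - (j + 1)) 0 - f j (n - j) 0,
    fun j => f (j + 1) 0 (n - (j + 1)) - f j 0 (n - j))

/-- Boundary difference triples of hives. -/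
def HiveSet (n : ℕ) : Set ((Fin n → ℝ) × (Fin n → ℝ) × (Fin n → ℝ)) :=
  {p | ∃ f, IsHive n f ∧ f 0 0 n = 0 ∧ p = sideDiff n f}

/-- `G` is the support function of `f`. -/
def IsSupport (n : ℕ) (f : ℕ → ℕ → ℕ → ℝ) (G : ℝ → ℝ → ℝ → ℝ) : Prop :=
  (∀ a b c, a + b + c = n → ∀ x y z : ℝ, f a b c + a * x + b * y + c * z ≤ G x y z) ∧
    ∀ x y z : ℝ, ∃ a b c, a + b + c = n ∧ G x y z = f a b c + a * x + b * y + c * z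

theorem exists_isSupport (n : ℕ) (f : ℕ → ℕ → ℕ → ℝ) : ∃ G, IsSupport n f G := by
  have hne : (Finset.Nat.antidiagonalTuple 3 n).Nonempty :=
    ⟨![n, 0, 0], by rw [Finset.Nat.mem_antidiagonalTuple]; simp [Fin.sum_univ_three]⟩
  refine ⟨fun x y z => (Finset.Nat.antidiagonalTuple 3 n).sup' hne
    fun v => f (v 0) (v 1) (v 2) + v 0 * x + v 1 * y + v 2 * z, ?_, ?_⟩
  · intro a b c h x y z
    have hv : ![a, b, c] ∈ Finset.Nat.antidiagonalTuple 3 n := by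
      rw [Finset.Nat.mem_antidiagonalTuple]; simpa [Fin.sum_univ_three] using h
    exact Finset.le_sup' (fun v : Fin 3 → ℕ => f (v 0) (v 1) (v 2) + v 0 * x + v 1 * y + v 2 * z) hv
  · intro x y z
    obtain ⟨v, hv, e⟩ := Finset.exists_mem_eq_sup' hne
      fun v : Fin 3 → ℕ => f (v 0) (v 1) (v 2) + v 0 * x + v 1 * y + v 2 * z
    rw [Finset.Nat.mem_antidiagonalTuple, Fin.sum_univ_three] at hv
    exact ⟨v 0, v 1, v 2, hv, e⟩

theorem IsSupport.rotate {n : ℕ} {f : ℕ → ℕ → ℕ → ℝ} {G : ℝ → ℝ → ℝ → ℝ} (h : IsSupport n f G) :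
    IsSupport n (fun a b c => f c a b) fun x y z => G z x y := by
  refine ⟨fun a b c e x y z => ?_, fun x y z => ?_⟩
  · have := h.1 c a b (by omega) z x y; linarith
  · obtain ⟨a, b, c, e, h'⟩ := h.2 z x y
    exact ⟨b, c, a, by omega, by linarith⟩

theorem IsSupport.swap {n : ℕ} {f : ℕ → ℕ → ℕ → ℝ} {G : ℝ → ℝ → ℝ → ℝ} (h : IsSupport n f G) :
    IsSupport n (fun a b c => f a c b) fun x y z => G x z y := by
  refine ⟨fun a b c e x y z => ?_, fun x y z => ?_⟩
  · have := h.1 a c b (by omega) x z y; linarith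
  · obtain ⟨a, b, c, e, h'⟩ := h.2 x z y
    exact ⟨a, c, b, by omega, by linarith⟩

theorem IsSupport.translate {n : ℕ} {f : ℕ → ℕ → ℕ → ℝ} {G : ℝ → ℝ → ℝ → ℝ} (h : IsSupport n f G)
    (x y z s : ℝ) : G (x + s) (y + s) (z + s) = G x y z + n * s := by
  apply le_antisymm
  · obtain ⟨a, b, c, e, h'⟩ := h.2 (x + s) (y + s) (z + s)
    have := h.1 a b c e x y z
    have e' : (a : ℝ) + b + c = n := by exact_mod_cast e
    rw [h', ← e']; linarith
  · obtain ⟨a, b, c, e, h'⟩ := h.2 x y z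
    have := h.1 a b c e (x + s) (y + s) (z + s)
    have e' : (a : ℝ) + b + c = n := by exact_mod_cast e
    rw [h', ← e']; linarith

theorem Rhombus.parallelogram {n : ℕ} {f : ℕ → ℕ → ℕ → ℝ} (h : Rhombus n f) (a b c p q : ℕ)
    (e : a + b + c + p + q = n) :
    f a b (c + p + q) + f (a + p) (b + q) c ≤ f (a + p) b (c + q) + f a (b + q) (c + p) := by
  have strip : ∀ p a b c, a + b + c + p + 1 = n →
      f a b (c + p + 1) + f (a + p) (b + 1) c ≤ f (a + p) b (c + 1) + f a (b + 1) (c + p) := by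
    intro p
    induction p with
    | zero => intro a b c _; simp only [add_zero]; linarith
    | succ p ih =>
      intro a b c e
      have h1 := ih (a + 1) b c (by omega)
      have h2 := h a b (c + p) (by omega)
      have e1 : a + 1 + p = a + (p + 1) := by ring
      have e2 : c + (p + 1) = c + p + 1 := by ring
      rw [e1] at h1
      rw [e2]
      linarith
  induction q generalizing b with
  | zero => simp only [add_zero]; linarith
  | succ q ih =>
    have h1 := ih (b + 1) (by omega)
    have h2 := strip p a b (c + q) (by omega)
    have e1 : b + 1 + q = b + (q + 1) := by ring
    have e2 : c + p + (q + 1) = c + q + p + 1 := by ring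
    have e3 : c + (q + 1) = c + q + 1 := by ring
    have e4 : c + p + q = c + q + p := by ring
    rw [e1, e4] at h1
    rw [e2, e3]
    linarith

/-- Submodularity in the first two variables. -/
def IsSubmod (G : ℝ → ℝ → ℝ → ℝ) : Prop :=
  ∀ x x' y y' z, x' ≤ x → y' ≤ y → G x y z + G x' y' z ≤ G x y' z + G x' y z

theorem IsSupport.isSubmod {n : ℕ} {f : ℕ → ℕ → ℕ → ℝ} {G : ℝ → ℝ → ℝ → ℝ} (h : IsSupport n f G)
    (hf : Rhombus n f) : IsSubmod G := by
  intro x x' y y' z hx hy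
  obtain ⟨a, b, c, e, h1⟩ := h.2 x y z
  obtain ⟨a', b', c', e', h2⟩ := h.2 x' y' z
  rw [h1, h2]
  have hle : ∀ {m k : ℕ}, m ≤ k → (m : ℝ) ≤ k := fun h => by exact_mod_cast h
  rcases le_or_gt a a' with ha | ha
  · have g1 := h.1 a' b' c' e' x y' z
    have g2 := h.1 a b c e x' y z
    nlinarith [hle ha]
  rcases le_or_gt b b' with hb | hb
  · have g1 := h.1 a b c e x y' z
    have g2 := h.1 a' b' c' e' x' y z
    nlinarith [hle hb]
  obtain ⟨p, rfl⟩ : ∃ p, a = a' + p := ⟨a - a', by omega⟩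
  obtain ⟨q, rfl⟩ : ∃ q, b = b' + q := ⟨b - b', by omega⟩
  obtain rfl : c' = c + p + q := by omega
  have g1 := h.1 (a' + p) b' (c + q) (by omega) x y' z
  have g2 := h.1 a' (b' + q) (c + p) (by omega) x' y z
  have g3 := hf.parallelogram a' b' c p q (by omega)
  push_cast at *
  linarith

/-- `f` is the concave conjugate of `G` on the triangle of size `n`. -/
def IsConjugate (n : ℕ) (G : ℝ → ℝ → ℝ → ℝ) (f : ℕ → ℕ → ℕ → ℝ) : Prop :=
  (∀ a b c, a + b + c = n → ∀ x y z : ℝ, f a b c + a * x + b * y + c * z ≤ G x y z) ∧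
    ∀ a b c, a + b + c = n → ∀ m : ℝ,
      (∀ x y z : ℝ, m + a * x + b * y + c * z ≤ G x y z) → m ≤ f a b c

theorem exists_isConjugate {n : ℕ} {G : ℝ → ℝ → ℝ → ℝ}
    (h : ∀ a b c, a + b + c = n → ∃ m : ℝ, ∀ x y z : ℝ, m + a * x + b * y + c * z ≤ G x y z) :
    ∃ f, IsConjugate n G f := by
  refine ⟨fun a b c => ⨅ v : ℝ × ℝ × ℝ, (G v.1 v.2.1 v.2.2 - (a * v.1 + b * v.2.1 + c * v.2.2)),
    fun a b c e x y z => ?_, fun a b c e m hm => ?_⟩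
  · obtain ⟨m, hm⟩ := h a b c e
    have := ciInf_le (f := fun v : ℝ × ℝ × ℝ =>
      (G v.1 v.2.1 v.2.2 - (a * v.1 + b * v.2.1 + c * v.2.2)))
      ⟨m, by rintro _ ⟨v, rfl⟩; have := hm v.1 v.2.1 v.2.2; dsimp only; linarith⟩ (x, y, z)
    dsimp only at this ⊢
    linarith
  · refine le_ciInf fun v => ?_
    have := hm v.1 v.2.1 v.2.2
    linarith

theorem IsConjugate.rotate {n : ℕ} {f : ℕ → ℕ → ℕ → ℝ} {G : ℝ → ℝ → ℝ → ℝ} (h : IsConjugate n G f) :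
    IsConjugate n (fun x y z => G z x y) (fun a b c => f c a b) := by
  refine ⟨fun a b c e x y z => ?_, fun a b c e m hm => ?_⟩
  · have := h.1 c a b (by omega) z x y; linarith
  · exact h.2 c a b (by omega) m fun x y z => by have := hm y z x; linarith

theorem IsConjugate.swap {n : ℕ} {f : ℕ → ℕ → ℕ → ℝ} {G : ℝ → ℝ → ℝ → ℝ} (h : IsConjugate n G f) :
    IsConjugate n (fun x y z => G x z y) (fun a b c => f a c b) := by
  refine ⟨fun a b c e x y z => ?_, fun a b c e m hm => ?_⟩
  · have := h.1 a c b (by omega) x z y; linarith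
  · exact h.2 a c b (by omega) m fun x y z => by have := hm x z y; linarith

theorem IsConjugate.rhombus {n : ℕ} {f : ℕ → ℕ → ℕ → ℝ} {G : ℝ → ℝ → ℝ → ℝ} (h : IsConjugate n G f)
    (ht : ∀ x y z s : ℝ, G (x + s) (y + s) (z + s) = G x y z + n * s) (hG : IsSubmod G) :
    Rhombus n f := by
  intro a b c e
  rw [← sub_le_iff_le_add']
  refine h.2 a (b + 1) (c + 1) (by omega) _ fun x' y' z' => ?_
  have : f a b (c + 2) + f (a + 1) (b + 1) c - (G x' y' z' - (a * x' + (b + 1) * y' + (c + 1) * z'))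
      ≤ f (a + 1) b (c + 1) := by
    refine h.2 (a + 1) b (c + 1) (by omega) _ fun x y z => ?_
    have t := ht x' y' z' (z - z')
    rw [add_sub_cancel] at t
    have en : (n : ℝ) = a + b + c + 2 := by exact_mod_cast e.symm
    set X := x' + (z - z') with hX
    set Y := y' + (z - z') with hY
    have key : G (max x X) (max y Y) z + G (min x X) (min y Y) z ≤ G x y z + G X Y z := by
      rcases le_total x X with h1 | h1 <;> rcases le_total y Y with h2 | h2 <;> simp only [h1, h2,
        max_eq_left, max_eq_right, min_eq_left, min_eq_right]
      · linarith
      · have := hG X x y Y z h1 h2; linarith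
      · have := hG x X Y y z h1 h2; linarith
      · linarith
    have g1 := h.1 (a + 1) (b + 1) c (by omega) (max x X) (max y Y) z
    have g2 := h.1 a b (c + 2) (by omega) (min x X) (min y Y) z
    have m1 := max_add_min x X
    have m2 := max_add_min y Y
    have m3 := le_max_left x X
    have m4 := le_max_right y Y
    have m5 : (a : ℝ) * max x X + a * min x X = a * x + a * X := by
      rw [← mul_add, m1, mul_add]
    have m6 : (b : ℝ) * max y Y + b * min y Y = b * y + b * Y := by
      rw [← mul_add, m2, mul_add]
    rw [en] at t
    push_cast at *
    have e1 : (a : ℝ) * x' = a * X - a * (z - z') := by rw [hX]; ring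
    have e2 : (b : ℝ) * y' = b * Y - b * (z - z') := by rw [hY]; ring
    linarith
  push_cast
  linarith

end Hives

section HiveSums

/-- Differences of `f` along the side of the triangle where the third coordinate vanishes. -/
def edgeDiff (n : ℕ) (f : ℕ → ℕ → ℕ → ℝ) (j : ℕ) : ℝ := f (j + 1) (n - (j + 1)) 0 - f j (n - j) 0

theorem sum_edgeDiff (n : ℕ) (f : ℕ → ℕ → ℕ → ℝ) (k : ℕ) :
    f k (n - k) 0 = f 0 n 0 + ∑ j ∈ Finset.range k, edgeDiff n f j := by
  unfold edgeDiff
  rw [Finset.sum_range_sub (fun k => f k (n - k) 0)]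
  simp

theorem Rhombus.comm {n : ℕ} {f : ℕ → ℕ → ℕ → ℝ} (h : Rhombus n f) :
    Rhombus n fun a b c => f b a c := fun a b c e => by
  have := h b a c (by omega)
  dsimp only
  linarith

theorem IsHive.rotate {n : ℕ} {f : ℕ → ℕ → ℕ → ℝ} (h : IsHive n f) :
    IsHive n fun a b c => f c a b := ⟨h.2.1, h.2.2, h.1⟩

theorem IsHive.swap {n : ℕ} {f : ℕ → ℕ → ℕ → ℝ} (h : IsHive n f) :
    IsHive n fun a b c => f a c b := ⟨h.2.2.comm, h.2.1.comm, h.1.comm⟩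

theorem IsHive.edgeDiff_antitone {n : ℕ} {f : ℕ → ℕ → ℕ → ℝ} (h : IsHive n f) {j k : ℕ} (hjk : j ≤ k)
    (hk : k < n) : edgeDiff n f k ≤ edgeDiff n f j := by
  induction k, hjk using Nat.le_induction with
  | base => exact le_rfl
  | succ k _ ih =>
    refine le_trans ?_ (ih (by omega))
    obtain ⟨b, rfl⟩ : ∃ b, n = k + 1 + 1 + b := ⟨n - (k + 2), by omega⟩
    have h1 := h.2.1 b 0 k (by omega)
    have h2 := h.2.2 0 k b (by omega)
    simp only [edgeDiff, show k + 1 + 1 + b - (k + 1 + 1) = b by omega,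
      show k + 1 + 1 + b - (k + 1) = b + 1 by omega, show k + 1 + 1 + b - k = b + 2 by omega]
    simp only [zero_add] at h1 h2
    rw [show k + 1 + 1 = k + 2 by ring]
    linarith

theorem sum_le_sum_max {n k : ℕ} (hk : k ≤ n) (α : ℕ → ℝ) (z : ℝ) :
    ∑ j ∈ Finset.range k, (α j + z) ≤ ∑ j ∈ Finset.range n, max (α j + z) 0 :=
  (Finset.sum_le_sum fun _ _ => le_max_left _ _).trans
    (Finset.sum_le_sum_of_subset_of_nonneg (Finset.range_mono hk) fun _ _ _ => le_max_right _ _)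

theorem sum_eq_sum_max {n k : ℕ} (hk : k ≤ n) {α : ℕ → ℝ} {z : ℝ} (h1 : ∀ j < k, 0 ≤ α j + z)
    (h2 : ∀ j, k ≤ j → j < n → α j + z ≤ 0) :
    ∑ j ∈ Finset.range k, (α j + z) = ∑ j ∈ Finset.range n, max (α j + z) 0 := by
  rw [← Finset.sum_subset (Finset.range_mono hk)]
  · exact Finset.sum_congr rfl fun j hj => (max_eq_left (h1 j (Finset.mem_range.1 hj))).symm
  · intro j hj hj'
    exact max_eq_right (h2 j (by simpa using hj') (by simpa using hj))

theorem exists_sum_eq_sum_max {n : ℕ} {α : ℕ → ℝ} (hα : ∀ j k, j ≤ k → k < n → α k ≤ α j) (z : ℝ) :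
    ∃ k ≤ n, ∑ j ∈ Finset.range k, (α j + z) = ∑ j ∈ Finset.range n, max (α j + z) 0 := by
  classical
  have hex : ∃ k, k = n ∨ α k + z < 0 := ⟨n, Or.inl rfl⟩
  have hle : Nat.find hex ≤ n := Nat.find_le (Or.inl rfl)
  refine ⟨Nat.find hex, hle, sum_eq_sum_max hle (fun j hj => ?_) fun j hj hjn => ?_⟩
  · have := Nat.find_min hex hj
    push Not at this
    exact this.2
  · rcases Nat.find_spec hex with h | h
    · omega
    · have := hα _ j hj hjn; linarith

theorem exists_shift_sum_eq_sum_max {n k : ℕ} (hk : k ≤ n) {α : ℕ → ℝ}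
    (hα : ∀ j k, j ≤ k → k < n → α k ≤ α j) :
    ∃ z, ∑ j ∈ Finset.range k, (α j + z) = ∑ j ∈ Finset.range n, max (α j + z) 0 := by
  rcases k with _ | k
  · refine ⟨-α 0, sum_eq_sum_max hk (fun j hj => by omega) fun j _ hj => ?_⟩
    have := hα 0 j (Nat.zero_le _) hj; linarith
  · refine ⟨-α k, sum_eq_sum_max hk (fun j hj => ?_) fun j hj hjn => ?_⟩
    · have := hα j k (by omega) (by omega); linarith
    · have := hα k j (by omega) hjn; linarith

theorem IsSupport.le_of_side {n : ℕ} {f : ℕ → ℕ → ℕ → ℝ} {G : ℝ → ℝ → ℝ → ℝ} (h : IsSupport n f G)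
    (z : ℝ) : ∃ L₀ : ℝ, ∀ L ≥ L₀,
      G z 0 (-L) ≤ f 0 n 0 + ∑ j ∈ Finset.range n, max (edgeDiff n f j + z) 0 := by
  refine ⟨max 0 (G z 0 0 - f 0 n 0), fun L hL => ?_⟩
  have hL0 : 0 ≤ L := (le_max_left _ _).trans hL
  have hL1 : G z 0 0 - f 0 n 0 ≤ L := (le_max_right _ _).trans hL
  obtain ⟨a, b, c, e, h1⟩ := h.2 z 0 (-L)
  rw [h1]
  rcases Nat.eq_zero_or_pos c with rfl | hc
  · obtain rfl : b = n - a := by omega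
    have h2 := sum_le_sum_max (show a ≤ n by omega) (edgeDiff n f) z
    rw [Finset.sum_add_distrib, Finset.sum_const, Finset.card_range, nsmul_eq_mul] at h2
    rw [sum_edgeDiff n f a]
    push_cast
    linarith
  · have h2 := h.1 a b c e z 0 0
    have hc' : (1 : ℝ) ≤ c := by exact_mod_cast hc
    have h3 : 0 ≤ ∑ j ∈ Finset.range n, max (edgeDiff n f j + z) 0 :=
      Finset.sum_nonneg fun j _ => le_max_right _ _
    nlinarith

theorem IsSupport.side_le {n : ℕ} {f : ℕ → ℕ → ℕ → ℝ} {G : ℝ → ℝ → ℝ → ℝ} (h : IsSupport n f G)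
    (hf : IsHive n f) (x y z : ℝ) :
    f 0 n 0 + ∑ j ∈ Finset.range n, max (edgeDiff n f j + (x - y)) 0 + n * y ≤ G x y z := by
  obtain ⟨k, hk, e⟩ := exists_sum_eq_sum_max (fun j k h1 h2 => hf.edgeDiff_antitone h1 h2) (x - y)
  have h1 := h.1 k (n - k) 0 (by omega) x y z
  rw [← e, Finset.sum_add_distrib, Finset.sum_const, Finset.card_range, nsmul_eq_mul]
  rw [sum_edgeDiff n f k, Nat.cast_sub hk] at h1
  push_cast at h1
  linarith

theorem sum_max_eq_valuesOf {n : ℕ} (α : ℕ → ℝ) (z : ℝ) :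
    ∑ j ∈ Finset.range n, max (α j + z) 0 =
      ((valuesOf fun j : Fin n => α j).map fun x => max (x + z) 0).sum := by
  rw [Finset.sum_range, valuesOf, Multiset.map_map]; rfl

theorem IsConjugate.side_eq {m n : ℕ} {f g h : ℕ → ℕ → ℕ → ℝ} {F G : ℝ → ℝ → ℝ → ℝ}
    (hF : IsSupport m f F) (hG : IsSupport n g G)
    (hh : IsConjugate (m + n) (fun x y z => F x y z + G x y z) h) (hf : IsHive m f) (hg : IsHive n g)
    {α : ℕ → ℝ} (hα : ∀ j k, j ≤ k → k < m + n → α k ≤ α j)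
    (hv : valuesOf (fun j : Fin (m + n) => α j) =
      valuesOf (fun j : Fin m => edgeDiff m f j) + valuesOf (fun j : Fin n => edgeDiff n g j))
    {k : ℕ} (hk : k ≤ m + n) :
    h k (m + n - k) 0 = f 0 m 0 + g 0 n 0 + ∑ j ∈ Finset.range k, α j := by
  have hsum : ∀ z, ∑ j ∈ Finset.range (m + n), max (α j + z) 0 =
      ∑ j ∈ Finset.range m, max (edgeDiff m f j + z) 0 +
        ∑ j ∈ Finset.range n, max (edgeDiff n g j + z) 0 := by
    intro z
    rw [sum_max_eq_valuesOf, sum_max_eq_valuesOf, sum_max_eq_valuesOf, hv, Multiset.map_add,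
      Multiset.sum_add]
  apply le_antisymm
  · obtain ⟨z, hz⟩ := exists_shift_sum_eq_sum_max hk hα
    obtain ⟨L₁, h1⟩ := hF.le_of_side z
    obtain ⟨L₂, h2⟩ := hG.le_of_side z
    have h3 := hh.1 k (m + n - k) 0 (by omega) z 0 (-max L₁ L₂)
    have h4 := h1 _ (le_max_left L₁ L₂)
    have h5 := h2 _ (le_max_right L₁ L₂)
    rw [hsum, Finset.sum_add_distrib, Finset.sum_const, Finset.card_range, nsmul_eq_mul] at hz
    push_cast at h3
    linarith
  · refine hh.2 k (m + n - k) 0 (by omega) _ fun x y z => ?_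
    have h1 := hF.side_le hf x y z
    have h2 := hG.side_le hg x y z
    have h3 := sum_le_sum_max hk α (x - y)
    rw [hsum, Finset.sum_add_distrib, Finset.sum_const, Finset.card_range, nsmul_eq_mul] at h3
    rw [Nat.cast_sub hk]
    push_cast
    linarith

theorem IsConjugate.isHive {n : ℕ} {F : ℝ → ℝ → ℝ → ℝ} {h : ℕ → ℕ → ℕ → ℝ} (hh : IsConjugate n F h)
    (ht : ∀ x y z s : ℝ, F (x + s) (y + s) (z + s) = F x y z + n * s)
    (h1 : IsSubmod F) (h2 : IsSubmod fun x y z => F z x y) (h3 : IsSubmod fun x y z => F y z x) :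
    IsHive n h :=
  ⟨hh.rhombus ht h1, hh.rotate.rhombus (fun x y z s => ht z x y s) h2,
    hh.rotate.rotate.rhombus (fun x y z s => ht y z x s) h3⟩

theorem IsSubmod.add {F G : ℝ → ℝ → ℝ → ℝ} (hF : IsSubmod F) (hG : IsSubmod G) :
    IsSubmod fun x y z => F x y z + G x y z := fun x x' y y' z hx hy => by
  have := hF x x' y y' z hx hy
  have := hG x x' y y' z hx hy
  dsimp only
  linarith

/-- The extension by zero of a finite sequence. -/
noncomputable def extendZero {n : ℕ} (a : Fin n → ℝ) (j : ℕ) : ℝ := if h : j < n then a ⟨j, h⟩ else 0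

theorem extendZero_val {n : ℕ} (a : Fin n → ℝ) (j : Fin n) : extendZero a j = a j := by
  simp [extendZero]

theorem extendZero_antitone {n : ℕ} {a : Fin n → ℝ} (ha : Antitone a) (j k : ℕ) (hjk : j ≤ k)
    (hk : k < n) : extendZero a k ≤ extendZero a j := by
  simp only [extendZero, hk, hjk.trans_lt hk, dif_pos]
  exact ha hjk

theorem IsConjugate.edgeDiff_eq {m n : ℕ} {f g h : ℕ → ℕ → ℕ → ℝ} {F G : ℝ → ℝ → ℝ → ℝ}
    (hF : IsSupport m f F) (hG : IsSupport n g G)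
    (hh : IsConjugate (m + n) (fun x y z => F x y z + G x y z) h) (hf : IsHive m f) (hg : IsHive n g)
    {a : Fin (m + n) → ℝ} (ha : Antitone a)
    (hv : valuesOf a =
      valuesOf (fun j : Fin m => edgeDiff m f j) + valuesOf (fun j : Fin n => edgeDiff n g j)) :
    h 0 (m + n) 0 = f 0 m 0 + g 0 n 0 ∧ a = fun j : Fin (m + n) => edgeDiff (m + n) h j := by
  have hv' : valuesOf (fun j : Fin (m + n) => extendZero a j) = valuesOf (fun j : Fin m =>
      edgeDiff m f j) + valuesOf (fun j : Fin n => edgeDiff n g j) := by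
    simpa only [extendZero_val] using hv
  have key := fun k hk => hh.side_eq hF hG hf hg (extendZero_antitone ha) hv' (k := k) hk
  refine ⟨by simpa using key 0 (Nat.zero_le _), ?_⟩
  ext j
  rw [edgeDiff, key _ j.2, key _ j.2.le, Finset.sum_range_succ, extendZero_val]
  ring

theorem HiveSet.sum_mem {m n : ℕ} {p : (Fin m → ℝ) × (Fin m → ℝ) × (Fin m → ℝ)}
    {q : (Fin n → ℝ) × (Fin n → ℝ) × (Fin n → ℝ)}
    {r : (Fin (m + n) → ℝ) × (Fin (m + n) → ℝ) × (Fin (m + n) → ℝ)}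
    (hp : p ∈ HiveSet m) (hq : q ∈ HiveSet n) (h1 : Antitone r.1) (h2 : Antitone r.2.1)
    (h3 : Antitone r.2.2) (e1 : valuesOf r.1 = valuesOf p.1 + valuesOf q.1)
    (e2 : valuesOf r.2.1 = valuesOf p.2.1 + valuesOf q.2.1)
    (e3 : valuesOf r.2.2 = valuesOf p.2.2 + valuesOf q.2.2) : r ∈ HiveSet (m + n) := by
  obtain ⟨f, hf, f0, rfl⟩ := hp
  obtain ⟨g, hg, g0, rfl⟩ := hq
  obtain ⟨F, hF⟩ := exists_isSupport m f
  obtain ⟨G, hG⟩ := exists_isSupport n g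
  obtain ⟨h, hh⟩ := exists_isConjugate (n := m + n) (G := fun x y z => F x y z + G x y z) (by
    intro a b c e
    obtain ⟨a1, a2, b1, b2, c1, c2, rfl, rfl, rfl, e1⟩ : ∃ a1 a2 b1 b2 c1 c2, a = a1 + a2 ∧
        b = b1 + b2 ∧ c = c1 + c2 ∧ a1 + b1 + c1 = m := by
      refine ⟨min a m, a - min a m, min b (m - min a m), b - min b (m - min a m),
        m - min a m - min b (m - min a m), c - (m - min a m - min b (m - min a m)), ?_⟩
      omega
    refine ⟨f a1 b1 c1 + g a2 b2 c2, fun x y z => ?_⟩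
    have := hF.1 a1 b1 c1 e1 x y z
    have := hG.1 a2 b2 c2 (by omega) x y z
    push_cast
    linarith)
  have r1 := hh.rotate.edgeDiff_eq hF.rotate hG.rotate hf.rotate hg.rotate h1 e1
  have r2 := hh.edgeDiff_eq hF hG hf hg h2 e2
  have r3 := hh.swap.edgeDiff_eq hF.swap hG.swap hf.swap hg.swap h3 e3
  refine ⟨h, hh.isHive (fun x y z s => ?_) ((hF.isSubmod hf.1).add (hG.isSubmod hg.1))
    ((hF.rotate.isSubmod hf.2.1).add (hG.rotate.isSubmod hg.2.1))
    ((hF.rotate.rotate.isSubmod hf.2.2).add (hG.rotate.rotate.isSubmod hg.2.2)), ?_,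
    Prod.ext r1.2 (Prod.ext r2.2 r3.2)⟩
  · rw [hF.translate, hG.translate]
    push_cast; ring
  · rw [r3.1, f0, g0, add_zero]

end HiveSums

section HiveCone

open Filter Topology

theorem Rhombus.congr {n : ℕ} {f g : ℕ → ℕ → ℕ → ℝ} (hf : Rhombus n f)
    (h : ∀ a b c, a + b + c = n → f a b c = g a b c) : Rhombus n g := fun a b c e => by
  rw [← h _ _ _ (by omega), ← h _ _ _ (by omega), ← h _ _ _ (by omega), ← h _ _ _ (by omega)]
  exact hf a b c e

theorem Rhombus.add {n : ℕ} {f g : ℕ → ℕ → ℕ → ℝ} (hf : Rhombus n f) (hg : Rhombus n g) :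
    Rhombus n fun a b c => f a b c + g a b c := fun a b c e => by
  have := hf a b c e
  have := hg a b c e
  dsimp only
  linarith

theorem Rhombus.smul {n : ℕ} {f : ℕ → ℕ → ℕ → ℝ} (hf : Rhombus n f) {r : ℝ} (hr : 0 ≤ r) :
    Rhombus n fun a b c => r * f a b c := fun a b c e => by
  have := hf a b c e
  dsimp only
  rw [← mul_add, ← mul_add]
  exact mul_le_mul_of_nonneg_left this hr

theorem HiveSet.add_mem {n : ℕ} {p q : (Fin n → ℝ) × (Fin n → ℝ) × (Fin n → ℝ)}
    (hp : p ∈ HiveSet n) (hq : q ∈ HiveSet n) : p + q ∈ HiveSet n := by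
  obtain ⟨f, hf, f0, rfl⟩ := hp
  obtain ⟨g, hg, g0, rfl⟩ := hq
  refine ⟨fun a b c => f a b c + g a b c, ⟨hf.1.add hg.1, hf.2.1.add hg.2.1, hf.2.2.add hg.2.2⟩,
    by simp [f0, g0], ?_⟩
  refine Prod.ext (funext fun j => ?_) (Prod.ext (funext fun j => ?_) (funext fun j => ?_)) <;>
    simp [sideDiff] <;> ring

theorem HiveSet.smul_mem {n : ℕ} {p : (Fin n → ℝ) × (Fin n → ℝ) × (Fin n → ℝ)}
    (hp : p ∈ HiveSet n) {r : ℝ} (hr : 0 ≤ r) : r • p ∈ HiveSet n := by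
  obtain ⟨f, hf, f0, rfl⟩ := hp
  refine ⟨fun a b c => r * f a b c, ⟨hf.1.smul hr, hf.2.1.smul hr, hf.2.2.smul hr⟩,
    by simp [f0], ?_⟩
  refine Prod.ext (funext fun j => ?_) (Prod.ext (funext fun j => ?_) (funext fun j => ?_)) <;>
    simp [sideDiff] <;> ring

theorem HiveSet.scalar_mem (n : ℕ) (x y : ℝ) :
    ((fun _ => x, fun _ => y, fun _ => x + y) : (Fin n → ℝ) × (Fin n → ℝ) × (Fin n → ℝ)) ∈
      HiveSet n := by
  refine ⟨fun a b _ => x * (a + b) + y * a, ⟨fun a b c e => ?_, fun a b c e => ?_, fun a b c e => ?_⟩,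
    by simp, ?_⟩
  iterate 3 (push_cast; apply le_of_eq; ring)
  refine Prod.ext (funext fun j => ?_) (Prod.ext (funext fun j => ?_) (funext fun j => ?_)) <;>
    simp [sideDiff]
  all_goals ring

theorem HiveSet.convex (n : ℕ) : Convex ℝ (HiveSet n) := fun _ hp _ hq _ _ ha hb _ =>
  HiveSet.add_mem (HiveSet.smul_mem hp ha) (HiveSet.smul_mem hq hb)

theorem abs_le_of_abs_sub_le {M : ℝ} {u : ℕ → ℝ} {N : ℕ} (h0 : u 0 = 0)
    (h : ∀ j < N, |u (j + 1) - u j| ≤ M) : ∀ j ≤ N, |u j| ≤ j * M := by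
  intro j hj
  induction j with
  | zero => simp [h0]
  | succ j ih =>
    have h1 := ih (by omega)
    have h2 := h j (by omega)
    have h3 := abs_add_le (u (j + 1) - u j) (u j)
    rw [sub_add_cancel] at h3
    push_cast
    linarith

theorem IsHive.slope_le {n : ℕ} {f : ℕ → ℕ → ℕ → ℝ} (h : IsHive n f) (c : ℕ) :
    ∀ a b, a + b + c + 1 = n → f (a + 1) b c - f a (b + 1) c ≤ f (a + 1) (b + c) 0 - f a (b + c + 1) 0 := by
  induction c with
  | zero => intro a b _; exact le_rfl
  | succ c ih =>
    intro a b e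
    have h1 := ih a (b + 1) (by omega)
    have h2 := h.2.2 c a b (by omega)
    rw [show b + 1 + c = b + (c + 1) by ring] at h1
    rw [show b + 1 + 1 = b + 2 by ring] at h1
    linarith

theorem IsHive.le_slope {n : ℕ} {f : ℕ → ℕ → ℕ → ℝ} (h : IsHive n f) (c : ℕ) :
    ∀ a b, a + b + c + 1 = n → f (a + c + 1) b 0 - f (a + c) (b + 1) 0 ≤ f (a + 1) b c - f a (b + 1) c := by
  induction c with
  | zero => intro a b _; exact le_rfl
  | succ c ih =>
    intro a b e
    have h1 := ih (a + 1) b (by omega)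
    have h2 := h.2.1 b c a (by omega)
    rw [show a + 1 + c = a + (c + 1) by ring, show a + 1 + 1 = a + 2 by ring] at h1
    linarith

theorem IsHive.abs_le_mul {n : ℕ} {f : ℕ → ℕ → ℕ → ℝ} (h : IsHive n f) (h0 : f 0 0 n = 0) {M : ℝ}
    (h1 : ∀ j, |(sideDiff n f).1 j| ≤ M) (h2 : ∀ j, |(sideDiff n f).2.1 j| ≤ M) (a b c : ℕ)
    (e : a + b + c = n) : |f a b c| ≤ (n + n) * M := by
  have hl := abs_le_of_abs_sub_le (u := fun j => f 0 j (n - j)) (N := n) (by simpa using h0)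
    fun j hj => h1 ⟨j, hj⟩
  have hr := abs_le_of_abs_sub_le (u := fun j => f j (a + b - j) c - f 0 (a + b) c) (M := M)
    (N := a + b) (by simp) (by
      intro j hj
      have s1 := h.slope_le c j (a + b - (j + 1)) (by omega)
      have s2 := h.le_slope c j (a + b - (j + 1)) (by omega)
      have t1 := h2 ⟨j, by omega⟩
      have t2 := h2 ⟨j + c, by omega⟩
      simp only [sideDiff] at t1 t2
      rw [show n - (j + 1) = a + b - (j + 1) + c by omega, show n - j = a + b - (j + 1) + c + 1 by omega]
        at t1
      rw [show n - (j + c + 1) = a + b - (j + 1) by omega, show n - (j + c) = a + b - (j + 1) + 1 by omega]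
        at t2
      rw [show a + b - j = a + b - (j + 1) + 1 by omega]
      rw [abs_le] at t1 t2 ⊢
      constructor <;> linarith)
  have hl' := hl (a + b) (by omega)
  have hr' := hr a (by omega)
  simp only [Nat.add_sub_cancel_left] at hr'
  rw [show n - (a + b) = c by omega] at hl'
  have h3 := abs_add_le (f a b c - f 0 (a + b) c) (f 0 (a + b) c)
  rw [sub_add_cancel] at h3
  rcases Nat.eq_zero_or_pos n with hn | hn
  · have ha : a = 0 := by omega
    have hb : b = 0 := by omega
    subst ha hb
    simp only [CharP.cast_eq_zero, zero_mul] at *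
    rw [hn]
    simp at hl' ⊢
    rw [hl']
  · have hM : 0 ≤ M := (abs_nonneg _).trans (h1 ⟨0, hn⟩)
    have e1 : (a : ℝ) ≤ n := by exact_mod_cast (by omega : a ≤ n)
    have e2 : ((a + b : ℕ) : ℝ) ≤ n := by exact_mod_cast (by omega : a + b ≤ n)
    have := mul_le_mul_of_nonneg_right e1 hM
    have := mul_le_mul_of_nonneg_right e2 hM
    linarith

theorem isClosed_rhombus (n : ℕ) (g : (ℕ × ℕ × ℕ → ℝ) → ℕ → ℕ → ℕ → ℝ)
    (hg : ∀ a b c, Continuous fun f => g f a b c) : IsClosed {f | Rhombus n (g f)} := by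
  have : {f | Rhombus n (g f)} = ⋂ (a) (b) (c) (_ : a + b + c + 2 = n),
      {f | g f a b (c + 2) + g f (a + 1) (b + 1) c ≤ g f (a + 1) b (c + 1) + g f a (b + 1) (c + 1)} := by
    ext f; simp [Rhombus]
  rw [this]
  refine isClosed_iInter fun a => isClosed_iInter fun b => isClosed_iInter fun c =>
    isClosed_iInter fun _ => isClosed_le ?_ ?_ <;> exact (hg _ _ _).add (hg _ _ _)

theorem isClosed_forall_le {X κ : Type*} [TopologicalSpace X] {M : ℝ} {u : κ → X → ℝ}
    (hu : ∀ j, Continuous (u j)) : IsClosed {x | ∀ j, u j x ≤ M} := by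
  have : {x | ∀ j, u j x ≤ M} = ⋂ j, {x | u j x ≤ M} := by ext; simp
  rw [this]
  exact isClosed_iInter fun j => isClosed_le (hu j) continuous_const

theorem isClosed_hiveSet_bounded (n : ℕ) (M : ℝ) :
    IsClosed {p | p ∈ HiveSet n ∧ (∀ j, |p.1 j| ≤ M) ∧ ∀ j, |p.2.1 j| ≤ M} := by
  have hbox : IsCompact (Set.pi Set.univ fun _ : ℕ × ℕ × ℕ =>
      Set.Icc (-((n + n) * |M|)) ((n + n) * |M|)) := isCompact_univ_pi fun _ => isCompact_Icc
  set g : (ℕ × ℕ × ℕ → ℝ) → ℕ → ℕ → ℕ → ℝ := fun f a b c => f (a, b, c) with hg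
  have hgc : ∀ a b c, Continuous fun f => g f a b c := fun a b c => continuous_apply _
  have hF := isClosed_exists_mem_of_isCompact (Y := (Fin n → ℝ) × (Fin n → ℝ) × (Fin n → ℝ)) hbox
    (F := {x | (Rhombus n (g x.1) ∧ Rhombus n (fun a b c => g x.1 c a b) ∧
        Rhombus n (fun a b c => g x.1 b c a)) ∧ g x.1 0 0 n = 0 ∧ x.2 = sideDiff n (g x.1) ∧
        (∀ j, |x.2.1 j| ≤ M) ∧ ∀ j, |x.2.2.1 j| ≤ M}) (by
      have hside : Continuous fun f => sideDiff n (g f) := by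
        refine Continuous.prodMk (continuous_pi fun j => ?_) (Continuous.prodMk
          (continuous_pi fun j => ?_) (continuous_pi fun j => ?_)) <;>
          exact (hgc _ _ _).sub (hgc _ _ _)
      refine IsClosed.inter (IsClosed.inter ?_ (IsClosed.inter ?_ ?_)) (IsClosed.inter ?_
        (IsClosed.inter ?_ (IsClosed.inter ?_ ?_)))
      · exact (isClosed_rhombus n g hgc).preimage continuous_fst
      · exact (isClosed_rhombus n (fun f a b c => g f c a b) fun a b c => hgc _ _ _).preimage
          continuous_fst
      · exact (isClosed_rhombus n (fun f a b c => g f b c a) fun a b c => hgc _ _ _).preimage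
          continuous_fst
      · exact isClosed_eq ((hgc 0 0 n).comp continuous_fst) continuous_const
      · exact isClosed_eq continuous_snd (hside.comp continuous_fst)
      · exact isClosed_forall_le fun j => by fun_prop
      · exact isClosed_forall_le fun j => by fun_prop)
  convert! hF using 1
  ext p
  constructor
  · rintro ⟨⟨f, hf, f0, rfl⟩, h1, h2⟩
    refine ⟨fun x => if x.1 + x.2.1 + x.2.2 = n then f x.1 x.2.1 x.2.2 else 0, ?_, ?_⟩
    · intro x _
      rw [Set.mem_Icc, ← abs_le]
      have hM : 0 ≤ ((n : ℝ) + n) * |M| := by positivity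
      dsimp only
      split_ifs with hx
      · refine (hf.abs_le_mul f0 h1 h2 _ _ _ hx).trans ?_
        exact mul_le_mul_of_nonneg_left (le_abs_self M) (by positivity)
      · simpa using hM
    · have key : ∀ a b c, a + b + c = n → g (fun x => if x.1 + x.2.1 + x.2.2 = n then
          f x.1 x.2.1 x.2.2 else 0) a b c = f a b c := fun a b c e => by simp [hg, e]
      have hs : sideDiff n (g fun x => if x.1 + x.2.1 + x.2.2 = n then
          f x.1 x.2.1 x.2.2 else 0) = sideDiff n f := by
        refine Prod.ext (funext fun j => ?_) (Prod.ext (funext fun j => ?_) (funext fun j => ?_)) <;>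
          simp only [sideDiff] <;>
          rw [key _ _ _ (by have := j.2; omega), key _ _ _ (by have := j.2; omega)]
      refine ⟨⟨hf.1.congr fun a b c e => (key _ _ _ (by omega)).symm,
        hf.2.1.congr fun a b c e => (key _ _ _ (by omega)).symm,
        hf.2.2.congr fun a b c e => (key _ _ _ (by omega)).symm⟩,
        (key _ _ _ (by omega)).trans f0, hs.symm, h1, h2⟩
  · rintro ⟨f, -, h1, h2, h3, h4, h5⟩
    exact ⟨⟨g f, h1, h2, h3⟩, h4, h5⟩

theorem isClosed_hiveSet (n : ℕ) : IsClosed (HiveSet n) := by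
  refine isClosed_of_closure_subset fun p hp => ?_
  set U := Metric.ball p 1 with hU
  have h1 : p ∈ closure (U ∩ HiveSet n) :=
    Metric.isOpen_ball.inter_closure ⟨Metric.mem_ball_self one_pos, hp⟩
  have h2 : U ∩ HiveSet n ⊆ {q | q ∈ HiveSet n ∧ (∀ j, |q.1 j| ≤ ‖p‖ + 1) ∧
      ∀ j, |q.2.1 j| ≤ ‖p‖ + 1} := by
    rintro q ⟨hq, hqH⟩
    have hn : ‖q‖ ≤ ‖p‖ + 1 := by
      have h3 := norm_le_norm_add_norm_sub' q p
      rw [hU, Metric.mem_ball, dist_eq_norm] at hq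
      linarith
    refine ⟨hqH, fun j => ?_, fun j => ?_⟩
    · exact ((norm_le_pi_norm q.1 j).trans (norm_fst_le q)).trans hn
    · exact ((norm_le_pi_norm q.2.1 j).trans ((norm_fst_le q.2).trans (norm_snd_le q))).trans hn
  exact ((isClosed_hiveSet_bounded n _).closure_subset_iff.2 h2 h1).1

end HiveCone

section HornInHive

open Filter Topology

/-- Triples of decreasing spectra `(a, b, c)` solving `U a U* + b = V c V*` in unitary matrices. -/
def HSet (n : ℕ) : Set ((Fin n → ℝ) × (Fin n → ℝ) × (Fin n → ℝ)) :=
  {p | Antitone p.1 ∧ Antitone p.2.1 ∧ Antitone p.2.2 ∧ DiagSolvable ((fun _ => 1), p)}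

theorem hRel_iff {n : ℕ} {p : (Fin n → ℝ) × (Fin n → ℝ) × (Fin n → ℝ)} :
    HRel n (valuesOf p.1) (valuesOf p.2.1) (valuesOf p.2.2) ↔ DiagSolvable ((fun _ => 1), p) := by
  refine ⟨fun h => SpecRel.diagSolvable_one h, fun h => ?_⟩
  have := h.specRel
  simpa [HRel, valuesOf_const] using this

theorem isClosed_hSet (n : ℕ) : IsClosed (HSet n) := by
  refine IsClosed.inter (isClosed_antitone.preimage continuous_fst) (IsClosed.inter
    (isClosed_antitone.preimage (by fun_prop : Continuous fun p :
      (Fin n → ℝ) × (Fin n → ℝ) × (Fin n → ℝ) => p.2.1)) (IsClosed.inter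
    (isClosed_antitone.preimage (by fun_prop : Continuous fun p :
      (Fin n → ℝ) × (Fin n → ℝ) × (Fin n → ℝ) => p.2.2)) ?_))
  exact isClosed_diagSolvable.preimage (by fun_prop)

theorem DiagSolvable.smul {n : ℕ} {p : (Fin n → ℝ) × (Fin n → ℝ) × (Fin n → ℝ)} (r : ℝ)
    (h : DiagSolvable ((fun _ => 1), p)) : DiagSolvable ((fun _ => 1), r • p) := by
  obtain ⟨U, hU, V, hV, e⟩ := h
  refine ⟨U, hU, V, hV, ?_⟩
  have hr : ∀ a : Fin n → ℝ, rdiag (r • a) = r • rdiag a := by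
    intro a; ext i j
    by_cases hij : i = j
    · subst hij; simp [rdiag]
    · simp [rdiag, hij]
  dsimp only [Prod.smul_fst, Prod.smul_snd] at e ⊢
  rw [hr, hr, hr]
  simp only [mul_smul_comm, smul_mul_assoc, ← smul_add]
  rw [e]

theorem rdiag_zero {n : ℕ} : rdiag (0 : Fin n → ℝ) = 0 := by
  ext i j; simp [rdiag, Matrix.diagonal_apply]

theorem eq_zero_of_unitary_conj_eq_zero {n : ℕ} {U : Matrix (Fin n) (Fin n) ℂ}
    (hU : U ∈ Matrix.unitaryGroup (Fin n) ℂ) {a : Fin n → ℝ} (h : U * rdiag a * star U = 0) :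
    a = 0 := by
  have h1 : rdiag a = 0 := by
    calc rdiag a = (star U * U) * rdiag a * (star U * U) := by
          rw [Unitary.star_mul_self_of_mem hU, one_mul, mul_one]
      _ = star U * (U * rdiag a * star U) * U := by simp only [mul_assoc]
      _ = 0 := by rw [h, mul_zero, zero_mul]
  ext i
  simpa [rdiag] using congrFun (congrFun h1 i) i

theorem SpecSplits.mem_hiveSet {n : ℕ} (ih : ∀ m < n, HSet m ⊆ HiveSet m)
    {p : (Fin n → ℝ) × (Fin n → ℝ) × (Fin n → ℝ)} (h1 : Antitone p.1) (h2 : Antitone p.2.1)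
    (h3 : Antitone p.2.2) (h : SpecSplits n (Multiset.replicate n 1) (valuesOf p.1)
      (valuesOf p.2.1) (valuesOf p.2.2)) : p ∈ HiveSet n := by
  obtain ⟨m, m', hm, hm', rfl, s1, a1, t1, c1, s2, a2, t2, c2, es, ea, et, ec, r1, r2⟩ := h
  obtain ⟨rfl, rfl⟩ := Multiset.eq_replicate_of_add es r1.card.1 r2.card.1
  obtain ⟨a, ha, rfl⟩ := exists_valuesOf_eq r1.card.2.1
  obtain ⟨t, ht, rfl⟩ := exists_valuesOf_eq r1.card.2.2.1
  obtain ⟨c, hc, rfl⟩ := exists_valuesOf_eq r1.card.2.2.2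
  obtain ⟨a', ha', rfl⟩ := exists_valuesOf_eq r2.card.2.1
  obtain ⟨t', ht', rfl⟩ := exists_valuesOf_eq r2.card.2.2.1
  obtain ⟨c', hc', rfl⟩ := exists_valuesOf_eq r2.card.2.2.2
  exact HiveSet.sum_mem (p := (a, t, c)) (q := (a', t', c'))
    (ih m hm ⟨ha, ht, hc, r1.diagSolvable_one⟩) (ih m' hm' ⟨ha', ht', hc', r2.diagSolvable_one⟩)
    h1 h2 h3 ea et ec

theorem diagSolvable_ray {n : ℕ} (hn : 0 < n) {p e : (Fin n → ℝ) × (Fin n → ℝ) × (Fin n → ℝ)}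
    (hp : p ∈ HSet n)
    (he : ∑ i, e.1 i + ∑ i, e.2.1 i = ∑ i, e.2.2 i)
    (hs : ∀ r : ℝ, 0 ≤ r → ¬ SpecSplits n (Multiset.replicate n 1) (valuesOf (p + r • e).1)
      (valuesOf (p + r • e).2.1) (valuesOf (p + r • e).2.2)) :
    DiagSolvable ((fun _ => 1), e) := by
  have : Nonempty (Fin n) := ⟨⟨0, hn⟩⟩
  have hc : Continuous fun x : Set.Ici (0 : ℝ) => (((fun _ => 1), p + (x : ℝ) • e) : DiagQuad (Fin n)) := by
    fun_prop
  have hsum := hp.2.2.2.sum_eq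
  have hclopen : IsClopen {x : Set.Ici (0 : ℝ) | DiagSolvable ((fun _ => 1), p + (x : ℝ) • e)} := by
    refine ⟨isClosed_diagSolvable.preimage hc, isOpen_iff_mem_nhds.2 ?_⟩
    rintro ⟨x, hx⟩ hxs
    rcases sum_dichotomy (ι := Fin n) hxs with hsp | hev
    · exact absurd (by simpa using hsp) (hs x hx)
    · refine (hc.tendsto ⟨x, hx⟩).eventually hev |>.mono fun y hy => ?_
      refine hy rfl ?_
      simp only [Prod.fst_add, Prod.snd_add, Prod.smul_fst, Prod.smul_snd, Pi.add_apply,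
        Pi.smul_apply, smul_eq_mul, Finset.sum_add_distrib, ← Finset.mul_sum]
      linear_combination hsum + (y : ℝ) * he
  have : PreconnectedSpace (Set.Ici (0 : ℝ)) :=
    isPreconnected_iff_preconnectedSpace.mp isPreconnected_Ici
  have huniv := hclopen.eq_univ ⟨⟨0, Set.mem_Ici.2 le_rfl⟩, by simpa using hp.2.2.2⟩
  have hall : ∀ x : ℝ, 0 ≤ x → DiagSolvable ((fun _ => 1), p + x • e) := fun x hx => by
    have : (⟨x, hx⟩ : Set.Ici (0 : ℝ)) ∈ (Set.univ : Set (Set.Ici (0 : ℝ))) := trivial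
    rwa [← huniv] at this
  have hlim : Tendsto (fun x : ℝ => (((fun _ => 1), x⁻¹ • (p + x • e)) : DiagQuad (Fin n))) atTop
      (𝓝 ((fun _ => 1), e)) := by
    refine tendsto_const_nhds.prodMk_nhds ?_
    have h4 : Tendsto (fun x : ℝ => x⁻¹ • p + e) atTop (𝓝 ((0 : ℝ) • p + e)) :=
      (tendsto_inv_atTop_zero.smul_const p).add_const e
    rw [zero_smul, zero_add] at h4
    refine h4.congr' ((eventually_gt_atTop 0).mono fun x hx => ?_)
    dsimp only
    rw [smul_add, smul_smul, inv_mul_cancel₀ hx.ne', one_smul]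
  exact isClosed_diagSolvable.mem_of_tendsto hlim
    ((eventually_ge_atTop 0).mono fun x hx => (hall x hx).smul _)

theorem exists_separating {n : ℕ} {p : (Fin n → ℝ) × (Fin n → ℝ) × (Fin n → ℝ)}
    (hp : p ∉ HiveSet n) :
    ∃ f : (Fin n → ℝ) × (Fin n → ℝ) × (Fin n → ℝ) →L[ℝ] ℝ, (∀ q ∈ HiveSet n, f q ≤ 0) ∧ 0 < f p := by
  obtain ⟨f, u, h1, h2⟩ :=
    geometric_hahn_banach_closed_point (HiveSet.convex n) (isClosed_hiveSet n) hp
  have h0 : (0 : (Fin n → ℝ) × (Fin n → ℝ) × (Fin n → ℝ)) ∈ HiveSet n := by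
    have := HiveSet.scalar_mem n 0 0
    rw [add_zero] at this
    exact this
  have hu : 0 < u := by simpa using h1 0 h0
  refine ⟨f, fun q hq => ?_, hu.trans h2⟩
  by_contra! hlt
  have := h1 _ (HiveSet.smul_mem hq (r := u / f q) (by positivity))
  rw [map_smul, smul_eq_mul, div_mul_cancel₀ _ hlt.ne'] at this
  exact lt_irrefl _ this

theorem antitone_smul {n : ℕ} {a : Fin n → ℝ} (h : Antitone a) {r : ℝ} (hr : 0 ≤ r) :
    Antitone (r • a) := fun _ _ hij => mul_le_mul_of_nonneg_left (h hij) hr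

theorem hornCone_eq_hSet (n : ℕ) : HornCone n = HSet n := by
  ext p
  constructor
  · rintro ⟨A, B, hA, hB, hC, h1, h2, h3, ⟨σ, e1⟩, ⟨τ, e2⟩, ⟨ρ, e3⟩⟩
    refine ⟨h1, h2, h3, hRel_iff.1 ?_⟩
    rw [e1, e2, e3, valuesOf_comp_perm, valuesOf_comp_perm, valuesOf_comp_perm]
    have h1 : SpecIs (1 : Matrix (Fin n) (Fin n) ℂ) (Multiset.replicate n 1) := by
      have := specIs_rdiag (fun _ : Fin n => (1 : ℝ))
      rwa [rdiag_const, one_smul, valuesOf_const, Fintype.card_fin] at this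
    exact ⟨1, A, B, A + B, h1, hA.specIs, hB.specIs, hC.specIs, by rw [one_mul, mul_one]⟩
  · rintro ⟨h1, h2, h3, U, hU, V, hV, e⟩
    dsimp only at e
    rw [rdiag_const, one_smul, one_mul, mul_one] at e
    have hA := specIs_unitary_conj hU p.1
    have hB := specIs_rdiag p.2.1
    have hC := specIs_unitary_conj hV p.2.2
    rw [← e] at hC
    exact ⟨_, _, hA.1, hB.1, hC.1, h1, h2, h3,
      exists_perm_of_valuesOf_eq (hA.unique hA.1.specIs),
      exists_perm_of_valuesOf_eq (hB.unique hB.1.specIs),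
      exists_perm_of_valuesOf_eq (hC.unique hC.1.specIs)⟩

theorem hSet_subset_hiveSet : ∀ n, HSet n ⊆ HiveSet n := by
  intro n
  induction n using Nat.strong_induction_on with
  | _ n ih =>
  intro p hp
  rcases Nat.eq_zero_or_pos n with rfl | hn
  · have := HiveSet.scalar_mem 0 0 0
    convert this using 1
    exact Subsingleton.elim _ _
  by_contra hpK
  obtain ⟨f, hf, hfp⟩ := exists_separating hpK
  have hray : ∀ e : (Fin n → ℝ) × (Fin n → ℝ) × (Fin n → ℝ), Antitone e.1 → Antitone e.2.1 →
      Antitone e.2.2 → ∑ i, e.1 i + ∑ i, e.2.1 i = ∑ i, e.2.2 i → 0 < f e →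
      DiagSolvable ((fun _ => 1), e) := by
    intro e h1 h2 h3 he hfe
    refine diagSolvable_ray hn hp he fun r hr hsp => ?_
    have hmem := hsp.mem_hiveSet ih (p := p + r • e)
      (hp.1.add (antitone_smul h1 hr)) (hp.2.1.add (antitone_smul h2 hr))
      (hp.2.2.1.add (antitone_smul h3 hr))
    have := hf _ hmem
    rw [map_add, map_smul, smul_eq_mul] at this
    have : 0 ≤ r * f e := by positivity
    linarith
  have hn' : (n : ℝ) ≠ 0 := by positivity
  have hsum := hp.2.2.2.sum_eq
  obtain ⟨h1, h2, h3, -⟩ := hp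
  set x := (∑ i, p.1 i) / n with hx
  set y := (∑ i, p.2.1 i) / n with hy
  have hxs : ∑ i, p.1 i = n * x := by rw [hx]; field_simp
  have hys : ∑ i, p.2.1 i = n * y := by rw [hy]; field_simp
  rw [hxs, hys] at hsum
  set e1 : (Fin n → ℝ) × (Fin n → ℝ) × (Fin n → ℝ) := (fun i => p.1 i - x, 0, 0) with he1
  set e2 : (Fin n → ℝ) × (Fin n → ℝ) × (Fin n → ℝ) := (0, fun i => p.2.1 i - y, 0) with he2
  set e3 : (Fin n → ℝ) × (Fin n → ℝ) × (Fin n → ℝ) := (0, 0, fun i => p.2.2 i - (x + y)) with he3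
  have hanti0 : Antitone (0 : Fin n → ℝ) := antitone_const
  have hdec : p = (fun _ => x, fun _ => y, fun _ => x + y) + e1 + e2 + e3 := by
    ext i <;> simp [he1, he2, he3]
  have hf1 : f e1 ≤ 0 := by
    by_contra! hlt
    have hd := hray e1 (fun i j hij => sub_le_sub_right (h1 hij) x) hanti0 hanti0
      (by simp [he1, Finset.sum_sub_distrib, hxs]) hlt
    obtain ⟨U, hU, V, hV, e⟩ := hd
    simp only [he1, rdiag_const, one_smul, one_mul, mul_one, rdiag_zero, mul_zero, zero_mul,
      add_zero] at e
    have h0 := eq_zero_of_unitary_conj_eq_zero hU e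
    rw [he1, h0] at hlt
    exact lt_irrefl _ (hlt.trans_eq (map_zero f))
  have hf2 : f e2 ≤ 0 := by
    by_contra! hlt
    have hd := hray e2 hanti0 (fun i j hij => sub_le_sub_right (h2 hij) y) hanti0
      (by simp [he2, Finset.sum_sub_distrib, hys]) hlt
    obtain ⟨U, hU, V, hV, e⟩ := hd
    simp only [he2, rdiag_const, one_smul, mul_one, rdiag_zero, mul_zero, zero_mul,
      zero_add] at e
    have h0 := eq_zero_of_unitary_conj_eq_zero (one_mem _) (by rwa [one_mul, star_one, mul_one])
    rw [he2, h0] at hlt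
    exact lt_irrefl _ (hlt.trans_eq (map_zero f))
  have hf3 : f e3 ≤ 0 := by
    by_contra! hlt
    have hd := hray e3 hanti0 hanti0 (fun i j hij => sub_le_sub_right (h3 hij) (x + y))
      (by simp [he3, Finset.sum_sub_distrib, ← hsum]) hlt
    obtain ⟨U, hU, V, hV, e⟩ := hd
    simp only [he3, rdiag_const, one_smul, mul_one, rdiag_zero, mul_zero, zero_mul,
      add_zero] at e
    have h0 := eq_zero_of_unitary_conj_eq_zero hV e.symm
    rw [he3, h0] at hlt
    exact lt_irrefl _ (hlt.trans_eq (map_zero f))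
  rw [hdec, map_add, map_add, map_add] at hfp
  have := hf _ (HiveSet.scalar_mem n x y)
  linarith

end HornInHive

section NetworkPaths

/-- There is a slanted edge of the triangular network from `(x, r + 1)` to `(x + 1, r)`. -/
def Slant (n x r : ℕ) : Prop :=
  ∃ s, 1 ≤ s ∧ s ≤ r ∧ r + 1 ≤ n ∧ x = 2 * (n - 1 - r) + 3 * (s - 1) + 1

/-- `m` is the height function of a source-to-sink path of the triangular network. -/
def GPath (n : ℕ) (m : ℕ → ℕ) : Prop :=
  ∀ x < 3 * n, 1 ≤ m x ∧ m x ≤ n ∧ (m (x + 1) = m x ∨ m x = m (x + 1) + 1 ∧ Slant n x (m (x + 1)))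

/-- The list of grid points `(x, m x)`, `x ≤ N`. -/
def pathList (N : ℕ) (m : ℕ → ℕ) : List (ℝ × ℝ) :=
  (List.range (N + 1)).map fun x : ℕ => ((x : ℝ), (m x : ℝ))

/-- The edge from `(x, a)` to `(x + 1, b)`. -/
def gridEdge (x a b : ℕ) : (ℝ × ℝ) × (ℝ × ℝ) := (((x : ℝ), (a : ℝ)), ((x : ℝ) + 1, (b : ℝ)))

theorem pathWeight_pathList (ε : (ℝ × ℝ) × (ℝ × ℝ) → ℝ) (N : ℕ) (m : ℕ → ℕ) :
    pathWeight ε (pathList N m) = ∑ x ∈ Finset.range N, ε (gridEdge x (m x) (m (x + 1))) := by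
  have : (pathList N m).zip (pathList N m).tail =
      (List.range N).map fun x => gridEdge x (m x) (m (x + 1)) := by
    refine List.ext_getElem (by simp [pathList]) fun i h1 h2 => ?_
    simp [pathList, gridEdge]
  rw [pathWeight, this, Finset.sum_range, List.map_map, ← List.sum_ofFn]
  congr 1
  refine List.ext_getElem (by simp) fun i h1 h2 => ?_
  simp

theorem mem_pathList {N : ℕ} {m : ℕ → ℕ} {v : ℝ × ℝ} :
    v ∈ pathList N m ↔ ∃ x ≤ N, v = ((x : ℝ), (m x : ℝ)) := by
  simp [pathList, eq_comm]

theorem getLast?_pathList (N : ℕ) (m : ℕ → ℕ) :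
    (pathList N m).getLast? = some ((N : ℝ), (m N : ℝ)) := by
  simp [pathList, List.range_succ]

theorem pathList_disjoint {N : ℕ} {m m' : ℕ → ℕ} :
    (∀ v ∈ pathList N m, v ∉ pathList N m') ↔ ∀ x ≤ N, m x ≠ m' x := by
  constructor
  · intro h x hx e
    exact h _ (mem_pathList.2 ⟨x, hx, rfl⟩) (mem_pathList.2 ⟨x, hx, by rw [e]⟩)
  · rintro h v hv hv'
    obtain ⟨x, hx, rfl⟩ := mem_pathList.1 hv
    obtain ⟨y, hy, e⟩ := mem_pathList.1 hv'
    have h1 : x = y := by simpa using congrArg Prod.fst e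
    subst h1
    exact h x hx (by simpa using congrArg Prod.snd e)

theorem isThroughPath_iff {n : ℕ} (hn : 1 ≤ n) {Γ : PlanarNetwork}
    (ha : Γ.a = 0) (hb : Γ.b = 3 * n)
    (hE : ∀ e : (ℝ × ℝ) × (ℝ × ℝ), e ∈ Γ.E ↔
      ((∃ j m : ℕ, j + 1 ≤ 3 * n ∧ 1 ≤ m ∧ m ≤ n ∧
          e = (((j : ℝ), (m : ℝ)), ((j : ℝ) + 1, (m : ℝ)))) ∨
       (∃ r s : ℕ, 1 ≤ s ∧ s ≤ r ∧ r + 1 ≤ n ∧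
          e = ((((2 * (n - 1 - r) + 3 * (s - 1) + 1 : ℕ) : ℝ), (r : ℝ) + 1),
               (((2 * (n - 1 - r) + 3 * (s - 1) + 2 : ℕ) : ℝ), (r : ℝ))))))
    {L : List (ℝ × ℝ)} :
    IsThroughPath Γ L ↔ ∃ m, GPath n m ∧ L = pathList (3 * n) m := by
  have hE' : ∀ e : (ℝ × ℝ) × (ℝ × ℝ), e ∈ Γ.E ↔ ∃ x a b, x < 3 * n ∧ 1 ≤ a ∧ a ≤ n ∧
      (b = a ∨ a = b + 1 ∧ Slant n x b) ∧ e = gridEdge x a b := by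
    intro e
    rw [hE]
    constructor
    · rintro (⟨j, m, h1, h2, h3, rfl⟩ | ⟨r, s, h1, h2, h3, rfl⟩)
      · exact ⟨j, m, m, h1, h2, h3, Or.inl rfl, rfl⟩
      · refine ⟨2 * (n - 1 - r) + 3 * (s - 1) + 1, r + 1, r, by omega, by omega, h3,
          Or.inr ⟨rfl, s, h1, h2, h3, rfl⟩, ?_⟩
        simp only [gridEdge]
        push_cast
        ring_nf
    · rintro ⟨x, a, b, h1, h2, h3, rfl | ⟨rfl, s, h4, h5, h6, rfl⟩, rfl⟩
      · exact Or.inl ⟨x, b, h1, h2, h3, rfl⟩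
      · refine Or.inr ⟨b, s, h4, h5, h6, ?_⟩
        simp only [gridEdge]
        push_cast
        ring_nf
  constructor
  · rintro ⟨p, q, ⟨hne, hch, hhd, hlast⟩, hp, hq⟩
    rw [ha] at hp
    rw [hb] at hq
    have hlen : 0 < L.length := List.length_pos_iff.2 hne
    have h0 : L[0] = p := by
      rw [List.head?_eq_getElem?, List.getElem?_eq_getElem hlen] at hhd
      exact Option.some.inj hhd
    have hl : L[L.length - 1] = q := by
      rw [List.getLast?_eq_getElem?, List.getElem?_eq_getElem (by omega)] at hlast
      exact Option.some.inj hlast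
    have hstep : ∀ i (h : i + 1 < L.length), (L[i], L[i + 1]) ∈ Γ.E :=
      List.isChain_iff_getElem.1 hch
    have hx : ∀ i (h : i < L.length), L[i].1 = i := by
      intro i
      induction i with
      | zero => intro h; rw [h0, hp]; simp
      | succ i ih =>
        intro h
        obtain ⟨x, a, b, -, -, -, -, e⟩ := (hE' _).1 (hstep i h)
        have e1 := congrArg (fun z => z.1.1) e
        have e2 := congrArg (fun z => z.2.1) e
        simp only [gridEdge] at e1 e2
        rw [e2, ← e1, ih (by omega)]
        push_cast; ring
    have hlen' : L.length = 3 * n + 1 := by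
      have := hx (L.length - 1) (by omega)
      rw [hl, hq] at this
      have : 3 * n = L.length - 1 := by exact_mod_cast this
      omega
    have hnat : ∀ i (h : i < L.length), ∃ m : ℕ, L[i] = ((i : ℝ), (m : ℝ)) := by
      intro i h
      rcases Nat.lt_or_ge (i + 1) L.length with h' | h'
      · obtain ⟨x, a, b, -, -, -, -, e⟩ := (hE' _).1 (hstep i h')
        have e1 := congrArg Prod.fst e
        simp only [gridEdge] at e1
        exact ⟨a, Prod.ext (hx i h) (by rw [e1])⟩
      · obtain ⟨i, rfl⟩ : ∃ j, i = j + 1 := ⟨i - 1, by omega⟩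
        obtain ⟨x, a, b, -, -, -, -, e⟩ := (hE' _).1 (hstep i h)
        have e1 := congrArg Prod.snd e
        simp only [gridEdge] at e1
        exact ⟨b, Prod.ext (hx _ h) (by rw [e1])⟩
    choose! m hm using hnat
    refine ⟨m, fun x hx3 => ?_, List.ext_getElem (by simp [pathList, hlen']) fun i h1 h2 => ?_⟩
    · obtain ⟨x', a, b, -, h2, h3, h4, e⟩ := (hE' _).1 (hstep x (by omega))
      rw [hm x (by omega), hm (x + 1) (by omega)] at e
      simp only [gridEdge, Prod.mk.injEq, Nat.cast_inj] at e
      obtain ⟨⟨rfl, rfl⟩, -, rfl⟩ := e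
      exact ⟨h2, h3, h4⟩
    · rw [hm i h1]; simp [pathList]
  · rintro ⟨m, hm, rfl⟩
    refine ⟨((0 : ℕ), (m 0 : ℝ)), ((3 * n : ℕ), (m (3 * n) : ℝ)), ⟨by simp [pathList], ?_, ?_, ?_⟩,
      by simp [ha], by simp [hb]⟩
    · refine List.isChain_iff_getElem.2 fun i h => ?_
      have hi : i < 3 * n := by simpa [pathList] using h
      obtain ⟨h1, h2, h3⟩ := hm i hi
      rw [hE']
      exact ⟨i, m i, m (i + 1), hi, h1, h2, h3, by simp [pathList, gridEdge]⟩
    · simp [pathList, List.range_succ_eq_map]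
    · exact getLast?_pathList _ _

theorem isThroughPath_trivial_iff {n : ℕ} {Δ : PlanarNetwork}
    (ha : Δ.a = 3 * n) (hb : Δ.b = 3 * n + 1)
    (hE : ∀ e : (ℝ × ℝ) × (ℝ × ℝ), e ∈ Δ.E ↔
      ∃ m : ℕ, 1 ≤ m ∧ m ≤ n ∧
        e = (((3 * n : ℝ), (m : ℝ)), ((3 * n : ℝ) + 1, (m : ℝ))))
    {L : List (ℝ × ℝ)} :
    IsThroughPath Δ L ↔ ∃ m : ℕ, 1 ≤ m ∧ m ≤ n ∧
      L = [((3 * n : ℝ), (m : ℝ)), ((3 * n : ℝ) + 1, (m : ℝ))] := by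
  constructor
  · rintro ⟨p, q, ⟨hne, hch, hhd, hlast⟩, hp, hq⟩
    rw [ha] at hp
    rw [hb] at hq
    match L, hne with
    | [x], _ =>
      simp only [List.head?_cons, Option.some.injEq, List.getLast?_singleton] at hhd hlast
      subst hhd hlast
      linarith
    | [x, y], _ =>
      obtain ⟨m, h1, h2, e⟩ := (hE _).1 (List.isChain_cons_cons.1 hch).1
      obtain ⟨rfl, rfl⟩ := Prod.mk.injEq _ _ _ _ ▸ e
      exact ⟨m, h1, h2, rfl⟩
    | x :: y :: z :: l, _ =>
      have h := List.isChain_cons_cons.1 hch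
      obtain ⟨m, -, -, e⟩ := (hE _).1 h.1
      obtain ⟨m', -, -, e'⟩ := (hE _).1 (List.isChain_cons_cons.1 h.2).1
      have h1 := congrArg (fun z => z.2.1) e
      have h2 := congrArg (fun z => z.1.1) e'
      simp only at h1 h2
      linarith
  · rintro ⟨m, h1, h2, rfl⟩
    refine ⟨((3 * n : ℝ), (m : ℝ)), ((3 * n : ℝ) + 1, (m : ℝ)), ⟨by simp, ?_, rfl, rfl⟩, ha.symm,
      hb.symm⟩
    refine List.isChain_pair.2 ?_
    exact (hE _).2 ⟨m, h1, h2, rfl⟩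

/-- The total weight of a family of paths with heights `G j`, of which those in `S` are continued
to the right. -/
def familyWeight (ε : (ℝ × ℝ) × (ℝ × ℝ) → ℝ) (n : ℕ) {k : ℕ} (G : Fin k → ℕ → ℕ)
    (S : Finset (Fin k)) : ℝ :=
  ∑ j, ∑ x ∈ Finset.range (3 * n), ε (gridEdge x (G j x) (G j (x + 1))) +
    ∑ j ∈ S, ε (gridEdge (3 * n) (G j (3 * n)) (G j (3 * n)))

/-- The family `G` consists of pairwise disjoint paths, in order of increasing height. -/
def IsFamily (n : ℕ) {k : ℕ} (G : Fin k → ℕ → ℕ) : Prop :=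
  (∀ j, GPath n (G j)) ∧ ∀ x ≤ 3 * n, StrictMono fun j => G j x

theorem GPath.lt_of_ne {n : ℕ} {m m' : ℕ → ℕ} (h : GPath n m) (h' : GPath n m')
    (hne : ∀ x ≤ 3 * n, m x ≠ m' x) (h0 : m 0 < m' 0) : ∀ x ≤ 3 * n, m x < m' x := by
  intro x
  induction x with
  | zero => exact fun _ => h0
  | succ x ih =>
    intro hx
    have h1 := ih (by omega)
    have h2 := (h x (by omega)).2.2
    have h3 := (h' x (by omega)).2.2
    have h4 := hne (x + 1) hx
    rcases h2 with h2 | ⟨h2, -⟩ <;> rcases h3 with h3 | ⟨h3, -⟩ <;> omega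

theorem GPath.bounds {n : ℕ} (hn : 1 ≤ n) {m : ℕ → ℕ} (h : GPath n m) :
    ∀ x ≤ 3 * n, 1 ≤ m x ∧ m x ≤ n := by
  intro x hx
  rcases Nat.lt_or_ge x (3 * n) with h1 | h1
  · exact ⟨(h x h1).1, (h x h1).2.1⟩
  · obtain ⟨x, rfl⟩ : ∃ y, x = y + 1 := ⟨x - 1, by omega⟩
    obtain ⟨h1, h2, h3 | ⟨h3, s, h4, h5, -⟩⟩ := h x (by omega) <;> omega

theorem exists_isFamily {n k : ℕ} {g : Fin k → ℕ → ℕ} (hg : ∀ j, GPath n (g j))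
    (hne : ∀ j j', j ≠ j' → ∀ x ≤ 3 * n, g j x ≠ g j' x) :
    ∃ σ : Equiv.Perm (Fin k), IsFamily n fun j => g (σ j) := by
  refine ⟨Tuple.sort fun j => g j 0, fun j => hg _, ?_⟩
  have h0 : StrictMono fun j => g (Tuple.sort (fun j => g j 0) j) 0 := by
    refine (Tuple.monotone_sort fun j => g j 0).strictMono_of_injective fun a b hab => ?_
    by_contra hab'
    exact hne _ _ (fun h => hab' ((Tuple.sort fun j => g j 0).injective h)) 0 (by omega) hab
  exact fun x hx a b hab => (hg _).lt_of_ne (hg _)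
    (hne _ _ ((Tuple.sort fun j => g j 0).injective.ne hab.ne)) (h0 hab) x hx

theorem mem_gdWeights_iff {n : ℕ} (hn : 1 ≤ n) {Γ Δ : PlanarNetwork}
    (hΓ : ∀ L, IsThroughPath Γ L ↔ ∃ m, GPath n m ∧ L = pathList (3 * n) m)
    (hΔ : ∀ L, IsThroughPath Δ L ↔ ∃ m : ℕ, 1 ≤ m ∧ m ≤ n ∧
      L = [((3 * n : ℝ), (m : ℝ)), ((3 * n : ℝ) + 1, (m : ℝ))])
    {ε : (ℝ × ℝ) × (ℝ × ℝ) → ℝ} {i k : ℕ} {y : ℝ} :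
    y ∈ gdWeights Γ Δ ε i k ↔ ∃ (G : Fin k → ℕ → ℕ) (S : Finset (Fin k)),
      S.card = i ∧ IsFamily n G ∧ y = familyWeight ε n G S := by
  constructor
  · rintro ⟨G, D, hG, hD, hGd, hDd, hGD, rfl⟩
    choose g hg hgG using fun j => (hΓ _).1 (hG j)
    choose d hd1 hdn hdD using fun j => (hΔ _).1 (hD j)
    choose f hf using hGD
    have hfd : ∀ j, d j = g (f j) (3 * n) := by
      intro j
      have := hf j
      rw [hdD, hgG, getLast?_pathList] at this
      simpa using this
    have hfi : Function.Injective f := by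
      intro a b hab
      by_contra hne
      refine hDd a b hne ((3 * n : ℝ), (d a : ℝ)) (by rw [hdD]; simp) ?_
      rw [hdD b, hfd a, hfd b, hab]
      simp
    have hgd : ∀ j j', j ≠ j' → ∀ x ≤ 3 * n, g j x ≠ g j' x := fun j j' hj => by
      have := hGd j j' hj
      rw [hgG, hgG] at this
      exact pathList_disjoint.1 this
    obtain ⟨σ, hσ⟩ := exists_isFamily hg hgd
    refine ⟨_, Finset.univ.image fun j => σ.symm (f j), ?_, hσ, ?_⟩
    · rw [Finset.card_image_of_injective _ fun a b hab => hfi (σ.symm.injective hab),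
        Finset.card_univ, Fintype.card_fin]
    · rw [familyWeight, Finset.sum_image (by
        intro a _ b _ hab; exact hfi (σ.symm.injective hab))]
      congr 1
      · rw [Equiv.sum_comp σ fun j => ∑ x ∈ Finset.range (3 * n), ε (gridEdge x (g j x) (g j (x + 1)))]
        exact Finset.sum_congr rfl fun j _ => by rw [hgG, pathWeight_pathList]
      · refine Finset.sum_congr rfl fun j _ => ?_
        rw [hdD, Equiv.apply_symm_apply, ← hfd]
        simp [pathWeight, gridEdge]
  · rintro ⟨G, S, hS, hG, rfl⟩
    have hlt := hG.2 (3 * n) le_rfl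
    refine ⟨fun j => pathList (3 * n) (G j), fun j => [((3 * n : ℝ), (G (S.orderEmbOfFin hS j) (3 * n) : ℝ)),
      ((3 * n : ℝ) + 1, (G (S.orderEmbOfFin hS j) (3 * n) : ℝ))],
      fun j => (hΓ _).2 ⟨_, hG.1 j, rfl⟩, fun j => (hΔ _).2 ⟨_, ((hG.1 _).bounds hn _ le_rfl).1,
        ((hG.1 _).bounds hn _ le_rfl).2, rfl⟩, ?_, ?_, fun j => ⟨S.orderEmbOfFin hS j, ?_⟩, ?_⟩
    · exact fun j j' hj => pathList_disjoint.2 fun x hx => (hG.2 x hx).injective.ne hj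
    · intro j j' hj v hv hv'
      have hne : G (S.orderEmbOfFin hS j) (3 * n) ≠ G (S.orderEmbOfFin hS j') (3 * n) :=
        hlt.injective.ne ((S.orderEmbOfFin hS).injective.ne hj)
      apply hne
      simp only [List.mem_cons, List.not_mem_nil, or_false] at hv hv'
      have h2 : v.2 = (G (S.orderEmbOfFin hS j) (3 * n) : ℝ) := by rcases hv with rfl | rfl <;> rfl
      have h3 : v.2 = (G (S.orderEmbOfFin hS j') (3 * n) : ℝ) := by
        rcases hv' with rfl | rfl <;> rfl
      exact_mod_cast h2.symm.trans h3
    · rw [getLast?_pathList]; simp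
    · rw [familyWeight]
      congr 1
      · exact Finset.sum_congr rfl fun j _ => by rw [pathWeight_pathList]
      · conv_lhs => rw [← Finset.map_orderEmbOfFin_univ S hS, Finset.sum_map]
        refine Finset.sum_congr rfl fun j _ => ?_
        simp [pathWeight, gridEdge]

end NetworkPaths

section TableauBounds

variable {n : ℕ} {t : ℕ → ℕ → ℝ}

/-- The horizontal differences of a tableau. -/
def tabH (t : ℕ → ℕ → ℝ) (i k : ℕ) : ℝ := t (i + 1) k - t i k

/-- The vertical differences of a tableau. -/
def tabV (t : ℕ → ℕ → ℝ) (i k : ℕ) : ℝ := t i (k + 1) - t i k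

/-- The diagonal differences of a tableau. -/
def tabD (t : ℕ → ℕ → ℝ) (i k : ℕ) : ℝ := t (i + 1) (k + 1) - t i k

theorem le_of_succ_le {f : ℕ → ℝ} {a b n : ℕ} (h : ∀ k, a ≤ k → k < n → f (k + 1) ≤ f k) (hab : a ≤ b)
    (hb : b ≤ n) : f b ≤ f a := by
  induction b, hab using Nat.le_induction with
  | base => exact le_rfl
  | succ b hab ih => exact (h b hab (by omega)).trans (ih (by omega))

theorem MemC3.tabH_mono (ht : MemC3 n t) {s a b : ℕ} (hs : s + 1 ≤ a) (hab : a ≤ b) (hb : b ≤ n) :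
    tabH t s a ≤ tabH t s b := by
  have := le_of_succ_le (f := fun k => -tabH t s k) (n := n) (fun k hk hkn => by
    have := (ht (s + 1) k (by omega) (by omega) hkn).1
    simp only [Nat.add_sub_cancel] at this
    simp only [tabH]
    linarith) hab hb
  simpa using this

theorem MemC3.tabD_succ_le (ht : MemC3 n t) {s k : ℕ} (hs : s + 1 ≤ k) (hk : k < n) :
    tabD t (s + 1) k ≤ tabD t s k := by
  have := (ht (s + 1) k (by omega) hs hk).2.1
  simp only [Nat.add_sub_cancel] at this
  simp only [tabD]
  linarith

theorem MemC3.tabD_anti (ht : MemC3 n t) {s a b : ℕ} (hs : s ≤ a) (hab : a ≤ b) (hb : b + 1 ≤ n) :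
    tabD t s b ≤ tabD t s a :=
  le_of_succ_le (f := tabD t s) (n := n - 1) (fun k hk hkn => by
    have := (ht (s + 1) (k + 1) (by omega) (by omega) (by omega)).2.2
    simp only [Nat.add_sub_cancel] at this
    simp only [tabD]
    linarith) hab (by omega)

theorem MemC3.tabV_anti (ht : MemC3 n t) {s a b : ℕ} (hs : s ≤ a) (hab : a ≤ b) (hb : b + 1 ≤ n) :
    tabV t s b ≤ tabV t s a :=
  le_of_succ_le (f := tabV t s) (n := n - 1) (fun k hk hkn => by
    simp only [tabV]
    rcases Nat.eq_zero_or_pos s with rfl | h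
    · have h1 := (ht 1 (k + 1) (by omega) (by omega) (by omega)).2.2
      have h2 := (ht 1 (k + 1) (by omega) (by omega) (by omega)).1
      simp only [Nat.add_sub_cancel, Nat.sub_self] at h1 h2
      linarith
    · obtain ⟨s, rfl⟩ : ∃ r, s = r + 1 := ⟨s - 1, by omega⟩
      have h1 := (ht (s + 1) (k + 1) (by omega) (by omega) (by omega)).2.2
      have h2 := (ht (s + 1) k (by omega) (by omega) (by omega)).1
      simp only [Nat.add_sub_cancel] at h1 h2
      linarith) hab (by omega)

theorem MemC3.tabH_last_anti (ht : MemC3 n t) {a b : ℕ} (hab : a ≤ b) (hb : b + 1 ≤ n) :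
    tabH t b n ≤ tabH t a n :=
  le_of_succ_le (f := fun s => tabH t s n) (n := n - 1) (fun s _ hkn => by
    obtain ⟨n, rfl⟩ : ∃ m, n = m + 1 := ⟨n - 1, by omega⟩
    have h1 := (ht (s + 1) n (by omega) (by omega) (by omega)).2.1
    have h2 := (ht (s + 1) n (by omega) (by omega) (by omega)).1
    simp only [Nat.add_sub_cancel] at h1 h2
    simp only [tabH]
    linarith) hab (by omega)

theorem sum_tabD_sub (κ : ℕ → ℕ) (q : ℕ) :
    tabV t 0 (κ 0) + ∑ s ∈ Finset.range q, (tabH t s (κ s + 1) - tabH t s (κ (s + 1))) =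
      ∑ s ∈ Finset.range q, (tabD t s (κ s) - tabD t s (κ (s + 1))) + tabV t q (κ q) := by
  induction q with
  | zero => simp
  | succ q ih =>
    rw [Finset.sum_range_succ, Finset.sum_range_succ, ← add_assoc, ih]
    simp only [tabV, tabH, tabD]
    ring

theorem MemC3.sum_tabD_le (ht : MemC3 n t) {κ : ℕ → ℕ} {q r : ℕ} (hqr : q ≤ r)
    (h : ∀ s ≤ r, s ≤ κ s ∧ κ s < n) :
    ∑ s ∈ Finset.range r, (tabD t s (κ s) - tabD t s (κ (s + 1))) + tabD t r (κ r) ≤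
      ∑ s ∈ Finset.range q, (tabD t s (κ s) - tabD t s (κ (s + 1))) + tabD t q (κ q) :=
  le_of_succ_le (f := fun r => ∑ s ∈ Finset.range r, (tabD t s (κ s) - tabD t s (κ (s + 1))) +
    tabD t r (κ r)) (n := r) (fun s _ hs => by
      rw [Finset.sum_range_succ]
      have := ht.tabD_succ_le (h (s + 1) hs).1 (h (s + 1) hs).2
      linarith) hqr le_rfl

theorem MemC3.total_le (ht : MemC3 n t) (h0 : t 0 0 = 0) {i k : ℕ} (hik : i ≤ k)
    {κ : ℕ → ℕ → ℕ} (h1 : ∀ j < k, ∀ s ≤ j, κ j s < n) (h2 : ∀ j < k, ∀ s, s ≤ κ j s)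
    (h3 : ∀ j, j + 1 < k → ∀ s, κ (j + 1) (s + 1) ≤ κ j s)
    (h4 : ∀ j, j + 1 < k → ∀ s, κ (j + 1) s < κ j s) :
    ∑ j ∈ Finset.range k, (if j < i then
        ∑ s ∈ Finset.range j, (tabD t s (κ j s) - tabD t s (κ j (s + 1))) + tabD t j (κ j j)
      else ∑ s ∈ Finset.range i, (tabD t s (κ j s) - tabD t s (κ j (s + 1))) + tabV t i (κ j i)) ≤
      t i k := by
  have key : ∀ J ≤ k, ∑ j ∈ Finset.range J, (if j < i then
        ∑ s ∈ Finset.range j, (tabD t s (κ j s) - tabD t s (κ j (s + 1))) + tabD t j (κ j j)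
      else ∑ s ∈ Finset.range i, (tabD t s (κ j s) - tabD t s (κ j (s + 1))) + tabV t i (κ j i)) ≤
      ∑ s ∈ Finset.range (min i J), tabD t s (κ (J - 1) s) +
        ∑ j ∈ Finset.Ico i J, tabV t i (κ j i) := by
    intro J
    induction J with
    | zero => simp
    | succ J ih =>
      intro hJ
      have ih' := ih (by omega)
      have hcol : ∑ s ∈ Finset.range (min i J), tabD t s (κ (J - 1) s) ≤
          ∑ s ∈ Finset.range (min i J), tabD t s (κ J (s + 1)) := by
        refine Finset.sum_le_sum fun s hs => ?_
        rw [Finset.mem_range, lt_min_iff] at hs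
        have hJs : κ J (s + 1) ≤ κ (J - 1) s := by
          have := h3 (J - 1) (by omega) s
          rwa [Nat.sub_add_cancel (by omega)] at this
        exact ht.tabD_anti (by have := h2 J hJ (s + 1); omega) hJs
          (h1 (J - 1) (by omega) s (by omega))
      rw [Finset.sum_range_succ, Nat.add_sub_cancel]
      split_ifs with hJi
      · rw [min_eq_right hJi.le] at ih' hcol
        rw [min_eq_right hJi, Finset.sum_range_succ, Finset.sum_sub_distrib,
          Finset.Ico_eq_empty (by omega), Finset.sum_empty]
        rw [Finset.Ico_eq_empty (by omega), Finset.sum_empty] at ih'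
        linarith
      · rw [min_eq_left (by omega)] at ih' hcol ⊢
        rw [Finset.sum_sub_distrib, Finset.sum_Ico_succ_top (by omega)]
        linarith
  refine (key k le_rfl).trans ?_
  rw [min_eq_left hik]
  have e1 : ∑ s ∈ Finset.range i, tabD t s (κ (k - 1) s) ≤ t i i := by
    calc ∑ s ∈ Finset.range i, tabD t s (κ (k - 1) s) ≤ ∑ s ∈ Finset.range i, tabD t s s := by
          refine Finset.sum_le_sum fun s hs => ?_
          rw [Finset.mem_range] at hs
          exact ht.tabD_anti le_rfl (h2 _ (by omega) s) (h1 _ (by omega) s (by omega))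
      _ = t i i := by
          simp only [tabD]
          rw [Finset.sum_range_sub fun s => t s s, h0, sub_zero]
  have hκ : ∀ m, ∀ j, j + m + 1 = k → i + m ≤ κ j i := by
    intro m
    induction m with
    | zero => intro j hj; exact h2 j (by omega) i
    | succ m ih =>
      intro j hj
      have := ih (j + 1) (by omega)
      have := h4 j (by omega) i
      omega
  have e2 : ∑ j ∈ Finset.Ico i k, tabV t i (κ j i) ≤ t i k - t i i := by
    calc ∑ j ∈ Finset.Ico i k, tabV t i (κ j i) ≤ ∑ j ∈ Finset.Ico i k, tabV t i (i + (k - 1 - j)) := by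
          refine Finset.sum_le_sum fun j hj => ?_
          rw [Finset.mem_Ico] at hj
          exact ht.tabV_anti (by omega) (hκ (k - 1 - j) j (by omega)) (h1 j hj.2 i hj.1)
      _ = ∑ m ∈ Finset.range (k - i), tabV t i (i + m) := by
          rw [Finset.sum_Ico_eq_sum_range, ← Finset.sum_range_reflect]
          refine Finset.sum_congr rfl fun m hm => ?_
          rw [Finset.mem_range] at hm
          congr 2
          omega
      _ = t i k - t i i := by
          have := Finset.sum_range_sub (fun m => t i (i + m)) (k - i)
          simp only [tabV]
          rw [add_zero, Nat.add_sub_cancel' hik] at this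
          exact this
  linarith

end TableauBounds

section HiveWeights

variable {n : ℕ} {m m' : ℕ → ℕ}

theorem GPath.step (h : GPath n m) {x : ℕ} (hx : x < 3 * n) :
    m (x + 1) = m x ∨ ∃ s, 1 ≤ s ∧ s ≤ m (x + 1) ∧ m x = m (x + 1) + 1 ∧ m x ≤ n ∧
      x + 2 * m x + 2 = 2 * n + 3 * s := by
  obtain ⟨h1, h2, h3 | ⟨h3, s, hs1, hs2, hs3, hs4⟩⟩ := h x hx
  · exact Or.inl h3
  · exact Or.inr ⟨s, hs1, hs2, h3, h2, by omega⟩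

/-- The height at which the path `m` enters the region above the `s`-th diagonal of slanted edges,
as seen up to abscissa `x`. -/
def entryHeight (n : ℕ) (m : ℕ → ℕ) (s : ℕ) : ℕ → ℕ
  | 0 => m 0
  | x + 1 => if x + 2 * m x + 2 ≤ 2 * n + 3 * s then m (x + 1) else entryHeight n m s x

theorem GPath.entryHeight_eq (h : GPath n m) (s : ℕ) :
    ∀ x ≤ 3 * n, x + 2 * m x + 1 ≤ 2 * n + 3 * s → entryHeight n m s x = m x
  | 0, _, _ => rfl
  | x + 1, hx, hs => by
    rw [entryHeight, if_pos]
    rcases h.step hx with h1 | ⟨s', h1⟩ <;> omega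

theorem GPath.le_entryHeight (h : GPath n m) (s : ℕ) : ∀ x ≤ 3 * n, m x ≤ entryHeight n m s x
  | 0, _ => le_rfl
  | x + 1, hx => by
    have ih := h.le_entryHeight s x (by omega)
    rw [entryHeight]
    split_ifs with hc
    · exact le_rfl
    · rcases h.step hx with h1 | ⟨s', h1⟩ <;> omega

theorem GPath.entryHeight_zero (h : GPath n m) : ∀ x ≤ 3 * n, entryHeight n m 0 x = m 0
  | 0, _ => rfl
  | x + 1, hx => by
    have ih := h.entryHeight_zero x (by omega)
    rw [entryHeight]
    split_ifs with hc
    · have := h.entryHeight_eq 0 x (by omega) (by omega)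
      rcases h.step hx with h1 | ⟨s', h1⟩ <;> omega
    · exact ih

theorem GPath.entryHeight_succ_le (h : GPath n m) (s : ℕ) :
    ∀ x ≤ 3 * n, entryHeight n m (s + 1) x ≤ entryHeight n m s x
  | 0, _ => le_rfl
  | x + 1, hx => by
    have ih := h.entryHeight_succ_le s x (by omega)
    have h2 := h.le_entryHeight s x (by omega)
    rw [entryHeight, entryHeight]
    rcases h.step hx with h1 | ⟨s', h1⟩ <;> split_ifs <;> omega

theorem GPath.entryHeight_succ (h : GPath n m) (s : ℕ) :
    ∀ x ≤ 3 * n, entryHeight n m (s + 1) x = entryHeight n m s x ∨ s + 1 ≤ entryHeight n m (s + 1) x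
  | 0, _ => Or.inl rfl
  | x + 1, hx => by
    have ih := h.entryHeight_succ s x (by omega)
    have h2 := h.entryHeight_eq (s + 1) x (by omega)
    rw [entryHeight, entryHeight]
    rcases h.step hx with h1 | ⟨s', h1⟩ <;> split_ifs <;> omega

theorem GPath.entryHeight_lt (h : GPath n m) (h' : GPath n m') (s : ℕ) :
    ∀ x ≤ 3 * n, (∀ y ≤ x, m y < m' y) → entryHeight n m s x < entryHeight n m' (s + 1) x
  | 0, _, hlt => hlt 0 le_rfl
  | x + 1, hx, hlt => by
    have ih := h.entryHeight_lt h' s x (by omega) fun y hy => hlt y (by omega)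
    have h1 := hlt x (by omega)
    have h2 := hlt (x + 1) le_rfl
    have h3 := h.entryHeight_eq s x (by omega)
    have h4 := h'.entryHeight_eq (s + 1) x (by omega)
    rw [entryHeight, entryHeight]
    rcases h.step hx with h5 | ⟨s', h5⟩ <;> rcases h'.step hx with h6 | ⟨s'', h6⟩ <;>
      split_ifs <;> omega

theorem GPath.entryHeight_le (hn : 1 ≤ n) (h : GPath n m) (s : ℕ) :
    ∀ x ≤ 3 * n, entryHeight n m s x ≤ n
  | 0, hx => (h.bounds hn 0 hx).2
  | x + 1, hx => by
    have ih := h.entryHeight_le hn s x (by omega)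
    have h2 := (h.bounds hn (x + 1) hx).2
    rw [entryHeight]
    split_ifs <;> assumption

theorem GPath.entryHeight_final (hn : 1 ≤ n) (h : GPath n m) {s : ℕ} (hs : m (3 * n) ≤ s) :
    entryHeight n m s (3 * n) = m (3 * n) := by
  have hF := (h.bounds hn (3 * n) le_rfl).2
  have key : ∀ d s, m (3 * n) ≤ s → n + 1 ≤ s + d → entryHeight n m s (3 * n) = m (3 * n) := by
    intro d
    induction d with
    | zero => exact fun s _ hd => h.entryHeight_eq s _ le_rfl (by omega)
    | succ d ih =>
      intro s hs hd
      have h1 := ih (s + 1) (by omega) (by omega)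
      have h2 := h.entryHeight_succ s (3 * n) le_rfl
      omega
  exact key (n + 1) s hs (by omega)

/-- The weighting of the triangular network that realizes the hive `t`. -/
noncomputable def hiveWeight (n : ℕ) (t : ℕ → ℕ → ℝ) (x a b : ℕ) : ℝ :=
  if x = 3 * n then tabH t (a - 1) n
  else if a = b then (if x = 0 then tabV t 0 (n - a) else 0)
  else tabH t ((x + 2 * a + 2 - 2 * n) / 3 - 1) (n + (x + 2 * a + 2 - 2 * n) / 3 - a) -
    tabH t ((x + 2 * a + 2 - 2 * n) / 3 - 1) (n + (x + 2 * a + 2 - 2 * n) / 3 - b)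

theorem GPath.sum_hiveWeight_aux (hn : 1 ≤ n) (h : GPath n m) (t : ℕ → ℕ → ℝ) :
    ∀ x < 3 * n, ∑ y ∈ Finset.range (x + 1), hiveWeight n t y (m y) (m (y + 1)) =
      tabV t 0 (n - m 0) + ∑ s ∈ Finset.range n,
        (tabH t s (n + s + 1 - entryHeight n m s (x + 1)) -
          tabH t s (n + s + 1 - entryHeight n m (s + 1) (x + 1)))
  | 0, hx => by
    have h1 : m 1 = m 0 := by
      rcases h.step hx with h1 | ⟨s', h1⟩
      · exact h1
      · omega
    rw [Finset.sum_range_one, zero_add, h1, hiveWeight, if_neg (by omega), if_pos rfl, if_pos rfl,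
      Finset.sum_eq_zero, add_zero]
    intro s _
    have e : ∀ s, entryHeight n m s 1 = m 0 := fun s => by
      rw [entryHeight, entryHeight, zero_add, h1, ite_self]
    rw [e, e, sub_self]
  | x + 1, hx => by
    have ih := h.sum_hiveWeight_aux hn t x (by omega)
    rw [Finset.sum_range_succ, ih, add_assoc, add_right_inj, ← eq_sub_iff_add_eq',
      ← Finset.sum_sub_distrib]
    rcases h.step hx with h1 | ⟨s', hs1, hs2, hs3, hs4, hs5⟩
    · rw [hiveWeight, if_neg (by omega), if_pos h1.symm, if_neg (by omega), Finset.sum_eq_zero]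
      intro s _
      have e : ∀ s, entryHeight n m s (x + 1 + 1) = entryHeight n m s (x + 1) := fun s => by
        rw [entryHeight]
        split_ifs with hc
        · rw [h.entryHeight_eq s (x + 1) (by omega) (by omega), h1]
        · rfl
      rw [e, e, sub_self]
    · have e1 : ∀ s, s' ≤ s → entryHeight n m s (x + 1 + 1) = m (x + 1 + 1) := fun s hs => by
        rw [entryHeight, if_pos (by omega)]
      have e2 : ∀ s, s' ≤ s → entryHeight n m s (x + 1) = m (x + 1) := fun s hs =>
        h.entryHeight_eq s _ (by omega) (by omega)
      have e3 : ∀ s, s < s' → entryHeight n m s (x + 1 + 1) = entryHeight n m s (x + 1) :=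
        fun s hs => by rw [entryHeight, if_neg (by omega)]
      rw [Finset.sum_eq_single (s' - 1)]
      · rw [e3 (s' - 1) (by omega), Nat.sub_add_cancel hs1, e1 s' le_rfl, e2 s' le_rfl, hiveWeight,
          if_neg (by omega), if_neg (by omega),
          show (x + 1 + 2 * m (x + 1) + 2 - 2 * n) / 3 = s' by omega,
          show n + (s' - 1) + 1 = n + s' by omega]
        ring
      · intro s _ hs
        rcases Nat.lt_or_ge s s' with hss | hss
        · rw [e3 s hss, e3 (s + 1) (by omega), sub_self]
        · rw [e1 s hss, e2 s hss, e1 (s + 1) (by omega), e2 (s + 1) (by omega)]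
          ring
      · intro hs
        rw [Finset.mem_range] at hs
        omega

/-- The column of the hive in which the path `m` crosses the `s`-th row. -/
def hiveCol (n : ℕ) (m : ℕ → ℕ) (s : ℕ) : ℕ := n + s - entryHeight n m s (3 * n)

theorem GPath.sum_hiveWeight (hn : 1 ≤ n) (h : GPath n m) (t : ℕ → ℕ → ℝ) :
    ∑ y ∈ Finset.range (3 * n), hiveWeight n t y (m y) (m (y + 1)) =
      tabV t 0 (hiveCol n m 0) + ∑ s ∈ Finset.range (m (3 * n)),
        (tabH t s (hiveCol n m s + 1) - tabH t s (hiveCol n m (s + 1))) := by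
  have := h.sum_hiveWeight_aux hn t (3 * n - 1) (by omega)
  rw [Nat.sub_add_cancel (by omega)] at this
  rw [this, hiveCol, h.entryHeight_zero _ le_rfl, add_zero, add_right_inj,
    ← Finset.sum_subset (Finset.range_subset_range.2 (h.bounds hn (3 * n) le_rfl).2)]
  · refine Finset.sum_congr rfl fun s _ => ?_
    have := h.entryHeight_le hn s (3 * n) le_rfl
    rw [hiveCol, hiveCol, show n + s - entryHeight n m s (3 * n) + 1 =
      n + s + 1 - entryHeight n m s (3 * n) by omega, ← add_assoc]
  · intro s _ hs
    rw [Finset.mem_range, not_lt] at hs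
    rw [h.entryHeight_final hn hs, h.entryHeight_final hn (by omega), sub_self]

theorem GPath.le_hiveCol (hn : 1 ≤ n) (h : GPath n m) (s : ℕ) : s ≤ hiveCol n m s := by
  have := h.entryHeight_le hn s (3 * n) le_rfl
  rw [hiveCol]
  omega

theorem GPath.hiveCol_lt (hn : 1 ≤ n) (h : GPath n m) {s : ℕ} (hs : s < m (3 * n)) : hiveCol n m s < n := by
  have := h.le_entryHeight s (3 * n) le_rfl
  rw [hiveCol]
  omega

theorem GPath.hiveCol_le (h : GPath n m) {s : ℕ} (hs : s ≤ m (3 * n)) : hiveCol n m s ≤ n := by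
  have := h.le_entryHeight s (3 * n) le_rfl
  rw [hiveCol]
  omega

theorem GPath.hiveCol_succ (hn : 1 ≤ n) (h : GPath n m) (s : ℕ) :
    hiveCol n m s + 1 ≤ hiveCol n m (s + 1) := by
  have h1 := h.entryHeight_le hn s (3 * n) le_rfl
  have h2 := h.entryHeight_succ_le s (3 * n) le_rfl
  rw [hiveCol, hiveCol]
  omega

theorem GPath.hiveCol_succ_le (hn : 1 ≤ n) (h : GPath n m) (h' : GPath n m')
    (hlt : ∀ x ≤ 3 * n, m x < m' x) (s : ℕ) : hiveCol n m' (s + 1) ≤ hiveCol n m s := by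
  have h1 := h'.entryHeight_le hn (s + 1) (3 * n) le_rfl
  have h2 := h.entryHeight_lt h' s (3 * n) le_rfl hlt
  rw [hiveCol, hiveCol]
  omega

theorem GPath.sum_hiveWeight_add (hn : 1 ≤ n) (h : GPath n m) {t : ℕ → ℕ → ℝ} (ht : MemC3 n t)
    {q : ℕ} (hq : q < m (3 * n)) :
    ∑ y ∈ Finset.range (3 * n), hiveWeight n t y (m y) (m (y + 1)) + tabH t (m (3 * n) - 1) n ≤
      ∑ s ∈ Finset.range q, (tabD t s (hiveCol n m s) - tabD t s (hiveCol n m (s + 1))) +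
        tabD t q (hiveCol n m q) := by
  obtain ⟨f, hf⟩ : ∃ f, m (3 * n) = f + 1 := ⟨m (3 * n) - 1, by omega⟩
  have h1 : hiveCol n m (f + 1) = n := by
    rw [hiveCol, h.entryHeight_final hn hf.le, hf]
    omega
  refine le_trans (le_of_eq ?_) (ht.sum_tabD_le (r := f) (by omega) fun s hs =>
    ⟨h.le_hiveCol hn s, h.hiveCol_lt hn (by omega)⟩)
  rw [h.sum_hiveWeight hn, hf, Finset.sum_range_succ, ← add_assoc, sum_tabD_sub, h1,
    Nat.add_sub_cancel]
  simp only [tabH, tabV, tabD]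
  ring

theorem GPath.sum_hiveWeight_le (hn : 1 ≤ n) (h : GPath n m) {t : ℕ → ℕ → ℝ} (ht : MemC3 n t)
    {q : ℕ} (hq : q ≤ m (3 * n)) :
    ∑ y ∈ Finset.range (3 * n), hiveWeight n t y (m y) (m (y + 1)) ≤
      ∑ s ∈ Finset.range q, (tabD t s (hiveCol n m s) - tabD t s (hiveCol n m (s + 1))) +
        tabV t q (hiveCol n m q) := by
  rw [h.sum_hiveWeight hn, ← sum_tabD_sub, add_le_add_iff_left]
  refine le_of_succ_le (f := fun q => ∑ s ∈ Finset.range q,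
    (tabH t s (hiveCol n m s + 1) - tabH t s (hiveCol n m (s + 1)))) (n := m (3 * n))
    (fun s _ hs => ?_) hq le_rfl
  have := ht.tabH_mono (s := s) (Nat.succ_le_succ (h.le_hiveCol hn s)) (h.hiveCol_succ hn s)
    (h.hiveCol_le hs)
  rw [Finset.sum_range_succ]
  linarith

end HiveWeights

section HiveCompleteness

variable {n : ℕ}

theorem exists_weighting (w : ℕ → ℕ → ℕ → ℝ) :
    ∃ ε : (ℝ × ℝ) × (ℝ × ℝ) → ℝ, ∀ x a b, ε (gridEdge x a b) = w x a b :=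
  ⟨fun e => w ⌊e.1.1⌋₊ ⌊e.1.2⌋₊ ⌊e.2.2⌋₊, fun x a b => by simp [gridEdge]⟩

theorem StrictMono.val_le_apply {k : ℕ} {g : Fin k → ℕ} (hg : StrictMono g) (j : Fin k) :
    (j : ℕ) ≤ g j := by
  obtain ⟨j, hj⟩ := j
  induction j with
  | zero => exact Nat.zero_le _
  | succ j ih =>
    exact Nat.succ_le_of_lt ((ih (by omega)).trans_lt (hg (Fin.mk_lt_mk.2 j.lt_succ_self)))

theorem Antitone.sum_le_sum_initial {k i : ℕ} {f : Fin k → ℝ} (hf : Antitone f)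
    {S : Finset (Fin k)} (hS : S.card = i) :
    ∑ j ∈ S, f j ≤ ∑ j : Fin k, if (j : ℕ) < i then f j else 0 := by
  have hik : i ≤ k := by
    rw [← hS]
    exact S.card_le_univ.trans_eq (Fintype.card_fin k)
  have h1 : ∑ j ∈ S, f j = ∑ l : Fin i, f (S.orderEmbOfFin hS l) := by
    conv_lhs => rw [← Finset.map_orderEmbOfFin_univ S hS]
    rw [Finset.sum_map]
    rfl
  have h2 : (∑ j : Fin k, if (j : ℕ) < i then f j else 0) = ∑ l : Fin i, f (Fin.castLE hik l) := by
    rw [← Finset.sum_filter]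
    refine (Finset.sum_bij (fun l _ => Fin.castLE hik l) (by simp) (by simp) ?_ fun _ _ => rfl).symm
    intro b hb
    rw [Finset.mem_filter] at hb
    exact ⟨⟨b, hb.2⟩, Finset.mem_univ _, rfl⟩
  rw [h1, h2]
  refine Finset.sum_le_sum fun l _ => hf ?_
  have : StrictMono fun l => ((S.orderEmbOfFin hS l : Fin k) : ℕ) :=
    fun a b hab => (S.orderEmbOfFin hS).strictMono hab
  exact this.val_le_apply l

theorem IsFamily.lt_apply {k : ℕ} (hn : 1 ≤ n) {G : Fin k → ℕ → ℕ} (hG : IsFamily n G) (j : Fin k)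
    {x : ℕ} (hx : x ≤ 3 * n) : (j : ℕ) < G j x := by
  have h1 := fun j => ((hG.1 j).bounds hn x hx).1
  have : StrictMono fun j => G j x - 1 := fun a b hab => by
    have h2 : G a x < G b x := hG.2 x hx hab
    have := h1 a
    show G a x - 1 < G b x - 1
    omega
  have h3 : (j : ℕ) ≤ G j x - 1 := this.val_le_apply j
  have := h1 j
  omega

theorem familyWeight_le (hn : 1 ≤ n) {t : ℕ → ℕ → ℝ} (ht : MemC3 n t) (h0 : t 0 0 = 0)
    {ε : (ℝ × ℝ) × (ℝ × ℝ) → ℝ} (hε : ∀ x a b, ε (gridEdge x a b) = hiveWeight n t x a b)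
    {i k : ℕ} (hik : i ≤ k) {G : Fin k → ℕ → ℕ} (hG : IsFamily n G) {S : Finset (Fin k)}
    (hS : S.card = i) : familyWeight ε n G S ≤ t i k := by
  have hlt := fun j => hG.lt_apply hn j (le_refl (3 * n))
  have hanti : Antitone fun j => tabH t (G j (3 * n) - 1) n := fun a b hab => by
    have h1 : G a (3 * n) ≤ G b (3 * n) := (hG.2 (3 * n) le_rfl).monotone hab
    have h2 := ((hG.1 b).bounds hn (3 * n) le_rfl).2
    have h3 := ((hG.1 b).bounds hn (3 * n) le_rfl).1
    exact ht.tabH_last_anti (by omega) (by omega)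
  have hmark : ∑ j ∈ S, ε (gridEdge (3 * n) (G j (3 * n)) (G j (3 * n))) ≤
      ∑ j : Fin k, if (j : ℕ) < i then tabH t (G j (3 * n) - 1) n else 0 := by
    simp only [hε, hiveWeight, if_true]
    exact hanti.sum_le_sum_initial hS
  set κ : ℕ → ℕ → ℕ := fun j s => if h : j < k then hiveCol n (G ⟨j, h⟩) s else 0 with hκ
  have hκ' : ∀ j (h : j < k) s, κ j s = hiveCol n (G ⟨j, h⟩) s := fun j h s => dif_pos h
  have hlt' : ∀ j (h : j + 1 < k), ∀ x ≤ 3 * n, G ⟨j, by omega⟩ x < G ⟨j + 1, h⟩ x :=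
    fun j h x hx => hG.2 x hx (Fin.mk_lt_mk.2 j.lt_succ_self)
  have key := ht.total_le h0 hik (κ := κ)
    (fun j hj s hs => by
      rw [hκ' j hj]
      have : j < _ := hlt ⟨j, hj⟩
      exact (hG.1 _).hiveCol_lt hn (by omega))
    (fun j hj s => by
      rw [hκ' j hj]
      exact (hG.1 _).le_hiveCol hn s)
    (fun j hj s => by
      rw [hκ' j (by omega), hκ' (j + 1) hj]
      exact (hG.1 _).hiveCol_succ_le hn (hG.1 _) (hlt' j hj) s)
    (fun j hj s => by
      rw [hκ' j (by omega), hκ' (j + 1) hj]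
      have h1 := (hG.1 ⟨j, by omega⟩).hiveCol_succ_le hn (hG.1 _) (hlt' j hj) s
      have h2 := (hG.1 ⟨j + 1, hj⟩).hiveCol_succ hn s
      omega)
  refine le_trans ?_ key
  rw [← Fin.sum_univ_eq_sum_range (fun j => if j < i then
        ∑ s ∈ Finset.range j, (tabD t s (κ j s) - tabD t s (κ j (s + 1))) + tabD t j (κ j j)
      else ∑ s ∈ Finset.range i, (tabD t s (κ j s) - tabD t s (κ j (s + 1))) + tabV t i (κ j i)),
    familyWeight]
  refine (add_le_add_right hmark _).trans ?_
  rw [← Finset.sum_add_distrib]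
  refine Finset.sum_le_sum fun j _ => ?_
  have hj := hlt j
  simp only [hε, hκ' j j.2]
  split_ifs with hji
  · exact (hG.1 j).sum_hiveWeight_add hn ht hj
  · rw [add_zero]
    exact (hG.1 j).sum_hiveWeight_le hn ht (by omega)

/-- The path that starts at height `h` and descends to height `J` along the `J`-th diagonal of
slanted edges. -/
def descent (n J h : ℕ) : ℕ → ℕ
  | 0 => h
  | x + 1 => if x + 2 * descent n J h x + 2 = 2 * n + 3 * J ∧ J < descent n J h x then
      descent n J h x - 1 else descent n J h x

section Descent

variable {J h : ℕ}

theorem le_descent (hJ : J ≤ h) : ∀ x, J ≤ descent n J h x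
  | 0 => hJ
  | x + 1 => by
    have := le_descent hJ x
    rw [descent]
    split_ifs <;> omega

theorem descent_le : ∀ x, descent n J h x ≤ h
  | 0 => le_rfl
  | x + 1 => by
    have := descent_le x
    rw [descent]
    split_ifs <;> omega

theorem descent_eq_or (hJ : 1 ≤ J) (hn : h ≤ n) :
    ∀ x, x + 2 * descent n J h x + 2 ≤ 2 * n + 3 * J ∨ descent n J h x ≤ J
  | 0 => by rw [descent]; omega
  | x + 1 => by
    have := descent_eq_or hJ hn x
    rw [descent]
    split_ifs <;> omega

theorem descent_last (hJ : 1 ≤ J) (hJh : J ≤ h) (hn : h ≤ n) : descent n J h (3 * n) = J := by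
  have h1 := descent_eq_or hJ hn (3 * n)
  have h2 := le_descent (n := n) hJh (3 * n)
  omega

theorem gPath_descent (hJ : 1 ≤ J) (hJh : J ≤ h) (hn : h ≤ n) : GPath n (descent n J h) := by
  intro x _
  have h1 := le_descent (n := n) hJh x
  have h2 := descent_le (n := n) (J := J) (h := h) x
  refine ⟨by omega, by omega, ?_⟩
  rw [descent]
  split_ifs with hc
  · exact Or.inr ⟨by omega, J, hJ, by omega, by omega, by omega⟩
  · exact Or.inl rfl

theorem descent_lt (hJ : 1 ≤ J) (hn : h ≤ n) :
    ∀ x, descent n J h x < descent n (J + 1) (h + 1) x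
  | 0 => h.lt_succ_self
  | x + 1 => by
    have h1 := descent_lt hJ hn x
    have h2 := descent_eq_or hJ hn x
    rw [descent, descent]
    split_ifs <;> omega

theorem sum_hiveWeight_descent (hJ : 1 ≤ J) (hJh : J ≤ h) (hn : h ≤ n) (t : ℕ → ℕ → ℝ) :
    ∀ x < 3 * n, ∑ y ∈ Finset.range (x + 1),
      hiveWeight n t y (descent n J h y) (descent n J h (y + 1)) =
        tabV t 0 (n - h) + tabH t (J - 1) (n + J - h) -
          tabH t (J - 1) (n + J - descent n J h (x + 1))
  | 0, hx => by
    have h1 : descent n J h 1 = h := by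
      rw [descent, descent, if_neg (by omega)]
    rw [Finset.sum_range_one, zero_add, h1, descent, hiveWeight, if_neg (by omega), if_pos rfl,
      if_pos rfl]
    ring
  | x + 1, hx => by
    rw [Finset.sum_range_succ, sum_hiveWeight_descent hJ hJh hn t x (by omega)]
    rw [descent.eq_2 n J h (x + 1)]
    split_ifs with hc
    · rw [hiveWeight, if_neg (by omega), if_neg (by omega),
        show (x + 1 + 2 * descent n J h (x + 1) + 2 - 2 * n) / 3 = J by omega]
      ring
    · rw [hiveWeight, if_neg (by omega), if_pos rfl, if_neg (by omega), add_zero]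

theorem sum_hiveWeight_const (hn : 1 ≤ n) (t : ℕ → ℕ → ℝ) :
    ∑ y ∈ Finset.range (3 * n), hiveWeight n t y h h = tabV t 0 (n - h) := by
  rw [Finset.sum_eq_single 0]
  · rw [hiveWeight, if_neg (by omega), if_pos rfl, if_pos rfl]
  · intro y hy hy0
    rw [Finset.mem_range] at hy
    rw [hiveWeight, if_neg (by omega), if_pos rfl, if_neg hy0]
  · intro hc
    rw [Finset.mem_range] at hc
    omega

end Descent

theorem exists_familyWeight_eq (hn : 1 ≤ n) {t : ℕ → ℕ → ℝ} (h0 : t 0 0 = 0)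
    {ε : (ℝ × ℝ) × (ℝ × ℝ) → ℝ} (hε : ∀ x a b, ε (gridEdge x a b) = hiveWeight n t x a b)
    {i k : ℕ} (hik : i ≤ k) (hk : k ≤ n) :
    ∃ (G : Fin k → ℕ → ℕ) (S : Finset (Fin k)), S.card = i ∧ IsFamily n G ∧
      t i k = familyWeight ε n G S := by
  set G : ℕ → ℕ → ℕ := fun j => if j < i then descent n (j + 1) (n - k + j + 1)
    else fun _ => n - k + j + 1 with hG
  have hG1 : ∀ j < i, G j = descent n (j + 1) (n - k + j + 1) := fun j hj => if_pos hj
  have hG2 : ∀ j, i ≤ j → G j = fun _ => n - k + j + 1 := fun j hj => if_neg (by omega)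
  refine ⟨fun j => G j, Finset.univ.filter fun j => (j : ℕ) < i, ?_, ⟨fun j => ?_, fun x _ => ?_⟩, ?_⟩
  · rw [Fin.card_filter_val_lt, min_eq_right hik]
  · rcases Nat.lt_or_ge (j : ℕ) i with h | h
    · show GPath n (G j)
      rw [hG1 _ h]
      exact gPath_descent (by omega) (by omega) (by omega)
    · show GPath n (G j)
      rw [hG2 _ h]
      exact fun x _ => ⟨Nat.le_add_left 1 _, show n - k + j + 1 ≤ n by omega, Or.inl rfl⟩
  · have : StrictMono fun j => G j x := strictMono_nat_of_lt_succ fun j => by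
      rcases Nat.lt_or_ge (j + 1) i with h | h
      · rw [hG1 _ h, hG1 j (by omega)]
        exact descent_lt (by omega) (by omega) x
      · rw [hG2 _ h]
        rcases Nat.lt_or_ge j i with h' | h'
        · rw [hG1 j h']
          exact Nat.lt_succ_of_le (descent_le x)
        · rw [hG2 j h']
          exact Nat.lt_succ_self _
    exact fun a b hab => this hab
  · rw [familyWeight, Finset.sum_filter, ← Finset.sum_add_distrib]
    have : ∀ j : Fin k, (∑ x ∈ Finset.range (3 * n), ε (gridEdge x (G j x) (G j (x + 1))) +
        if (j : ℕ) < i then ε (gridEdge (3 * n) (G j (3 * n)) (G j (3 * n))) else 0) =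
        tabV t 0 (k - 1 - j) + if (j : ℕ) < i then tabH t j k else 0 := by
      intro j
      have hj := j.2
      simp only [hε]
      split_ifs with h
      · have h1 := sum_hiveWeight_descent (n := n) (J := j + 1) (h := n - k + j + 1) (by omega)
          (by omega) (by omega) t (3 * n - 1) (by omega)
        have h2 := descent_last (n := n) (J := j + 1) (h := n - k + j + 1) (by omega)
          (by omega) (by omega)
        rw [Nat.sub_add_cancel (by omega), h2] at h1
        rw [hG1 _ h, h1, h2, hiveWeight, if_pos rfl, Nat.add_sub_cancel, Nat.add_sub_cancel,
          show n - (n - k + j + 1) = k - 1 - j by omega,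
          show n + (j + 1) - (n - k + j + 1) = k by omega]
        ring
      · rw [hG2 _ (by omega)]
        simp only
        rw [sum_hiveWeight_const hn, show n - (n - k + j + 1) = k - 1 - j by omega]
    rw [Finset.sum_congr rfl fun j _ => this j,
      Fin.sum_univ_eq_sum_range (fun j => tabV t 0 (k - 1 - j) + if j < i then tabH t j k else 0),
      Finset.sum_add_distrib, Finset.sum_range_reflect (fun j => tabV t 0 j) k,
      ← Finset.sum_filter, show (Finset.range k).filter (· < i) = Finset.range i by
        ext j; simp; omega]
    simp only [tabV, tabH]
    rw [Finset.sum_range_sub (fun j => t 0 j), Finset.sum_range_sub (fun j => t j k), h0]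
    ring

end HiveCompleteness

section Compound

open Matrix

variable {R : Type*} [CommRing R] {k n : ℕ}

theorem exists_strictMono_comp {p : Fin k → Fin n} (hp : Function.Injective p) :
    ∃ (h : Fin k ↪o Fin n) (σ : Equiv.Perm (Fin k)), h ∘ σ = p := by
  have h1 : StrictMono (p ∘ Tuple.sort p) :=
    (Tuple.monotone_sort p).strictMono_of_injective (hp.comp (Tuple.sort p).injective)
  refine ⟨OrderEmbedding.ofStrictMono _ h1, (Tuple.sort p)⁻¹, ?_⟩
  ext i
  simp

theorem comp_perm_injective :
    Function.Injective fun q : (Fin k ↪o Fin n) × Equiv.Perm (Fin k) => (q.1 ∘ q.2 : Fin k → Fin n) := by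
  rintro ⟨h, σ⟩ ⟨h', σ'⟩ heq
  dsimp only at heq
  have hh : h = h' := by
    have h1 := congrArg Set.range heq
    rw [EquivLike.range_comp, EquivLike.range_comp, h.strictMono.range_inj h'.strictMono] at h1
    exact DFunLike.coe_injective h1
  subst hh
  refine Prod.ext rfl (Equiv.ext fun i => h.injective (congrFun heq i))

theorem Matrix.det_mul_eq_sum_minors (A : Matrix (Fin k) (Fin n) R) (B : Matrix (Fin n) (Fin k) R) :
    (A * B).det = ∑ h : Fin k ↪o Fin n, (A.submatrix id h).det * (B.submatrix h id).det := by
  have h1 : (A * B).det = ∑ p : Fin k → Fin n, (∏ i, A i (p i)) * (B.submatrix p id).det := by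
    have e : A * B = fun i => ∑ j, A i j • B j := by
      ext i l
      simp [Matrix.mul_apply, Finset.sum_apply]
    have := (Matrix.detRowAlternating (n := Fin k) (R := R)).toMultilinearMap.map_sum
      (fun i j => A i j • B j)
    calc (A * B).det = Matrix.detRowAlternating (n := Fin k) (R := R) fun i => ∑ j, A i j • B j := by
          rw [e]; rfl
      _ = ∑ p : Fin k → Fin n, Matrix.detRowAlternating (n := Fin k) (R := R)
            fun i => A i (p i) • B (p i) := this
      _ = _ := Finset.sum_congr rfl fun p _ =>
        (Matrix.detRowAlternating (n := Fin k) (R := R)).toMultilinearMap.map_smul_univ _ _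
  have h2 : ∀ h : Fin k ↪o Fin n, (A.submatrix id h).det * (B.submatrix h id).det =
      ∑ σ : Equiv.Perm (Fin k), (∏ i, A i ((h ∘ σ) i)) * (B.submatrix (h ∘ σ) id).det := by
    intro h
    rw [← Matrix.det_transpose, Matrix.det_apply', Finset.sum_mul]
    refine Finset.sum_congr rfl fun σ _ => ?_
    have e := Matrix.det_permute σ (B.submatrix h id)
    rw [Matrix.submatrix_submatrix] at e
    rw [show B.submatrix (h ∘ σ) id = B.submatrix (h ∘ σ) (id ∘ id) from rfl, e]
    simp only [Matrix.transpose_apply, Matrix.submatrix_apply, id, Function.comp]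
    ring
  rw [h1, Finset.sum_congr rfl fun h _ => h2 h, ← Fintype.sum_prod_type'
    fun (h : Fin k ↪o Fin n) (σ : Equiv.Perm (Fin k)) =>
      (∏ i, A i ((h ∘ σ) i)) * (B.submatrix (h ∘ σ) id).det]
  refine (Fintype.sum_of_injective _ comp_perm_injective _ _ (fun p hp => ?_) fun q => rfl).symm
  have hp' : ¬Function.Injective p := fun hinj => by
    obtain ⟨h, σ, hq⟩ := exists_strictMono_comp hinj
    exact hp ⟨(h, σ), hq⟩
  have h0 : (B.submatrix p id).det = 0 :=
    (Matrix.detRowAlternating (n := Fin k) (R := R)).map_eq_zero_of_not_injective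
      (B.submatrix p id) fun hinj => hp' fun i j hij => hinj (by ext l; simp [hij])
  rw [h0, mul_zero]

/-- The `k`-th compound matrix, whose entries are the minors of order `k`. -/
def compound (k : ℕ) (M : Matrix (Fin n) (Fin n) R) :
    Matrix (Fin k ↪o Fin n) (Fin k ↪o Fin n) R :=
  Matrix.of fun f g => (M.submatrix f g).det

theorem compound_mul (M N : Matrix (Fin n) (Fin n) R) :
    compound k (M * N) = compound k M * compound k N := by
  ext f g
  simp only [compound, Matrix.of_apply, Matrix.mul_apply]
  rw [show (M * N).submatrix f g = M.submatrix f id * N.submatrix id g from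
    Matrix.submatrix_mul _ _ _ _ _ Function.bijective_id, Matrix.det_mul_eq_sum_minors]
  rfl

theorem compound_diagonal (d : Fin n → R) :
    compound k (Matrix.diagonal d) = Matrix.diagonal fun f => ∏ j, d (f j) := by
  ext f g
  simp only [compound, Matrix.of_apply]
  by_cases hfg : f = g
  · subst hfg
    rw [Matrix.submatrix_diagonal _ _ f.injective, Matrix.det_diagonal, Matrix.diagonal_apply_eq]
    rfl
  · rw [Matrix.diagonal_apply_ne _ hfg, Matrix.det_apply']
    refine Finset.sum_eq_zero fun σ _ => ?_
    obtain ⟨i, hi⟩ : ∃ i, f (σ i) ≠ g i := by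
      by_contra! hc
      refine hfg (DFunLike.coe_injective ((f.strictMono.range_inj g.strictMono).1 ?_))
      rw [← show f ∘ σ = g from funext hc, EquivLike.range_comp]
    have h0 : (Matrix.diagonal d).submatrix f g (σ i) i = 0 := Matrix.diagonal_apply_ne d hi
    exact mul_eq_zero_of_right _ (Finset.prod_eq_zero (Finset.mem_univ i) h0)

theorem compound_one : compound k (1 : Matrix (Fin n) (Fin n) R) = 1 := by
  rw [← Matrix.diagonal_one, compound_diagonal]
  simp

theorem compound_transpose (M : Matrix (Fin n) (Fin n) R) :
    compound k Mᵀ = (compound k M)ᵀ := by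
  ext f g
  simp only [compound, Matrix.of_apply, Matrix.transpose_apply]
  rw [← Matrix.det_transpose]
  rfl

theorem SpecIs.trace_compound {A : Matrix (Fin n) (Fin n) ℂ} {a : Fin n → ℝ}
    (h : SpecIs A (valuesOf a)) (k : ℕ) :
    (compound k A).trace = ∑ f : Fin k ↪o Fin n, ∏ j, (a (f j) : ℂ) := by
  obtain ⟨U, hU, rfl⟩ := h.exists_unitary
  rw [compound_mul, Matrix.trace_mul_comm, compound_mul, ← mul_assoc, ← compound_mul,
    (Matrix.mem_unitaryGroup_iff').1 hU, compound_one, one_mul, rdiag, compound_diagonal,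
    Matrix.trace_diagonal]

theorem Matrix.det_eq_prod_diag_of_forall {M : Matrix (Fin k) (Fin k) R}
    (h : ∀ σ : Equiv.Perm (Fin k), σ ≠ 1 → ∃ i, M (σ i) i = 0) : M.det = ∏ i, M i i := by
  rw [Matrix.det_apply', Finset.sum_eq_single 1]
  · simp
  · intro σ _ hσ
    obtain ⟨i, hi⟩ := h σ hσ
    exact mul_eq_zero_of_right _ (Finset.prod_eq_zero (Finset.mem_univ i) hi)
  · simp

end Compound

section Exponential

open Matrix

variable {ι : Type*} [Fintype ι] [DecidableEq ι] {A : ℕ → ι → ι → Prop} {w : ℕ → ι → ι → ℝ} {s : ℝ}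

open Classical in
/-- The matrix with entry `exp (s w)` on allowed pairs and zero elsewhere. -/
noncomputable def expMatrix (A : ℕ → ι → ι → Prop) (w : ℕ → ι → ι → ℝ) (s : ℝ) (x : ℕ) :
    Matrix ι ι ℝ := Matrix.of fun a b => if A x a b then Real.exp (s * w x a b) else 0

/-- The ordered product of the first matrices of a sequence. -/
def seqProd {R : Type*} [Semiring R] (M : ℕ → Matrix ι ι R) : ℕ → Matrix ι ι R
  | 0 => 1
  | N + 1 => seqProd M N * M N

theorem expMatrix_nonneg (x : ℕ) (a b : ι) : 0 ≤ expMatrix A w s x a b := by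
  rw [expMatrix, Matrix.of_apply]
  split_ifs <;> positivity

theorem seqProd_expMatrix_nonneg : ∀ (N : ℕ) (a b : ι), 0 ≤ seqProd (expMatrix A w s) N a b
  | 0, a, b => by
    rw [seqProd, Matrix.one_apply]
    split_ifs <;> positivity
  | N + 1, a, b => by
    rw [seqProd, Matrix.mul_apply]
    exact Finset.sum_nonneg fun h _ =>
      mul_nonneg (seqProd_expMatrix_nonneg N a h) (expMatrix_nonneg N h b)

theorem exp_le_seqProd {c : ℕ → ι} : ∀ N, (∀ x < N, A x (c x) (c (x + 1))) →
    Real.exp (s * ∑ x ∈ Finset.range N, w x (c x) (c (x + 1))) ≤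
      seqProd (expMatrix A w s) N (c 0) (c N)
  | 0, _ => by simp [seqProd]
  | N + 1, h => by
    have ih := exp_le_seqProd N fun x hx => h x (by omega)
    rw [seqProd, Matrix.mul_apply, Finset.sum_range_succ, mul_add, Real.exp_add]
    refine le_trans ?_ (Finset.single_le_sum (f := fun j => seqProd (expMatrix A w s) N (c 0) j *
      expMatrix A w s N j (c (N + 1))) (fun j _ => mul_nonneg (seqProd_expMatrix_nonneg N _ _)
        (expMatrix_nonneg N _ _)) (Finset.mem_univ (c N)))
    have : expMatrix A w s N (c N) (c (N + 1)) = Real.exp (s * w N (c N) (c (N + 1))) :=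
      if_pos (h N (by omega))
    rw [this]
    exact mul_le_mul_of_nonneg_right ih (Real.exp_pos _).le

theorem seqProd_le_exp (hs : 0 ≤ s) : ∀ (N : ℕ) (f g : ι) (τ : ℝ),
    (∀ c : ℕ → ι, c 0 = f → c N = g → (∀ x < N, A x (c x) (c (x + 1))) →
      ∑ x ∈ Finset.range N, w x (c x) (c (x + 1)) ≤ τ) →
    seqProd (expMatrix A w s) N f g ≤ (Fintype.card ι : ℝ) ^ N * Real.exp (s * τ)
  | 0, f, g, τ, h => by
    rw [seqProd, Matrix.one_apply, pow_zero, one_mul]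
    split_ifs with hfg
    · have := h (fun _ => f) rfl hfg (by simp)
      rw [Finset.sum_range_zero] at this
      exact Real.one_le_exp (mul_nonneg hs this)
    · positivity
  | N + 1, f, g, τ, h => by
    rw [seqProd, Matrix.mul_apply]
    have key : ∀ j ∈ Finset.univ, seqProd (expMatrix A w s) N f j * expMatrix A w s N j g ≤
        (Fintype.card ι : ℝ) ^ N * Real.exp (s * τ) := by
      intro j _
      by_cases hj : A N j g
      · have ih := seqProd_le_exp hs N f j (τ - w N j g) fun c hc0 hcN hc => by
          have := h (fun x => if x ≤ N then c x else g) (by simpa using hc0) (by simp)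
            fun x hx => by
              rcases Nat.lt_or_ge x N with hxN | hxN
              · rw [if_pos (by omega), if_pos (by omega)]
                exact hc x hxN
              · obtain rfl : x = N := by omega
                rw [if_pos le_rfl, if_neg (by omega), hcN]
                exact hj
          rw [Finset.sum_range_succ, if_pos le_rfl, if_neg (by omega), hcN,
            Finset.sum_congr rfl fun x hx => by
              rw [if_pos (Finset.mem_range.1 hx).le, if_pos (Nat.succ_le_of_lt (Finset.mem_range.1 hx))]] at this
          linarith
        have e : expMatrix A w s N j g = Real.exp (s * w N j g) := if_pos hj
        rw [e]
        calc _ ≤ (Fintype.card ι : ℝ) ^ N * Real.exp (s * (τ - w N j g)) * Real.exp (s * w N j g) :=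
              mul_le_mul_of_nonneg_right ih (Real.exp_pos _).le
          _ = _ := by
              rw [mul_assoc, ← Real.exp_add]
              congr 2
              ring
      · have e : expMatrix A w s N j g = 0 := if_neg hj
        rw [e, mul_zero]
        positivity
    refine (Finset.sum_le_sum key).trans_eq ?_
    rw [Finset.sum_const, Finset.card_univ, nsmul_eq_mul, pow_succ]
    ring

end Exponential

section Transfer

open Matrix

variable {n k : ℕ}

/-- A path of the triangular network may go from height `a + 1` to height `b + 1` in column `x`. -/
def GStep (n x a b : ℕ) : Prop := a = b ∨ a = b + 1 ∧ Slant n x (b + 1)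

/-- The transfer matrix of a column of the triangular network. -/
noncomputable def transfer (n : ℕ) (ε : (ℝ × ℝ) × (ℝ × ℝ) → ℝ) (s : ℝ) (x : ℕ) :
    Matrix (Fin n) (Fin n) ℝ :=
  expMatrix (fun x (a b : Fin n) => GStep n x a b) (fun x a b => ε (gridEdge x (a + 1) (b + 1))) s x

theorem compound_transfer (ε : (ℝ × ℝ) × (ℝ × ℝ) → ℝ) (s : ℝ) (x : ℕ) :
    compound k (transfer n ε s x) = expMatrix
      (fun x (f g : Fin k ↪o Fin n) => ∀ j, GStep n x (f j) (g j))
      (fun x f g => ∑ j, ε (gridEdge x (f j + 1) (g j + 1))) s x := by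
  classical
  ext f g
  rw [compound, Matrix.of_apply, Matrix.det_eq_prod_diag_of_forall]
  · simp only [transfer, expMatrix, Matrix.of_apply, Matrix.submatrix_apply]
    split_ifs with h
    · rw [Finset.mul_sum, Real.exp_sum]
      exact Finset.prod_congr rfl fun j _ => if_pos (h j)
    · push Not at h
      obtain ⟨j, hj⟩ := h
      exact Finset.prod_eq_zero (Finset.mem_univ j) (if_neg hj)
  · intro σ hσ
    by_contra! hne
    have h1 : ∀ i, GStep n x (f (σ i)) (g i) := fun i => by
      by_contra hi
      exact hne i (if_neg hi)
    refine hσ ?_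
    have h2 : StrictMono σ := fun a b hab => by
      have h3 : g a < g b := g.strictMono hab
      have h4 : f (σ a) ≠ f (σ b) := fun h => hab.ne (σ.injective (f.injective h))
      have h5 := h1 a
      have h6 := h1 b
      rw [← f.lt_iff_lt]
      rw [Fin.lt_def] at h3 ⊢
      rw [Ne, Fin.ext_iff] at h4
      unfold GStep at h5 h6
      omega
    have h7 := (h2.range_inj strictMono_id).1 (by rw [σ.range_eq_univ, Set.range_id])
    exact Equiv.ext fun i => congrFun h7 i

theorem compound_seqProd (M : ℕ → Matrix (Fin n) (Fin n) ℝ) :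
    ∀ N, compound k (seqProd M N) = seqProd (fun x => compound k (M x)) N
  | 0 => compound_one
  | N + 1 => by rw [seqProd, compound_mul, compound_seqProd M N, seqProd]

theorem det_transfer_ne_zero (ε : (ℝ × ℝ) × (ℝ × ℝ) → ℝ) (s : ℝ) (x : ℕ) :
    (transfer n ε s x).det ≠ 0 := by
  rw [Matrix.det_of_isLowerTriangular]
  · refine Finset.prod_ne_zero_iff.2 fun i _ => ?_
    have : transfer n ε s x i i = Real.exp (s * ε (gridEdge x (i + 1) (i + 1))) := if_pos (Or.inl rfl)
    rw [this]
    exact (Real.exp_pos _).ne'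
  · intro a b hab
    refine if_neg fun h => ?_
    have h3 : a < b := hab
    rw [Fin.lt_def] at h3
    unfold GStep at h
    omega

theorem det_seqProd_ne_zero {M : ℕ → Matrix (Fin n) (Fin n) ℝ} (h : ∀ x, (M x).det ≠ 0) :
    ∀ N, (seqProd M N).det ≠ 0
  | 0 => by simp [seqProd]
  | N + 1 => by
    rw [seqProd, Matrix.det_mul]
    exact mul_ne_zero (det_seqProd_ne_zero h N) (h N)

/-- The path matrix of the triangular network, with the sinks weighted by `θ`. -/
noncomputable def pathMatrix (n : ℕ) (ε : (ℝ × ℝ) × (ℝ × ℝ) → ℝ) (θ : Fin n → ℝ) (s : ℝ) :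
    Matrix (Fin n) (Fin n) ℝ :=
  seqProd (transfer n ε s) (3 * n) * Matrix.diagonal fun j => Real.exp (s * θ j)

/-- The heights of disjoint paths, seen as a sequence of subsets of the columns. -/
def IsNetChain (n k : ℕ) (c : ℕ → Fin k ↪o Fin n) : Prop :=
  ∀ x < 3 * n, ∀ j, GStep n x (c x j) (c (x + 1) j)

/-- The weight of a family of disjoint paths, with the sinks weighted by `θ`. -/
noncomputable def chainWeight (ε : (ℝ × ℝ) × (ℝ × ℝ) → ℝ) (θ : Fin n → ℝ)
    (c : ℕ → Fin k ↪o Fin n) : ℝ :=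
  ∑ x ∈ Finset.range (3 * n), ∑ j, ε (gridEdge x (c x j + 1) (c (x + 1) j + 1)) +
    ∑ j, θ (c (3 * n) j)

theorem compound_pathMatrix (ε : (ℝ × ℝ) × (ℝ × ℝ) → ℝ) (θ : Fin n → ℝ) (s : ℝ)
    (f g : Fin k ↪o Fin n) :
    compound k (pathMatrix n ε θ s) f g = seqProd (expMatrix
      (fun x (f g : Fin k ↪o Fin n) => ∀ j, GStep n x (f j) (g j))
      (fun x f g => ∑ j, ε (gridEdge x (f j + 1) (g j + 1))) s) (3 * n) f g *
      Real.exp (s * ∑ j, θ (g j)) := by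
  rw [pathMatrix, compound_mul, compound_diagonal, compound_seqProd, Matrix.mul_diagonal,
    Finset.mul_sum, Real.exp_sum]
  congr 3
  exact funext fun x => compound_transfer ε s x

theorem compound_pathMatrix_nonneg (ε : (ℝ × ℝ) × (ℝ × ℝ) → ℝ) (θ : Fin n → ℝ) (s : ℝ)
    (f g : Fin k ↪o Fin n) : 0 ≤ compound k (pathMatrix n ε θ s) f g := by
  rw [compound_pathMatrix]
  exact mul_nonneg (seqProd_expMatrix_nonneg _ _ _) (Real.exp_pos _).le

theorem exp_le_compound_pathMatrix (ε : (ℝ × ℝ) × (ℝ × ℝ) → ℝ) (θ : Fin n → ℝ) (s : ℝ)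
    {c : ℕ → Fin k ↪o Fin n} (hc : IsNetChain n k c) :
    Real.exp (s * chainWeight ε θ c) ≤ compound k (pathMatrix n ε θ s) (c 0) (c (3 * n)) := by
  rw [compound_pathMatrix, chainWeight, mul_add, Real.exp_add]
  exact mul_le_mul_of_nonneg_right (exp_le_seqProd (A := fun x (f g : Fin k ↪o Fin n) =>
    ∀ j, GStep n x (f j) (g j)) (w := fun x f g => ∑ j, ε (gridEdge x (f j + 1) (g j + 1)))
    (3 * n) hc) (Real.exp_pos _).le

theorem compound_pathMatrix_le (ε : (ℝ × ℝ) × (ℝ × ℝ) → ℝ) (θ : Fin n → ℝ) {s : ℝ} (hs : 0 ≤ s)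
    {τ : ℝ} (hτ : ∀ c : ℕ → Fin k ↪o Fin n, IsNetChain n k c → chainWeight ε θ c ≤ τ)
    (f g : Fin k ↪o Fin n) :
    compound k (pathMatrix n ε θ s) f g ≤
      (Fintype.card (Fin k ↪o Fin n) : ℝ) ^ (3 * n) * Real.exp (s * τ) := by
  rw [compound_pathMatrix]
  calc _ ≤ (Fintype.card (Fin k ↪o Fin n) : ℝ) ^ (3 * n) * Real.exp (s * (τ - ∑ j, θ (g j))) *
        Real.exp (s * ∑ j, θ (g j)) :=
        mul_le_mul_of_nonneg_right (seqProd_le_exp hs _ _ _ _ fun c _ hcN hc => by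
          have := hτ c hc
          rw [chainWeight, hcN] at this
          linarith) (Real.exp_pos _).le
    _ = _ := by
        rw [mul_assoc, ← Real.exp_add]
        congr 2
        ring

end Transfer

section SpectralAsymptotics

open Matrix
open scoped ComplexOrder

variable {n k : ℕ}

theorem trace_compound_transpose_mul_self (Z : Matrix (Fin n) (Fin n) ℝ) :
    (compound k (Zᵀ * Z)).trace = ∑ g, ∑ f, compound k Z f g ^ 2 := by
  rw [compound_mul, compound_transpose, Matrix.trace]
  refine Finset.sum_congr rfl fun g _ => ?_
  rw [Matrix.diag_apply, Matrix.mul_apply]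
  exact Finset.sum_congr rfl fun f _ => by rw [Matrix.transpose_apply, sq]

theorem compound_map_ofReal (M : Matrix (Fin n) (Fin n) ℝ) :
    compound k (M.map Complex.ofReal) = (compound k M).map Complex.ofReal := by
  ext f g
  exact (RingHom.map_det Complex.ofRealHom (M.submatrix f g)).symm

theorem exists_specIs_transpose_mul_self {Z : Matrix (Fin n) (Fin n) ℝ} (hZ : Z.det ≠ 0) {s : ℝ}
    (hs : 0 < s) : ∃ a : Fin n → ℝ, Antitone a ∧
      SpecIs ((Zᵀ * Z).map Complex.ofReal) ((valuesOf a).map fun x => Real.exp (s * x)) := by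
  set W : Matrix (Fin n) (Fin n) ℂ := Z.map Complex.ofReal with hW
  have hdet : IsUnit W := by
    rw [Matrix.isUnit_iff_isUnit_det, isUnit_iff_ne_zero]
    have : W.det = ((Z.det : ℝ) : ℂ) := (RingHom.map_det Complex.ofRealHom Z).symm
    rw [this]
    exact_mod_cast hZ
  have hWW : (Zᵀ * Z).map Complex.ofReal = Wᴴ * W := by
    have h1 : (Zᵀ * Z).map Complex.ofReal = Zᵀ.map Complex.ofReal * W :=
      Matrix.map_mul (f := Complex.ofRealHom)
    rw [h1]
    congr 1
    ext i j
    simp [hW]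
  have hpos : (Wᴴ * W).PosDef :=
    Matrix.PosDef.conjTranspose_mul_self W (Matrix.mulVec_injective_iff_isUnit.2 hdet)
  obtain ⟨a, ha, hav⟩ := exists_valuesOf_eq (n := n)
    (s := (valuesOf hpos.1.eigenvalues).map fun x => Real.log x / s) (by
      rw [Multiset.card_map, card_valuesOf, Fintype.card_fin])
  refine ⟨a, ha, ?_⟩
  rw [hWW, hav, Multiset.map_map]
  have h2 : (valuesOf hpos.1.eigenvalues).map
      ((fun x => Real.exp (s * x)) ∘ fun x => Real.log x / s) = valuesOf hpos.1.eigenvalues := by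
    rw [valuesOf, Multiset.map_map]
    refine Multiset.map_congr rfl fun i _ => ?_
    simp only [Function.comp]
    rw [mul_div_cancel₀ _ hs.ne', Real.exp_log (hpos.eigenvalues_pos i)]
  rw [h2]
  exact hpos.1.specIs

theorem sum_exp_eq_trace_compound {M : Matrix (Fin n) (Fin n) ℝ} {a : Fin n → ℝ} {s : ℝ}
    (h : SpecIs (M.map Complex.ofReal) ((valuesOf a).map fun x => Real.exp (s * x))) (k : ℕ) :
    ∑ f : Fin k ↪o Fin n, Real.exp (s * ∑ j, a (f j)) = (compound k M).trace := by
  have h1 : (valuesOf a).map (fun x => Real.exp (s * x)) = valuesOf fun j => Real.exp (s * a j) := by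
    rw [valuesOf, Multiset.map_map]
    rfl
  rw [h1] at h
  have h2 := h.trace_compound k
  rw [compound_map_ofReal] at h2
  have h3 : ((compound k M).map Complex.ofReal).trace = (((compound k M).trace : ℝ) : ℂ) := by
    simp [Matrix.trace]
  rw [h3] at h2
  have h4 : (compound k M).trace = ∑ f : Fin k ↪o Fin n, ∏ j, Real.exp (s * a (f j)) := by
    exact_mod_cast h2
  rw [h4]
  exact Finset.sum_congr rfl fun f _ => by rw [Finset.mul_sum, Real.exp_sum]

theorem Antitone.sum_exp_bounds (hk : k ≤ n) {a : Fin n → ℝ} (ha : Antitone a) {s : ℝ} (hs : 0 ≤ s) :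
    Real.exp (s * ∑ j : Fin k, a (Fin.castLE hk j)) ≤
        ∑ f : Fin k ↪o Fin n, Real.exp (s * ∑ j, a (f j)) ∧
      ∑ f : Fin k ↪o Fin n, Real.exp (s * ∑ j, a (f j)) ≤
        Fintype.card (Fin k ↪o Fin n) * Real.exp (s * ∑ j : Fin k, a (Fin.castLE hk j)) := by
  constructor
  · exact Finset.single_le_sum (f := fun f : Fin k ↪o Fin n => Real.exp (s * ∑ j, a (f j)))
      (fun f _ => (Real.exp_pos _).le) (Finset.mem_univ (Fin.castLEOrderEmb hk))
  · rw [← nsmul_eq_mul, ← Finset.card_univ, ← Finset.sum_const]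
    refine Finset.sum_le_sum fun f _ => Real.exp_le_exp.2 (mul_le_mul_of_nonneg_left
      (Finset.sum_le_sum fun j _ => ha ?_) hs)
    have : StrictMono fun j => (f j : ℕ) := fun a b hab => f.strictMono hab
    exact this.val_le_apply j

/-- A constant controlling the distance between the spectral data and their tropical limit. -/
noncomputable def tropConst (n k : ℕ) : ℝ :=
  Real.log ((Fintype.card (Fin k ↪o Fin n) : ℝ) ^ 2 *
    ((Fintype.card (Fin k ↪o Fin n) : ℝ) ^ (3 * n)) ^ 2)

theorem abs_sum_sub_le (hk : k ≤ n) (ε : (ℝ × ℝ) × (ℝ × ℝ) → ℝ) (θ : Fin n → ℝ) {s : ℝ}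
    (hs : 0 < s) {τ : ℝ} (hτ : ∀ c : ℕ → Fin k ↪o Fin n, IsNetChain n k c → chainWeight ε θ c ≤ τ)
    {c : ℕ → Fin k ↪o Fin n} (hc : IsNetChain n k c) (hcτ : chainWeight ε θ c = τ)
    {a : Fin n → ℝ} (ha : Antitone a)
    (hspec : SpecIs (((pathMatrix n ε θ s)ᵀ * pathMatrix n ε θ s).map Complex.ofReal)
      ((valuesOf a).map fun x => Real.exp (2 * s * x))) :
    |∑ j : Fin k, a (Fin.castLE hk j) - τ| ≤ tropConst n k / (2 * s) := by
  set N : ℝ := (Fintype.card (Fin k ↪o Fin n) : ℝ) with hN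
  have hN1 : 1 ≤ N := by
    rw [hN]
    exact_mod_cast Fintype.card_pos_iff.2 ⟨c 0⟩
  obtain ⟨h1, h2⟩ := ha.sum_exp_bounds hk (mul_nonneg zero_le_two hs.le)
  rw [sum_exp_eq_trace_compound hspec k, trace_compound_transpose_mul_self] at h1 h2
  have h3 : ∑ g, ∑ f, compound k (pathMatrix n ε θ s) f g ^ 2 ≤
      N ^ 2 * (N ^ (3 * n)) ^ 2 * Real.exp (2 * s * τ) := by
    have : ∀ g ∈ Finset.univ, ∑ f, compound k (pathMatrix n ε θ s) f g ^ 2 ≤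
        N * (N ^ (3 * n) * Real.exp (s * τ)) ^ 2 := fun g _ => by
      rw [hN, ← nsmul_eq_mul, ← Finset.card_univ, ← Finset.sum_const]
      exact Finset.sum_le_sum fun f _ => pow_le_pow_left₀ (compound_pathMatrix_nonneg _ _ _ _ _)
        (compound_pathMatrix_le ε θ hs.le hτ f g) 2
    refine (Finset.sum_le_sum this).trans_eq ?_
    rw [Finset.sum_const, Finset.card_univ, nsmul_eq_mul, ← hN, mul_pow, ← Real.exp_nat_mul,
      show ((2 : ℕ) : ℝ) * (s * τ) = 2 * s * τ by push_cast; ring]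
    ring
  have h4 : Real.exp (2 * s * τ) ≤ ∑ g, ∑ f, compound k (pathMatrix n ε θ s) f g ^ 2 := by
    calc Real.exp (2 * s * τ) = Real.exp (s * τ) ^ 2 := by
          rw [← Real.exp_nat_mul]; push_cast; ring_nf
      _ ≤ compound k (pathMatrix n ε θ s) (c 0) (c (3 * n)) ^ 2 := by
          rw [← hcτ]
          exact pow_le_pow_left₀ (Real.exp_pos _).le (exp_le_compound_pathMatrix ε θ s hc) 2
      _ ≤ ∑ f, compound k (pathMatrix n ε θ s) f (c (3 * n)) ^ 2 :=
          Finset.single_le_sum (f := fun f => compound k (pathMatrix n ε θ s) f (c (3 * n)) ^ 2)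
            (fun f _ => sq_nonneg _) (Finset.mem_univ _)
      _ ≤ _ := Finset.single_le_sum
            (f := fun g => ∑ f, compound k (pathMatrix n ε θ s) f g ^ 2)
            (fun g _ => Finset.sum_nonneg fun f _ => sq_nonneg _) (Finset.mem_univ _)
  have hK : 0 < N ^ 2 * (N ^ (3 * n)) ^ 2 := by positivity
  have hNK : N ≤ N ^ 2 * (N ^ (3 * n)) ^ 2 := by
    have e1 : 1 ≤ (N ^ (3 * n)) ^ 2 := one_le_pow₀ (one_le_pow₀ hN1)
    nlinarith
  have h5 := h1.trans h3
  have h6 : Real.exp (2 * s * τ) ≤ N ^ 2 * (N ^ (3 * n)) ^ 2 *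
      Real.exp (2 * s * ∑ j : Fin k, a (Fin.castLE hk j)) :=
    (h4.trans h2).trans (mul_le_mul_of_nonneg_right hNK (Real.exp_pos _).le)
  rw [← Real.exp_log hK, ← Real.exp_add, Real.exp_le_exp] at h5 h6
  rw [abs_le, tropConst, ← hN, ← neg_div, div_le_iff₀ (by positivity), le_div_iff₀ (by positivity)]
  constructor <;> nlinarith

end SpectralAsymptotics

section BoundaryTriples

open Matrix Filter Topology

variable {n : ℕ}

/-- The family of disjoint paths described by a sequence of subsets of the columns. -/
def chainFamily {k : ℕ} (c : ℕ → Fin k ↪o Fin n) (j : Fin k) (x : ℕ) : ℕ := c x j + 1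

theorem IsNetChain.isFamily {k : ℕ} {c : ℕ → Fin k ↪o Fin n} (hc : IsNetChain n k c) :
    IsFamily n (chainFamily c) := by
  refine ⟨fun j x hx => ⟨Nat.le_add_left _ _, (c x j).isLt, ?_⟩, fun x _ a b hab =>
    Nat.succ_lt_succ ((c x).strictMono hab)⟩
  unfold chainFamily
  rcases hc x hx j with h | ⟨h1, h2⟩
  · exact Or.inl (by omega)
  · exact Or.inr ⟨by omega, h2⟩

theorem familyWeight_chainFamily_empty {k : ℕ} (ε : (ℝ × ℝ) × (ℝ × ℝ) → ℝ)
    (c : ℕ → Fin k ↪o Fin n) :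
    familyWeight ε n (chainFamily c) ∅ = chainWeight ε (fun _ => 0) c := by
  simp only [familyWeight, chainWeight, chainFamily, Finset.sum_empty, Finset.sum_const_zero]
  rw [Finset.sum_comm]

theorem familyWeight_chainFamily_univ {k : ℕ} (ε : (ℝ × ℝ) × (ℝ × ℝ) → ℝ)
    (c : ℕ → Fin k ↪o Fin n) :
    familyWeight ε n (chainFamily c) Finset.univ =
      chainWeight ε (fun m => ε (gridEdge (3 * n) (m + 1) (m + 1))) c := by
  simp only [familyWeight, chainWeight, chainFamily]
  rw [Finset.sum_comm]

theorem familyWeight_congr {k : ℕ} (ε : (ℝ × ℝ) × (ℝ × ℝ) → ℝ) {G G' : Fin k → ℕ → ℕ}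
    (h : ∀ j, ∀ x ≤ 3 * n, G j x = G' j x) (S : Finset (Fin k)) :
    familyWeight ε n G S = familyWeight ε n G' S := by
  refine congrArg₂ (· + ·) (Finset.sum_congr rfl fun j _ => Finset.sum_congr rfl fun x hx => ?_)
    (Finset.sum_congr rfl fun j _ => ?_)
  · rw [Finset.mem_range] at hx
    rw [h j x hx.le, h j (x + 1) hx]
  · rw [h j _ le_rfl]

theorem IsFamily.exists_chain (hn : 1 ≤ n) {k : ℕ} {G : Fin k → ℕ → ℕ} (hG : IsFamily n G) :
    ∃ c : ℕ → Fin k ↪o Fin n, IsNetChain n k c ∧ ∀ j, ∀ x ≤ 3 * n, G j x = chainFamily c j x := by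
  have hb := fun j x => (hG.1 j).bounds hn (min x (3 * n)) (min_le_right _ _)
  have hc : ∀ x, StrictMono fun j => (⟨G j (min x (3 * n)) - 1, by
      have := hb j x; omega⟩ : Fin n) := fun x a b hab => by
    have h1 : G a (min x (3 * n)) < G b (min x (3 * n)) := hG.2 _ (min_le_right _ _) hab
    have := hb a x
    exact Fin.mk_lt_mk.2 (by omega)
  have hv : ∀ j, ∀ x ≤ 3 * n, G j x =
      chainFamily (fun x => OrderEmbedding.ofStrictMono _ (hc x)) j x := fun j x hx => by
    have := hb j x
    rw [min_eq_left hx] at this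
    show G j x = G j (min x (3 * n)) - 1 + 1
    rw [min_eq_left hx]
    omega
  refine ⟨fun x => OrderEmbedding.ofStrictMono _ (hc x), fun x hx j => ?_, hv⟩
  have h1 := hv j x hx.le
  have h2 := hv j (x + 1) hx
  unfold chainFamily at h1 h2
  rcases (hG.1 j x hx).2.2 with h | ⟨h, hs⟩
  · exact Or.inl (by omega)
  · exact Or.inr ⟨by omega, by rwa [h2] at hs⟩

/-- The weights of the pairs consisting of `k` disjoint paths and `i` of their sinks. -/
def familyWeights (ε : (ℝ × ℝ) × (ℝ × ℝ) → ℝ) (n i k : ℕ) : Set ℝ :=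
  {y | ∃ (G : Fin k → ℕ → ℕ) (S : Finset (Fin k)), S.card = i ∧ IsFamily n G ∧
    y = familyWeight ε n G S}

theorem isGreatest_chainWeight_zero (hn : 1 ≤ n) {ε : (ℝ × ℝ) × (ℝ × ℝ) → ℝ} {k : ℕ} {τ : ℝ}
    (h : IsGreatest (familyWeights ε n 0 k) τ) :
    IsGreatest {y | ∃ c, IsNetChain n k c ∧ y = chainWeight ε (fun _ => 0) c} τ := by
  constructor
  · obtain ⟨G, S, hS, hG, rfl⟩ := h.1
    obtain rfl := Finset.card_eq_zero.1 hS
    obtain ⟨c, hc, e⟩ := hG.exists_chain hn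
    exact ⟨c, hc, (familyWeight_congr ε e _).trans (familyWeight_chainFamily_empty ε c)⟩
  · rintro y ⟨c, hc, rfl⟩
    exact h.2 ⟨_, ∅, rfl, hc.isFamily, (familyWeight_chainFamily_empty ε c).symm⟩

theorem isGreatest_chainWeight_sink (hn : 1 ≤ n) {ε : (ℝ × ℝ) × (ℝ × ℝ) → ℝ} {k : ℕ} {τ : ℝ}
    (h : IsGreatest (familyWeights ε n k k) τ) :
    IsGreatest {y | ∃ c, IsNetChain n k c ∧
      y = chainWeight ε (fun m => ε (gridEdge (3 * n) (m + 1) (m + 1))) c} τ := by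
  constructor
  · obtain ⟨G, S, hS, hG, rfl⟩ := h.1
    obtain rfl : S = Finset.univ := Finset.card_eq_iff_eq_univ _ |>.1 (by
      rw [hS, Fintype.card_fin])
    obtain ⟨c, hc, e⟩ := hG.exists_chain hn
    exact ⟨c, hc, (familyWeight_congr ε e _).trans (familyWeight_chainFamily_univ ε c)⟩
  · rintro y ⟨c, hc, rfl⟩
    exact h.2 ⟨_, Finset.univ, by simp, hc.isFamily, (familyWeight_chainFamily_univ ε c).symm⟩

theorem isFamily_full (n : ℕ) : IsFamily n fun (j : Fin n) _ => (j : ℕ) + 1 :=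
  ⟨fun j _ _ => ⟨Nat.le_add_left _ _, j.isLt, Or.inl rfl⟩, fun _ _ _ _ h => Nat.succ_lt_succ h⟩

theorem IsFamily.eq_full (hn : 1 ≤ n) {G : Fin n → ℕ → ℕ} (hG : IsFamily n G) (j : Fin n) {x : ℕ}
    (hx : x ≤ 3 * n) : G j x = j + 1 := by
  obtain ⟨c, -, e⟩ := hG.exists_chain hn
  rw [e j x hx, chainFamily]
  have h1 : ⇑(c x) = id := by
    refine (c x).strictMono.range_inj strictMono_id |>.1 ?_
    rw [Set.range_id, (Finite.surjective_of_injective (c x).injective).range_eq]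
  rw [h1, id]

/-- The maximal weights of `i` sinks of the full family grow by the ordered sink weights. -/
theorem sub_eq_sink_weight (hn : 1 ≤ n) {ε : (ℝ × ℝ) × (ℝ × ℝ) → ℝ} {b : Fin n → ℝ}
    (hb : Antitone b) {σ : Equiv.Perm (Fin n)}
    (hσ : b = (fun m : Fin n => ε (gridEdge (3 * n) (m + 1) (m + 1))) ∘ σ) {t : ℕ → ℝ}
    (ht : ∀ i ≤ n, IsGreatest (familyWeights ε n i n) (t i)) (j : Fin n) :
    t (j + 1) - t j = b j := by
  set H := familyWeight ε n (fun (j : Fin n) _ => (j : ℕ) + 1) ∅ with hH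
  have hw : ∀ S, familyWeight ε n (fun (j : Fin n) _ => (j : ℕ) + 1) S =
      H + ∑ j ∈ S.map σ.symm.toEmbedding, b j := fun S => by
    rw [hH, familyWeight, familyWeight, Finset.sum_empty, add_zero, Finset.sum_map, hσ]
    simp
  have key : ∀ i ≤ n, t i = H + ∑ j : Fin n, if (j : ℕ) < i then b j else 0 := fun i hi => by
    refine (ht i hi).unique ⟨?_, ?_⟩
    · refine ⟨fun j _ => (j : ℕ) + 1, (Finset.univ.filter fun j : Fin n => (j : ℕ) < i).map
        σ.toEmbedding, ?_, isFamily_full n, ?_⟩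
      · rw [Finset.card_map, Fin.card_filter_val_lt, min_eq_right hi]
      · rw [hw, Finset.map_map]
        have : σ.toEmbedding.trans σ.symm.toEmbedding = Function.Embedding.refl _ := by
          ext x; simp
        rw [this, Finset.map_refl, Finset.sum_filter]
    · rintro y ⟨G, S, hS, hG, rfl⟩
      rw [familyWeight_congr ε (fun j x hx => hG.eq_full hn j hx), hw]
      gcongr
      exact hb.sum_le_sum_initial (by rw [Finset.card_map, hS])
  rw [key _ j.isLt, key _ j.isLt.le, add_sub_add_left_eq_sub, ← Finset.sum_sub_distrib,
    Finset.sum_eq_single j]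
  · simp
  · intro l _ hl
    have : (l : ℕ) ≠ j := fun h => hl (Fin.ext h)
    by_cases h : (l : ℕ) < j
    · rw [if_pos (by omega), if_pos h, sub_self]
    · rw [if_neg (by omega), if_neg h, sub_self]
  · simp

theorem mRel_pathMatrix {ε : (ℝ × ℝ) × (ℝ × ℝ) → ℝ} {θ a c : Fin n → ℝ} {s : ℝ}
    (ha : SpecIs (((pathMatrix n ε (fun _ => 0) s)ᵀ * pathMatrix n ε (fun _ => 0) s).map
      Complex.ofReal) ((valuesOf a).map fun x => Real.exp (2 * s * x)))
    (hc : SpecIs (((pathMatrix n ε θ s)ᵀ * pathMatrix n ε θ s).map Complex.ofReal)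
      ((valuesOf c).map fun x => Real.exp (2 * s * x))) :
    MRel n (2 * s) (valuesOf a) (valuesOf θ) (valuesOf c) := by
  refine ⟨rdiag fun j => Real.exp (s * θ j), _, 0, _, ?_, ha, ?_, hc, ?_⟩
  · have : (valuesOf θ).map (fun x => Real.exp (2 * s * x / 2)) =
        valuesOf fun j => Real.exp (s * θ j) := by
      rw [valuesOf, Multiset.map_map]
      refine Multiset.map_congr rfl fun j _ => ?_
      simp only [Function.comp]
      ring_nf
    rw [this]
    exact specIs_rdiag _
  · have := specIs_rdiag (fun _ : Fin n => (0 : ℝ))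
    rwa [valuesOf_const, rdiag_const, Fintype.card_fin, zero_smul] at this
  · have h0 : pathMatrix n ε (fun _ => 0) s = seqProd (transfer n ε s) (3 * n) := by
      rw [pathMatrix]
      simp
    set D : Matrix (Fin n) (Fin n) ℝ := Matrix.diagonal fun j => Real.exp (s * θ j) with hD
    have hR : (rdiag fun j => Real.exp (s * θ j)) = D.map Complex.ofReal := by
      rw [hD, rdiag, Matrix.diagonal_map Complex.ofReal_zero]
    have h1 : pathMatrix n ε θ s = pathMatrix n ε (fun _ => 0) s * D := by
      rw [h0, pathMatrix]
    have hm : ∀ M N : Matrix (Fin n) (Fin n) ℝ,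
        (M * N).map Complex.ofReal = M.map Complex.ofReal * N.map Complex.ofReal :=
      fun M N => Matrix.map_mul (f := Complex.ofRealHom)
    rw [add_zero, hR, ← hm, ← hm, h1, Matrix.transpose_mul, hD, Matrix.diagonal_transpose]
    simp only [Matrix.mul_assoc]

theorem det_pathMatrix_ne_zero (ε : (ℝ × ℝ) × (ℝ × ℝ) → ℝ) (θ : Fin n → ℝ) (s : ℝ) :
    (pathMatrix n ε θ s).det ≠ 0 := by
  rw [pathMatrix, Matrix.det_mul, Matrix.det_diagonal]
  exact mul_ne_zero (det_seqProd_ne_zero (det_transfer_ne_zero ε s) _)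
    (Finset.prod_ne_zero_iff.2 fun j _ => (Real.exp_pos _).ne')

/-- Convergence of partial sums implies convergence of the terms. -/
theorem tendsto_of_tendsto_sum {a : ℕ → Fin n → ℝ} {τ : ℕ → ℝ}
    (h : ∀ k, ∀ hk : k ≤ n, Tendsto (fun N => ∑ j : Fin k, a N (Fin.castLE hk j)) atTop (𝓝 (τ k))) :
    Tendsto a atTop (𝓝 fun j => τ (j + 1) - τ j) := by
  refine tendsto_pi_nhds.2 fun j => ?_
  refine ((h (j + 1) j.isLt).sub (h j j.isLt.le)).congr fun N => ?_
  rw [Fin.sum_univ_castSucc]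
  exact add_sub_cancel_left _ _

/-- The boundary differences of the maximal weights form a Horn triple. -/
theorem boundary_mem_hSet (hn : 1 ≤ n) {ε : (ℝ × ℝ) × (ℝ × ℝ) → ℝ} {t : ℕ → ℕ → ℝ}
    (ht : ∀ k ≤ n, ∀ i ≤ k, IsGreatest (familyWeights ε n i k) (t i k)) :
    ((fun j => t 0 (j + 1) - t 0 j, fun j => t (j + 1) n - t j n,
      fun j => t (j + 1) (j + 1) - t j j) : (Fin n → ℝ) × (Fin n → ℝ) × (Fin n → ℝ)) ∈ HSet n := by
  set δ : Fin n → ℝ := fun m => ε (gridEdge (3 * n) (m + 1) (m + 1)) with hδ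
  obtain ⟨b, hb, hbδ⟩ := exists_valuesOf_eq (n := n) (s := valuesOf δ) (by
    rw [card_valuesOf, Fintype.card_fin])
  obtain ⟨σ, hσ⟩ := exists_perm_of_valuesOf_eq hbδ
  have hμ : (fun j : Fin n => t (j + 1) n - t j n) = b :=
    funext fun j => sub_eq_sink_weight (t := fun i => t i n) hn hb hσ (fun i hi => ht n le_rfl i hi) j
  rw [hμ]
  have hs : ∀ N : ℕ, (0 : ℝ) < N + 1 := fun N => by positivity
  choose a ha hspa using fun N : ℕ => exists_specIs_transpose_mul_self
    (det_pathMatrix_ne_zero ε (fun _ : Fin n => 0) ((N : ℝ) + 1)) (mul_pos two_pos (hs N))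
  choose c hc hspc using fun N : ℕ => exists_specIs_transpose_mul_self
    (det_pathMatrix_ne_zero ε δ ((N : ℝ) + 1)) (mul_pos two_pos (hs N))
  have hmem : ∀ N, (a N, b, c N) ∈ HSet n := fun N => by
    refine ⟨ha N, hb, hc N, hRel_iff.1 ?_⟩
    have := (mRel_pathMatrix (hspa N) (hspc N)).hRel _ (mul_pos two_pos (hs N))
    rwa [← hbδ] at this
  have hlim : ∀ C : ℝ, Tendsto (fun N : ℕ => C / (2 * ((N : ℝ) + 1))) atTop (𝓝 0) := fun C =>
    (tendsto_const_nhds (x := C)).div_atTop (Tendsto.const_mul_atTop two_pos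
      (tendsto_atTop_add_const_right _ _ tendsto_natCast_atTop_atTop))
  have hta : Tendsto a atTop (𝓝 fun j => t 0 (j + 1) - t 0 j) :=
    tendsto_of_tendsto_sum (τ := fun k => t 0 k) fun k hk => by
      have h := isGreatest_chainWeight_zero hn (ht k hk 0 (Nat.zero_le _))
      obtain ⟨c, hc, e⟩ := h.1
      refine tendsto_iff_norm_sub_tendsto_zero.2 (squeeze_zero (fun _ => norm_nonneg _)
        (fun N => ?_) (hlim (tropConst n k)))
      exact abs_sum_sub_le hk ε (fun _ => 0) (hs N) (fun c' hc' => h.2 ⟨c', hc', rfl⟩) hc e.symm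
        (ha N) (hspa N)
  have htc : Tendsto c atTop (𝓝 fun j => t (j + 1) (j + 1) - t j j) :=
    tendsto_of_tendsto_sum (τ := fun k => t k k) fun k hk => by
      have h := isGreatest_chainWeight_sink hn (ht k hk k le_rfl)
      obtain ⟨c', hc', e⟩ := h.1
      refine tendsto_iff_norm_sub_tendsto_zero.2 (squeeze_zero (fun _ => norm_nonneg _)
        (fun N => ?_) (hlim (tropConst n k)))
      exact abs_sum_sub_le hk ε δ (hs N) (fun c' hc' => h.2 ⟨c', hc', rfl⟩) hc' e.symm
        (hc N) (hspc N)
  exact (isClosed_hSet n).mem_of_tendsto (hta.prodMk_nhds (tendsto_const_nhds.prodMk_nhds htc))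
    (Eventually.of_forall hmem)

end BoundaryTriples

theorem sideDiff_eq_tableau {n : ℕ} (f : ℕ → ℕ → ℕ → ℝ) (j : Fin n) :
    (sideDiff n f).1 j = f 0 ((j : ℕ) + 1 - 0) (n - (j + 1)) - f 0 ((j : ℕ) - 0) (n - j) ∧
    (sideDiff n f).2.1 j = f (j + 1) (n - (j + 1)) (n - n) - f j (n - j) (n - n) ∧
    (sideDiff n f).2.2 j =
      f (j + 1) ((j : ℕ) + 1 - (j + 1)) (n - (j + 1)) - f j ((j : ℕ) - j) (n - j) := by
  simp only [Nat.sub_self, Nat.sub_zero]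
  exact ⟨rfl, rfl, rfl⟩

theorem exists_isGreatest_of_memC3 {n : ℕ} (hn : 1 ≤ n) {t : ℕ → ℕ → ℝ} (ht : MemC3 n t)
    (h0 : t 0 0 = 0) : ∃ ε : (ℝ × ℝ) × (ℝ × ℝ) → ℝ,
      ∀ k, k ≤ n → ∀ i, i ≤ k → IsGreatest (familyWeights ε n i k) (t i k) := by
  obtain ⟨ε, hε⟩ := exists_weighting (hiveWeight n t)
  refine ⟨ε, fun k hk i hik => ⟨exists_familyWeight_eq hn h0 hε hik hk, ?_⟩⟩
  rintro y ⟨G, S, hS, hG, rfl⟩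
  exact familyWeight_le hn ht h0 hε hik hG hS

/-- Theorem `thm:Horn2` combined with the Knutson–Tao
theorem.  Let `Γ₀` be the triangular planar network of rank `n`, realized on
the integer grid of the strip `{0 ≤ x ≤ 3n}` with unit horizontal edges and
slanted edges `a_{r,s}` from `(2(n−1−r)+3(s−1)+1, r+1)` down to
`(2(n−1−r)+3(s−1)+2, r)` for `1 ≤ s ≤ r ≤ n−1`, and let `Δ₀` be the trivial
network of `n` parallel horizontal edges on the strip `{3n ≤ x ≤ 3n+1}`.
Then (1) every tableau `t ∈ C₃` with `t 0 0 = 0` arises as the array of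
values `m_i^k(ε)` of some weighting `ε` of `Γ₀ ∘ Δ₀`, and (2) the set of
boundary-difference triples `(λ, μ, ν)` of such arrays — the image of
`∂ ∘ M_{Γ₀Δ₀}` — equals the closure of the Horn cone. -/
theorem hive_completeness_and_KnutsonTao (n : ℕ) (hn : 1 ≤ n)
    (Γ₀ Δ₀ : PlanarNetwork)
    (hΓa : Γ₀.a = 0) (hΓb : Γ₀.b = 3 * n)
    (hΓV : ∀ p : ℝ × ℝ, p ∈ Γ₀.V ↔
      ∃ j m : ℕ, j ≤ 3 * n ∧ 1 ≤ m ∧ m ≤ n ∧ p = ((j : ℝ), (m : ℝ)))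
    (hΓE : ∀ e : (ℝ × ℝ) × (ℝ × ℝ), e ∈ Γ₀.E ↔
      ((∃ j m : ℕ, j + 1 ≤ 3 * n ∧ 1 ≤ m ∧ m ≤ n ∧
          e = (((j : ℝ), (m : ℝ)), ((j : ℝ) + 1, (m : ℝ)))) ∨
       (∃ r s : ℕ, 1 ≤ s ∧ s ≤ r ∧ r + 1 ≤ n ∧
          e = ((((2 * (n - 1 - r) + 3 * (s - 1) + 1 : ℕ) : ℝ), (r : ℝ) + 1),
               (((2 * (n - 1 - r) + 3 * (s - 1) + 2 : ℕ) : ℝ), (r : ℝ))))))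
    (hΔa : Δ₀.a = 3 * n) (hΔb : Δ₀.b = 3 * n + 1)
    (hΔV : ∀ p : ℝ × ℝ, p ∈ Δ₀.V ↔
      ∃ m : ℕ, 1 ≤ m ∧ m ≤ n ∧
        (p = ((3 * n : ℝ), (m : ℝ)) ∨ p = ((3 * n : ℝ) + 1, (m : ℝ))))
    (hΔE : ∀ e : (ℝ × ℝ) × (ℝ × ℝ), e ∈ Δ₀.E ↔
      ∃ m : ℕ, 1 ≤ m ∧ m ≤ n ∧
        e = (((3 * n : ℝ), (m : ℝ)), ((3 * n : ℝ) + 1, (m : ℝ)))) :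
    (∀ t : ℕ → ℕ → ℝ, MemC3 n t → t 0 0 = 0 →
      ∃ ε : (ℝ × ℝ) × (ℝ × ℝ) → ℝ,
        ∀ k, k ≤ n → ∀ i, i ≤ k → IsGreatest (gdWeights Γ₀ Δ₀ ε i k) (t i k)) ∧
    ({ p : (Fin n → ℝ) × (Fin n → ℝ) × (Fin n → ℝ) |
        ∃ (ε : (ℝ × ℝ) × (ℝ × ℝ) → ℝ) (t : ℕ → ℕ → ℝ),
          (∀ k, k ≤ n → ∀ i, i ≤ k →
            IsGreatest (gdWeights Γ₀ Δ₀ ε i k) (t i k)) ∧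
          (∀ j : Fin n,
            p.1 j = t 0 ((j : ℕ) + 1) - t 0 (j : ℕ) ∧
            p.2.1 j = t ((j : ℕ) + 1) n - t (j : ℕ) n ∧
            p.2.2 j = t ((j : ℕ) + 1) ((j : ℕ) + 1) - t (j : ℕ) (j : ℕ)) }
      = closure (HornCone n)) := by
  have hw : ∀ (ε : (ℝ × ℝ) × (ℝ × ℝ) → ℝ) (i k : ℕ),
      gdWeights Γ₀ Δ₀ ε i k = familyWeights ε n i k := fun ε i k => Set.ext fun y =>
    mem_gdWeights_iff hn (fun L => isThroughPath_iff hn hΓa hΓb hΓE)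
      (fun L => isThroughPath_trivial_iff hΔa hΔb hΔE)
  simp only [hw]
  refine ⟨fun t ht h0 => exists_isGreatest_of_memC3 hn ht h0, ?_⟩
  rw [hornCone_eq_hSet, (isClosed_hSet n).closure_eq]
  refine Set.Subset.antisymm ?_ fun p hp => ?_
  · rintro p ⟨ε, t, ht, hp⟩
    have h := boundary_mem_hSet hn ht
    have e : p = (fun j : Fin n => t 0 (j + 1) - t 0 j, fun j : Fin n => t (j + 1) n - t j n,
        fun j : Fin n => t (j + 1) (j + 1) - t j j) :=
      Prod.ext (funext fun j => (hp j).1) (Prod.ext (funext fun j => (hp j).2.1)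
        (funext fun j => (hp j).2.2))
    rwa [e]
  · obtain ⟨f, hf, h0, rfl⟩ := hSet_subset_hiveSet n hp
    obtain ⟨ε, hε⟩ := exists_isGreatest_of_memC3 hn hf.memC3 (by simpa using h0)
    exact ⟨ε, _, hε, sideDiff_eq_tableau f⟩
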